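/- Every simple graph of order 12 with minimum degree at least 6 contains a K_6 minor. -/

import Mathlib

attribute [local instance] Classical.propDecidable

/-- `G` contains a `K_t` minor: `t` pairwise disjoint nonempty branch sets, each inducing a
connected subgraph of `G`, with an edge of `G` between any two of them. -/
def SimpleGraph.HasCompleteMinor {V : Type*} (G : SimpleGraph V) (t : ℕ) : Prop :=
  ∃ B : Fin t → Set V,
    (∀ i, (B i).Nonempty) ∧
    (∀ i, (G.induce (B i)).Connected) ∧
    (∀ i j, i ≠ j → Disjoint (B i) (B j)) ∧
    (∀ i j, i ≠ j → ∃ u ∈ B i, ∃ v ∈ B j, G.Adj u v)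

namespace K6

/-! ### The certificate checker -/

/-- Refutation trees. -/
inductive T : Type
  | m (c : ℕ) : T
  | d (v : ℕ) : T
  | l (k s : ℕ) : T
  | f (v : ℕ) (t : T) : T
  | r (e : ℕ) (a b : T) : T

/-- Evaluate the argument before passing it on. -/
def force (x : ℕ) (f : ℕ → Bool) : Bool := Nat.rec (f 0) (fun n _ => f (Nat.succ n)) x

theorem force_eq (x : ℕ) (f : ℕ → Bool) : force x f = f x := by
  cases x <;> rfl

/-- Bit test. -/
def tb (m i : ℕ) : Bool := Nat.beq (Nat.land (Nat.shiftRight m i) (nat_lit 1)) (nat_lit 1)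

theorem tb_eq (m i : ℕ) : tb m i = m.testBit i := by
  have h : tb m i = Nat.beq ((m >>> i) &&& 1) 1 := rfl
  rw [h, Nat.testBit, Nat.and_comm]
  have h2 : 1 &&& (m >>> i) = (m >>> i) % 2 := by
    rw [Nat.and_comm, Nat.and_one_is_mod]
  rw [h2]
  rcases Nat.mod_two_eq_zero_or_one (m >>> i) with h | h <;> rw [h] <;> rfl

def bit (i : ℕ) : ℕ := Nat.pow (nat_lit 2) i

theorem bit_test (i j : ℕ) : (bit i).testBit j = true ↔ i = j := by
  have : bit i = 2 ^ i := rfl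
  rw [this, Nat.testBit_two_pow]; simp

/-- Conjunction over all `i < n`. -/
def allB (n : ℕ) (f : ℕ → Bool) : Bool :=
  Nat.rec true (fun n ih => cond (f n) ih false) n

theorem allB_spec {n : ℕ} {f : ℕ → Bool} (h : allB n f = true) : ∀ i < n, f i = true := by
  induction n with
  | zero => intro i hi; omega
  | succ n ih =>
    intro i hi
    change cond (f n) (allB n f) false = true at h
    cases hf : f n with
    | false => rw [hf] at h; simp at h
    | true =>
      rw [hf] at h
      rcases Nat.lt_succ_iff_lt_or_eq.mp hi with h1 | h1
      · exact ih h i h1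
      · rw [h1]; exact hf

/-- Union of the rows of the members of `R` among the first `n` vertices. -/
def nb (P R n : ℕ) : ℕ :=
  Nat.rec (nat_lit 0) (fun n ih => cond (tb R n)
    (Nat.lor ih (Nat.land (Nat.shiftRight P (Nat.mul (nat_lit 12) n)) (nat_lit 4095))) ih) n

/-- Grow a connected set until it is `B`. -/
def grow (P B k : ℕ) : ℕ → Bool :=
  Nat.rec (fun _ => false) (fun _ ih R => cond (Nat.beq R B) true
      (force (Nat.lor R (Nat.land (nb P R (nat_lit 12)) B)) ih)) k

/-- Some member of `B`. -/
def top (B n : ℕ) : ℕ := Nat.rec (nat_lit 0) (fun n ih => cond (tb B n) n ih) n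

def conn (P B : ℕ) : Bool :=
  force (top B (nat_lit 12)) fun b =>
    cond (Nat.ble b (nat_lit 11)) (force (bit b) (grow P B (nat_lit 12))) false

def blk (code a : ℕ) : ℕ := Nat.land (Nat.shiftRight code (Nat.mul (nat_lit 12) a)) (nat_lit 4095)

def minorB (P code : ℕ) : Bool :=
  force code fun code => allB (nat_lit 6) fun a => force (blk code a) fun A =>
    cond (conn P A)
      (force (nb P A (nat_lit 12)) fun X =>
        allB a fun b => force (blk code b) fun B =>
          cond (Nat.beq (Nat.land A B) (nat_lit 0)) (cond (Nat.beq (Nat.land X B) (nat_lit 0)) false true) false)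
      false

def cnt (N v n : ℕ) : ℕ :=
  Nat.rec (nat_lit 0) (fun j ih => cond (tb N (Nat.add (Nat.mul (nat_lit 12) v) j)) (Nat.succ ih) ih) n

def addE (P i j : ℕ) : ℕ :=
  Nat.lor P (Nat.lor (bit (Nat.add (Nat.mul (nat_lit 12) i) j)) (bit (Nat.add (Nat.mul (nat_lit 12) j) i)))

def addB (P e : ℕ) : ℕ := addE P (Nat.div e (nat_lit 12)) (Nat.mod e (nat_lit 12))

def frc (N v P n : ℕ) : ℕ :=
  Nat.rec P (fun j ih => cond (tb N (Nat.add (Nat.mul (nat_lit 12) v) j)) ih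
      (cond (Nat.beq j v) ih (addE ih v j))) n

def sg (s i : ℕ) : ℕ := Nat.land (Nat.shiftRight s (Nat.mul (nat_lit 4) i)) (nat_lit 15)

def occ (s n : ℕ) : ℕ :=
  Nat.rec (nat_lit 0) (fun n ih => Nat.lor ih (bit (sg s n))) n

def permB (s : ℕ) : Bool := Nat.beq (occ s (nat_lit 12)) (nat_lit 4095)

/-- The first base-256 digit. -/
def dg (m : ℕ) : ℕ := Nat.land m (nat_lit 255)

/-- The remaining base-256 digits. -/
def tl (m : ℕ) : ℕ := Nat.shiftRight m (nat_lit 8)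

def sub (s P k : ℕ) : ℕ → Bool :=
  Nat.rec (fun m => Nat.beq m (nat_lit 0)) (fun _ ih m => cond (Nat.beq m (nat_lit 0)) true
      (force (dg m) fun b => cond (Nat.ble b (nat_lit 143))
        (cond (tb P (Nat.add (Nat.mul (nat_lit 12) (sg s (Nat.div b (nat_lit 12))))
            (sg s (Nat.mod b (nat_lit 12)))))
          (force (tl m) ih) false) false)) k

def sy (k : ℕ) : ℕ → ℕ → (ℕ → Bool) → Bool :=
  Nat.rec (fun _ acc f => f acc) (fun _ ih m acc f => cond (Nat.beq m (nat_lit 0)) (f acc)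
      (force (dg m) fun b => cond (Nat.beq b (nat_lit 0)) false
        (cond (Nat.ble b (nat_lit 143))
          (force (addB acc b) fun acc2 => force (tl m) fun m2 => ih m2 acc2 f) false))) k

def nth (l : List (ℕ × ℕ)) : ℕ → (ℕ → ℕ → Bool) → Bool :=
  List.rec (fun _ _ => false)
    (fun x _ ih k f => Nat.rec (f x.1 x.2) (fun n _ => ih n f) k) l

noncomputable def chk (env : List (ℕ × ℕ)) (t : T) : ℕ → ℕ → Bool :=
  T.rec (fun c P _ => minorB P c)
    (fun v _ N => cond (Nat.ble v (nat_lit 11)) (Nat.ble (nat_lit 6) (cnt N v (nat_lit 12))) false)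
    (fun k s P N => nth env k fun p n => force s fun s =>
      cond (permB s) (cond (sub s P (nat_lit 70) p) (sub s N (nat_lit 70) n) false) false)
    (fun v _ ih P N => force v fun v => cond (Nat.ble v (nat_lit 11))
      (cond (Nat.ble (nat_lit 5) (cnt N v (nat_lit 12)))
        (force (frc N v P (nat_lit 12)) fun P2 => ih P2 N) false) false)
    (fun e _ _ iha ihb P N => force e fun e => cond (Nat.ble e (nat_lit 143))
      (cond (Nat.beq (Nat.div e (nat_lit 12)) (Nat.mod e (nat_lit 12))) false
        (cond (force (addB P e) fun P2 => iha P2 N)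
          (force (addB N e) fun N2 => ihb P N2) false)) false) t

/-- A lemma: known edges, known non-edges, refutation. -/
structure L : Type where
  p : ℕ
  n : ℕ
  t : T

noncomputable def run : List L → List (ℕ × ℕ) → Bool
  | [], _ => true
  | x :: xs, env =>
    cond (sy (nat_lit 70) x.p (nat_lit 0) fun P => sy (nat_lit 70) x.n (nat_lit 0) fun N => chk env x.t P N)
      (run xs ((x.p, x.n) :: env)) false

/-! ### Soundness -/

open SimpleGraph

/-- Vertex names. -/
def c (n : ℕ) : Fin 12 := Fin.ofNat 12 n

theorem c_val (x : Fin 12) : c x.val = x := by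
  apply Fin.ext; simp [c]

theorem val_c {n : ℕ} (h : n < 12) : (c n).val = n := by
  simp [c, Nat.mod_eq_of_lt h]

theorem c_inj {i j : ℕ} (hi : i < 12) (hj : j < 12) (h : c i = c j) : i = j := by
  rw [← val_c hi, ← val_c hj, h]

/-- The mask `P` only has bits at pairs in relation `R`. -/
def Mt (R : Fin 12 → Fin 12 → Prop) (P : ℕ) : Prop :=
  ∀ i j, i < 12 → j < 12 → P.testBit (12 * i + j) = true → R (c i) (c j)

/-- The digit sequence `m` only has pairs in relation `R`. -/
def Dm (R : Fin 12 → Fin 12 → Prop) (m : ℕ) : Prop :=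
  ∀ k, dg (m >>> (8 * k)) ≠ 0 → R (c (dg (m >>> (8 * k)) / 12)) (c (dg (m >>> (8 * k)) % 12))

theorem Dm_zero (R : Fin 12 → Fin 12 → Prop) : Dm R 0 := by
  intro k hk
  exfalso; apply hk
  rw [Nat.zero_shiftRight]; rfl

theorem Dm_head {R : Fin 12 → Fin 12 → Prop} {m : ℕ} (h : Dm R m) (h0 : dg m ≠ 0) :
    R (c (dg m / 12)) (c (dg m % 12)) := by
  have := h 0
  simp only [Nat.mul_zero, Nat.shiftRight_zero] at this
  exact this h0

theorem tl_shift (m k : ℕ) : tl m >>> (8 * k) = m >>> (8 * (k + 1)) := by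
  have : tl m = m >>> 8 := rfl
  rw [this, ← Nat.shiftRight_add]; congr 1; ring

theorem Dm_tail {R : Fin 12 → Fin 12 → Prop} {m : ℕ} (h : Dm R m) : Dm R (tl m) := by
  intro k
  rw [tl_shift]
  exact h (k + 1)

theorem Dm_cons {R : Fin 12 → Fin 12 → Prop} {m : ℕ}
    (h0 : R (c (dg m / 12)) (c (dg m % 12))) (h : Dm R (tl m)) : Dm R m := by
  intro k
  cases k with
  | zero => simp only [Nat.mul_zero, Nat.shiftRight_zero]; exact fun _ => h0
  | succ k => rw [← tl_shift]; exact h k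

theorem lor_eq (a b : ℕ) : Nat.lor a b = a ||| b := rfl
theorem land_eq (a b : ℕ) : Nat.land a b = a &&& b := rfl
theorem shr_eq (a b : ℕ) : Nat.shiftRight a b = a >>> b := rfl

theorem Mt_addE {R : Fin 12 → Fin 12 → Prop} (hs : ∀ x y, R x y → R y x) {P i j : ℕ}
    (hi : i < 12) (hj : j < 12) (h : Mt R P) (hR : R (c i) (c j)) : Mt R (addE P i j) := by
  intro a b ha hb hab
  have e : addE P i j = P ||| (bit (12 * i + j) ||| bit (12 * j + i)) := rfl
  rw [e, Nat.testBit_or, Nat.testBit_or] at hab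
  simp only [Bool.or_eq_true, bit_test] at hab
  rcases hab with h1 | h1 | h1
  · exact h a b ha hb h1
  · have h2 : i = a := by omega
    have h3 : j = b := by omega
    rw [← h2, ← h3]; exact hR
  · have h2 : j = a := by omega
    have h3 : i = b := by omega
    rw [← h2, ← h3]; exact hs _ _ hR

theorem Mt_addB {R : Fin 12 → Fin 12 → Prop} (hs : ∀ x y, R x y → R y x) {P e : ℕ}
    (he : e < 144) (h : Mt R P) (hR : R (c (e / 12)) (c (e % 12))) : Mt R (addB P e) :=
  Mt_addE hs (show e / 12 < 12 by omega) (show e % 12 < 12 by omega) h hR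

theorem cand_pos {a b : Bool} (h : cond a b false = true) : a = true ∧ b = true := by
  cases a <;> simp_all

theorem cand_neg {a b : Bool} (h : cond a false b = true) : a = false ∧ b = true := by
  cases a <;> simp_all

theorem sy_spec {R : Fin 12 → Fin 12 → Prop} (hs : ∀ x y, R x y → R y x) {f : ℕ → Bool} (k : ℕ) :
    ∀ m acc, sy k m acc f = true → Dm R m → Mt R acc → ∃ P, Mt R P ∧ f P = true := by
  induction k with
  | zero => intro m acc h _ h2; exact ⟨acc, h2, h⟩
  | succ k ih =>
    intro m acc h h1 h2
    change cond (Nat.beq m 0) (f acc) (force (dg m) fun b => cond (Nat.beq b 0) false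
      (cond (Nat.ble b 143)
        (force (addB acc b) fun acc2 => force (tl m) fun m2 => sy k m2 acc2 f) false)) = true at h
    cases hm : Nat.beq m 0 with
    | true => rw [hm] at h; exact ⟨acc, h2, h⟩
    | false =>
      rw [hm] at h
      simp only [force_eq, cond_false] at h
      obtain ⟨h3, h⟩ := cand_neg h
      obtain ⟨h4, h⟩ := cand_pos h
      have h5 : dg m ≠ 0 := Nat.ne_of_beq_eq_false h3
      have h6 : dg m ≤ 143 := Nat.le_of_ble_eq_true h4
      exact ih _ _ h (Dm_tail h1) (Mt_addB hs (by omega) h2 (Dm_head h1 h5))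

theorem Mt_zero (R : Fin 12 → Fin 12 → Prop) : Mt R 0 := by
  intro i j _ _ h
  simp at h

/-- The permutation encoded by `s`. -/
def pm (s : ℕ) (x : Fin 12) : Fin 12 := c (sg s x.val)

theorem occ_spec (s n b : ℕ) (h : (occ s n).testBit b = true) : ∃ i < n, sg s i = b := by
  induction n with
  | zero =>
    change (0 : ℕ).testBit b = true at h
    simp at h
  | succ n ih =>
    change (occ s n ||| bit (sg s n)).testBit b = true at h
    rw [Nat.testBit_or, Bool.or_eq_true, bit_test] at h
    rcases h with h | h
    · obtain ⟨i, hi, h⟩ := ih h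
      exact ⟨i, by omega, h⟩
    · exact ⟨n, by omega, h⟩

theorem perm_spec {s : ℕ} (h : permB s = true) :
    Function.Bijective (pm s) ∧ ∀ i < 12, sg s i < 12 := by
  have h1 : occ s 12 = 4095 := Nat.eq_of_beq_eq_true h
  have h2 : ∀ b < 12, ∃ i < 12, sg s i = b := by
    intro b hb
    apply occ_spec
    rw [h1, show (4095 : ℕ) = 2 ^ 12 - 1 by norm_num, Nat.testBit_two_pow_sub_one]
    simpa using hb
  have hsur : Function.Surjective (pm s) := by
    intro y
    obtain ⟨i, hi, h⟩ := h2 y.val y.isLt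
    refine ⟨c i, ?_⟩
    rw [pm, val_c hi, h, c_val]
  refine ⟨Finite.injective_iff_surjective.mpr hsur |> fun hi => ⟨hi, hsur⟩, ?_⟩
  have hle : ∀ n, ∀ i < n, (occ s n).testBit (sg s i) = true := by
    intro n
    induction n with
    | zero => intro i hi; omega
    | succ n ih =>
      intro i hi
      change (occ s n ||| bit (sg s n)).testBit _ = true
      rw [Nat.testBit_or, Bool.or_eq_true, bit_test]
      rcases Nat.lt_succ_iff_lt_or_eq.mp hi with h | h
      · exact Or.inl (ih i h)
      · exact Or.inr (by rw [h])
  intro i hi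
  have := hle 12 i hi
  rw [h1, show (4095 : ℕ) = 2 ^ 12 - 1 by norm_num, Nat.testBit_two_pow_sub_one] at this
  simpa using this

theorem sub_spec {R : Fin 12 → Fin 12 → Prop} {s P : ℕ} (hs : ∀ i < 12, sg s i < 12)
    (hP : Mt R P) (k : ℕ) :
    ∀ m, sub s P k m = true → Dm (fun x y => R (pm s x) (pm s y)) m := by
  induction k with
  | zero =>
    intro m h
    have : m = 0 := Nat.eq_of_beq_eq_true h
    rw [this]; exact Dm_zero _
  | succ k ih =>
    intro m h
    change cond (Nat.beq m 0) true (force (dg m) fun b => cond (Nat.ble b 143)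
        (cond (tb P (12 * sg s (b / 12) + sg s (b % 12))) (force (tl m) (sub s P k)) false)
        false) = true at h
    cases hm : Nat.beq m 0 with
    | true =>
      have : m = 0 := Nat.eq_of_beq_eq_true hm
      rw [this]; exact Dm_zero _
    | false =>
      rw [hm] at h
      simp only [force_eq, cond_false] at h
      obtain ⟨h4, h⟩ := cand_pos h
      obtain ⟨h5, h⟩ := cand_pos h
      have h6 : dg m ≤ 143 := Nat.le_of_ble_eq_true h4
      rw [tb_eq] at h5
      refine Dm_cons ?_ (ih _ h)
      have h7 := hP _ _ (hs (dg m / 12) (by omega)) (hs (dg m % 12) (by omega)) h5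
      simp only [pm]
      rw [val_c (show dg m / 12 < 12 by omega), val_c (show dg m % 12 < 12 by omega)]
      exact h7

/-! ### Degrees -/

/-- Non-adjacency of distinct vertices. -/
def Na (G : SimpleGraph (Fin 12)) (x y : Fin 12) : Prop := x ≠ y ∧ ¬ G.Adj x y

theorem Na_symm (G : SimpleGraph (Fin 12)) (x y : Fin 12) (h : Na G x y) : Na G y x :=
  ⟨h.1.symm, fun h2 => h.2 h2.symm⟩

/-- Minimum degree at least six. -/
def D6 {V : Type*} (G : SimpleGraph V) : Prop := ∀ v, 6 ≤ (G.neighborSet v).ncard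

theorem Na_card {G : SimpleGraph (Fin 12)} (hG : D6 G) (v : Fin 12) :
    {w | Na G v w}.ncard ≤ 5 := by
  have h1 : {w | Na G v w} = (insert v (G.neighborSet v))ᶜ := by
    ext w
    simp only [Na, Set.mem_ofPred_eq, Set.mem_compl_iff, Set.mem_insert_iff, mem_neighborSet, not_or]
    exact and_congr_left fun _ => ne_comm
  have h2 := Set.ncard_add_ncard_compl (insert v (G.neighborSet v))
  have h3 : (insert v (G.neighborSet v)).ncard = (G.neighborSet v).ncard + 1 :=
    Set.ncard_insert_of_notMem (by simp)
  have h4 : Nat.card (Fin 12) = 12 := by simp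
  have h5 := hG v
  rw [h1]
  omega

theorem cnt_spec (N v n : ℕ) :
    cnt N v n = ((Finset.range n).filter fun j => N.testBit (12 * v + j) = true).card := by
  induction n with
  | zero => rfl
  | succ n ih =>
    change cond (tb N (12 * v + n)) (cnt N v n + 1) (cnt N v n) = _
    rw [tb_eq, Finset.range_add_one, Finset.filter_insert, ih]
    cases h : N.testBit (12 * v + n) with
    | true => simp
    | false => simp

theorem cnt_set {G : SimpleGraph (Fin 12)} {N v : ℕ} (hv : v < 12) (hN : Mt (Na G) N) :
    ∃ A : Finset (Fin 12), A.card = cnt N v 12 ∧ (∀ x ∈ A, Na G (c v) x) ∧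
      ∀ x ∈ A, N.testBit (12 * v + x.val) = true := by
  refine ⟨((Finset.range 12).filter fun j => N.testBit (12 * v + j) = true).image c, ?_, ?_, ?_⟩
  · rw [cnt_spec]
    apply Finset.card_image_of_injOn
    intro i hi j hj h
    simp only [Finset.coe_filter, Finset.mem_range, Set.mem_ofPred_eq] at hi hj
    exact c_inj hi.1 hj.1 h
  · intro x hx
    simp only [Finset.mem_image, Finset.mem_filter, Finset.mem_range] at hx
    obtain ⟨j, ⟨hj, h⟩, rfl⟩ := hx
    exact hN v j hv hj h
  · intro x hx
    simp only [Finset.mem_image, Finset.mem_filter, Finset.mem_range] at hx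
    obtain ⟨j, ⟨hj, h⟩, rfl⟩ := hx
    rw [val_c hj]; exact h

theorem cnt_le {G : SimpleGraph (Fin 12)} (hG : D6 G) {N v : ℕ} (hv : v < 12)
    (hN : Mt (Na G) N) : cnt N v 12 ≤ 5 := by
  obtain ⟨A, h1, h2, _⟩ := cnt_set hv hN
  rw [← h1, ← Set.ncard_coe_finset]
  exact (Set.ncard_le_ncard (fun x hx => h2 x hx) (Set.toFinite _)).trans (Na_card hG (c v))

theorem adj_of_cnt {G : SimpleGraph (Fin 12)} (hG : D6 G) {N v : ℕ} (hv : v < 12)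
    (hN : Mt (Na G) N) (h5 : 5 ≤ cnt N v 12) {j : ℕ} (hj : j < 12) (hjv : j ≠ v)
    (hb : N.testBit (12 * v + j) = false) : G.Adj (c v) (c j) := by
  obtain ⟨A, h1, h2, h3⟩ := cnt_set hv hN
  by_contra hadj
  have hn : c j ∉ A := by
    intro h
    have := h3 _ h
    rw [val_c hj, hb] at this
    exact absurd this (by simp)
  have hna : Na G (c v) (c j) := ⟨fun h => hjv (c_inj hv hj h).symm, hadj⟩
  have h4 : ((insert (c j) A : Finset (Fin 12)) : Set (Fin 12)) ⊆ {w | Na G (c v) w} := by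
    intro x hx
    rcases Finset.mem_insert.mp (Finset.mem_coe.mp hx) with h | h
    · rw [h]; exact hna
    · exact h2 x h
  have h6 := (Set.ncard_le_ncard h4 (Set.toFinite _)).trans (Na_card hG (c v))
  rw [Set.ncard_coe_finset, Finset.card_insert_of_notMem hn] at h6
  omega

theorem frc_spec {G : SimpleGraph (Fin 12)} (hG : D6 G) {N P v : ℕ} (hv : v < 12)
    (hN : Mt (Na G) N) (h5 : 5 ≤ cnt N v 12) (hP : Mt G.Adj P) (n : ℕ) (hn : n ≤ 12) :
    Mt G.Adj (frc N v P n) := by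
  induction n with
  | zero => exact hP
  | succ n ih =>
    change Mt G.Adj (cond (tb N (12 * v + n)) (frc N v P n)
      (cond (Nat.beq n v) (frc N v P n) (addE (frc N v P n) v n)))
    have ih := ih (by omega)
    rw [tb_eq]
    cases hb : N.testBit (12 * v + n) with
    | true => exact ih
    | false =>
      cases hc : Nat.beq n v with
      | true => exact ih
      | false =>
        exact Mt_addE (fun x y h => h.symm) hv (by omega) ih
          (adj_of_cnt hG hv hN h5 (by omega) (Nat.ne_of_beq_eq_false hc) hb)

/-! ### Minors -/

/-- The vertex set of a mask. -/
def S (B : ℕ) : Set (Fin 12) := {x | B.testBit x.val = true}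

theorem nb_spec {P R n j : ℕ} (h : (nb P R n).testBit j = true) :
    j < 12 ∧ ∃ i < n, R.testBit i = true ∧ P.testBit (12 * i + j) = true := by
  induction n with
  | zero =>
    change (0 : ℕ).testBit j = true at h
    simp at h
  | succ n ih =>
    change (cond (tb R n) (nb P R n ||| ((P >>> (12 * n)) &&& 4095)) (nb P R n)).testBit j = true at h
    rw [tb_eq] at h
    cases hb : R.testBit n with
    | false =>
      rw [hb] at h
      obtain ⟨h1, i, h2, h3⟩ := ih h
      exact ⟨h1, i, by omega, h3⟩
    | true =>
      rw [hb] at h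
      simp only [cond_true, Nat.testBit_or, Bool.or_eq_true] at h
      rcases h with h | h
      · obtain ⟨h1, i, h2, h3⟩ := ih h
        exact ⟨h1, i, by omega, h3⟩
      · rw [Nat.testBit_and, Nat.testBit_shiftRight,
          show (4095 : ℕ) = 2 ^ 12 - 1 by norm_num, Nat.testBit_two_pow_sub_one] at h
        simp only [Bool.and_eq_true, decide_eq_true_eq] at h
        exact ⟨h.2, n, by omega, hb, h.1⟩

theorem nb_adj {G : SimpleGraph (Fin 12)} {P R : ℕ} (hP : Mt G.Adj P) {j : ℕ}
    (h : (nb P R 12).testBit j = true) : j < 12 ∧ ∃ x ∈ S R, G.Adj x (c j) := by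
  obtain ⟨h1, i, h2, h3, h4⟩ := nb_spec h
  refine ⟨h1, c i, ?_, hP i j h2 h1 h4⟩
  change R.testBit (c i).val = true
  rw [val_c h2]; exact h3

theorem conn_extend {V : Type*} {G : SimpleGraph V} {A B : Set V} (hA : (G.induce A).Connected)
    (hAB : A ⊆ B) (h : ∀ b ∈ B, b ∈ A ∨ ∃ a ∈ A, G.Adj a b) : (G.induce B).Connected := by
  obtain ⟨a0, ha0⟩ := hA.nonempty
  have hreach : ∀ a (ha : a ∈ A), (G.induce B).Reachable ⟨a0, hAB ha0⟩ ⟨a, hAB ha⟩ := by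
    intro a ha
    exact (hA.preconnected ⟨a0, ha0⟩ ⟨a, ha⟩).map (induceHomOfLE G hAB).toHom
  have hall : ∀ b : B, (G.induce B).Reachable ⟨a0, hAB ha0⟩ b := by
    rintro ⟨b, hb⟩
    rcases h b hb with h1 | ⟨a, ha, hab⟩
    · exact hreach b h1
    · refine (hreach a ha).trans ?_
      apply Adj.reachable
      exact hab
  have : Nonempty B := ⟨⟨a0, hAB ha0⟩⟩
  exact Connected.mk fun x y => (hall x).symm.trans (hall y)

theorem grow_spec {G : SimpleGraph (Fin 12)} {P B : ℕ} (hP : Mt G.Adj P) (k : ℕ) :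
    ∀ R, grow P B k R = true → (G.induce (S R)).Connected → (G.induce (S B)).Connected := by
  induction k with
  | zero => intro R h; exact absurd h (by change ¬ (false = true); simp)
  | succ k ih =>
    intro R h hR
    change cond (Nat.beq R B) true (force (R ||| (nb P R 12 &&& B)) (grow P B k)) = true at h
    cases hb : Nat.beq R B with
    | true => rw [← Nat.eq_of_beq_eq_true hb]; exact hR
    | false =>
      rw [hb] at h
      simp only [force_eq, cond_false] at h
      refine ih _ h (conn_extend hR ?_ ?_)
      · intro x hx
        change (R ||| (nb P R 12 &&& B)).testBit x.val = true
        rw [Nat.testBit_or, show R.testBit x.val = true from hx]; rfl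
      · intro x hx
        change (R ||| (nb P R 12 &&& B)).testBit x.val = true at hx
        rw [Nat.testBit_or, Bool.or_eq_true, Nat.testBit_and, Bool.and_eq_true] at hx
        rcases hx with hx | hx
        · exact Or.inl hx
        · obtain ⟨_, y, hy, h2⟩ := nb_adj hP hx.1
          rw [c_val] at h2
          exact Or.inr ⟨y, hy, h2⟩

theorem conn_spec {G : SimpleGraph (Fin 12)} {P B : ℕ} (hP : Mt G.Adj P)
    (h : conn P B = true) : (G.induce (S B)).Connected := by
  unfold conn at h
  simp only [force_eq] at h
  obtain ⟨h1, h2⟩ := cand_pos h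
  have h3 : top B 12 ≤ 11 := Nat.le_of_ble_eq_true h1
  refine grow_spec hP _ _ h2 ?_
  have h4 : S (bit (top B 12)) = {c (top B 12)} := by
    ext x
    change (bit (top B 12)).testBit x.val = true ↔ _
    rw [bit_test, Set.mem_singleton_iff]
    constructor
    · intro h; rw [h, c_val]
    · intro h; rw [h, val_c (by omega)]
  change (G.induce (S (bit (top B 12)))).Connected
  rw [h4]
  exact Connected.mk fun x y => by rw [Subsingleton.elim x y]

theorem minor_spec {G : SimpleGraph (Fin 12)} {P code : ℕ} (hP : Mt G.Adj P)
    (h : minorB P code = true) : G.HasCompleteMinor 6 := by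
  unfold minorB at h
  simp only [force_eq] at h
  have h := allB_spec h
  have hconn : ∀ a < 6, (G.induce (S (blk code a))).Connected := fun a ha =>
    conn_spec hP (cand_pos (h a ha)).1
  have hlt : ∀ a < 6, ∀ b < a, Disjoint (S (blk code a)) (S (blk code b)) ∧
      ∃ u ∈ S (blk code a), ∃ v ∈ S (blk code b), G.Adj u v := by
    intro a ha b hb
    obtain ⟨h1, h2⟩ := cand_pos (allB_spec (cand_pos (h a ha)).2 b hb)
    have h1 : blk code a &&& blk code b = 0 := Nat.eq_of_beq_eq_true h1
    have h2 : Nat.beq (nb P (blk code a) 12 &&& blk code b) 0 = false := by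
      cases h3 : Nat.beq (nb P (blk code a) 12 &&& blk code b) 0 with
      | false => rfl
      | true =>
        have h4 : Nat.beq (Nat.land (nb P (blk code a) 12) (blk code b)) 0 = true := h3
        rw [h4] at h2
        exact absurd h2 (by simp)
    constructor
    · rw [Set.disjoint_left]
      intro x hx hy
      have : (blk code a &&& blk code b).testBit x.val = true := by
        rw [Nat.testBit_and, show (blk code a).testBit x.val = true from hx,
          show (blk code b).testBit x.val = true from hy]; rfl
      rw [h1] at this
      simp at this
    · obtain ⟨j, hj⟩ := Nat.exists_testBit_of_ne_zero (Nat.ne_of_beq_eq_false h2)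
      rw [Nat.testBit_and, Bool.and_eq_true] at hj
      obtain ⟨hj1, x, hx, hxj⟩ := nb_adj hP hj.1
      refine ⟨x, hx, c j, ?_, hxj⟩
      change (blk code b).testBit (c j).val = true
      rw [val_c hj1]; exact hj.2
  refine ⟨fun i => S (blk code i.val), ?_, ?_, ?_, ?_⟩
  · intro i
    obtain ⟨x, hx⟩ := (hconn i.val i.isLt).nonempty
    exact ⟨x, hx⟩
  · intro i; exact hconn i.val i.isLt
  · intro i j hij
    rcases Nat.lt_or_gt_of_ne (fun h => hij (Fin.ext h)) with h1 | h1
    · exact (hlt j.val j.isLt i.val h1).1.symm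
    · exact (hlt i.val i.isLt j.val h1).1
  · intro i j hij
    rcases Nat.lt_or_gt_of_ne (fun h => hij (Fin.ext h)) with h1 | h1
    · obtain ⟨u, hu, v, hv, h⟩ := (hlt j.val j.isLt i.val h1).2
      exact ⟨v, hv, u, hu, h.symm⟩
    · exact (hlt i.val i.isLt j.val h1).2

/-- Minors transfer along injective homomorphisms. -/
theorem minor_map {W V : Type*} {H : SimpleGraph W} {G : SimpleGraph V} {t : ℕ} (f : W → V)
    (hf : Function.Injective f) (hadj : ∀ x y, H.Adj x y → G.Adj (f x) (f y))
    (h : H.HasCompleteMinor t) : G.HasCompleteMinor t := by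
  obtain ⟨B, h1, h2, h3, h4⟩ := h
  refine ⟨fun i => Set.image f (B i), fun i => (h1 i).image f, ?_, ?_, ?_⟩
  · intro i
    let g : H.induce (B i) →g G.induce (Set.image f (B i)) :=
      { toFun := fun x => ⟨f x.1, Set.mem_image_of_mem f x.2⟩
        map_rel' := fun {x y} h => hadj x.1 y.1 h }
    refine (h2 i).map g ?_
    rintro ⟨y, x, hx, rfl⟩
    exact ⟨⟨x, hx⟩, rfl⟩
  · intro i j hij
    exact (Set.disjoint_image_iff hf).mpr (h3 i j hij)
  · intro i j hij
    obtain ⟨u, hu, v, hv, h⟩ := h4 i j hij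
    exact ⟨f u, Set.mem_image_of_mem f hu, f v, Set.mem_image_of_mem f hv, hadj u v h⟩

theorem D6_comap {W V : Type*} [Finite V] {G : SimpleGraph V} (hG : D6 G) {f : W → V}
    (hf : Function.Bijective f) : D6 (G.comap f) := by
  intro v
  have : (G.comap f).neighborSet v = f ⁻¹' (G.neighborSet (f v)) := rfl
  rw [this, Set.ncard_preimage_of_injective_subset_range hf.1 (by rw [hf.2.range_eq]; exact Set.subset_univ _)]
  exact hG (f v)

/-! ### The main soundness theorem -/

/-- Every matching graph has a `K_6` minor. -/
def Ref (p n : ℕ) : Prop := ∀ G : SimpleGraph (Fin 12), D6 G → Dm G.Adj p → Dm (Na G) n →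
  G.HasCompleteMinor 6

theorem nth_spec {l : List (ℕ × ℕ)} {f : ℕ → ℕ → Bool} :
    ∀ k, nth l k f = true → ∃ x ∈ l, f x.1 x.2 = true := by
  induction l with
  | nil => intro k h; exact absurd h (by change ¬ (false = true); simp)
  | cons x l ih =>
    intro k h
    cases k with
    | zero => exact ⟨x, by simp, h⟩
    | succ k =>
      obtain ⟨y, hy, h2⟩ := ih k h
      exact ⟨y, by simp [hy], h2⟩

theorem chk_spec {env : List (ℕ × ℕ)} (henv : ∀ x ∈ env, Ref x.1 x.2)
    (G : SimpleGraph (Fin 12)) (hG : D6 G) (t : T) :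
    ∀ P N, chk env t P N = true → Mt G.Adj P → Mt (Na G) N → G.HasCompleteMinor 6 := by
  induction t with
  | m code => intro P N h hP _; exact minor_spec hP h
  | d v =>
    intro P N h hP hN
    obtain ⟨h1, h2⟩ := cand_pos h
    have h1 : v ≤ 11 := Nat.le_of_ble_eq_true h1
    have h2 : 6 ≤ cnt N v 12 := Nat.le_of_ble_eq_true h2
    have := cnt_le hG (show v < 12 by omega) hN
    omega
  | l k s =>
    intro P N h hP hN
    obtain ⟨x, hx, h⟩ := nth_spec k h
    rw [force_eq] at h
    obtain ⟨h1, h⟩ := cand_pos h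
    obtain ⟨h2, h3⟩ := cand_pos h
    obtain ⟨h4, h5⟩ := perm_spec h1
    refine minor_map (pm s) h4.1 (fun x y h => h)
      (henv x hx (G.comap (pm s)) (D6_comap hG h4) (sub_spec h5 hP _ _ h2) ?_)
    have h6 := sub_spec h5 hN _ _ h3
    intro k hk
    obtain ⟨h7, h8⟩ := h6 k hk
    exact ⟨fun h => h7 (by rw [h]), h8⟩
  | f v t ih =>
    intro P N h hP hN
    change force v (fun v => cond (Nat.ble v 11) (cond (Nat.ble 5 (cnt N v 12))
        (force (frc N v P 12) fun P2 => chk env t P2 N) false) false) = true at h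
    simp only [force_eq] at h
    obtain ⟨h1, h⟩ := cand_pos h
    obtain ⟨h2, h⟩ := cand_pos h
    have h1 : v ≤ 11 := Nat.le_of_ble_eq_true h1
    have h2 : 5 ≤ cnt N v 12 := Nat.le_of_ble_eq_true h2
    exact ih _ _ h (frc_spec hG (by omega) hN h2 hP 12 le_rfl) hN
  | r e a b iha ihb =>
    intro P N h hP hN
    change force e (fun e => cond (Nat.ble e 143) (cond (Nat.beq (e / 12) (e % 12)) false
        (cond (force (addB P e) fun P2 => chk env a P2 N)
          (force (addB N e) fun N2 => chk env b P N2) false)) false) = true at h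
    simp only [force_eq] at h
    obtain ⟨h1, h⟩ := cand_pos h
    obtain ⟨h2, h⟩ := cand_neg h
    obtain ⟨h3, h4⟩ := cand_pos h
    have h1 : e ≤ 143 := Nat.le_of_ble_eq_true h1
    have h2 : e / 12 ≠ e % 12 := Nat.ne_of_beq_eq_false h2
    by_cases hadj : G.Adj (c (e / 12)) (c (e % 12))
    · exact iha _ _ h3 (Mt_addB (fun x y h => h.symm) (by omega) hP hadj) hN
    · exact ihb _ _ h4 hP (Mt_addB (Na_symm G) (by omega) hN
        ⟨fun h => h2 (c_inj (by omega) (by omega) h), hadj⟩)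

theorem run_spec (ls : List L) : ∀ env, run ls env = true → (∀ x ∈ env, Ref x.1 x.2) →
    ∀ x ∈ ls, Ref x.p x.n := by
  induction ls with
  | nil => intro _ _ _ x hx; simp at hx
  | cons y ls ih =>
    intro env h henv x hx
    obtain ⟨h1, h2⟩ := cand_pos (show cond (sy 70 y.p 0 fun P => sy 70 y.n 0 fun N =>
      chk env y.t P N) (run ls ((y.p, y.n) :: env)) false = true from h)
    have hy : Ref y.p y.n := by
      intro G hG hp hn
      obtain ⟨P, hP, h3⟩ := sy_spec (R := G.Adj) (fun x y h => h.symm) _ _ _ h1 hp (Mt_zero _)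
      obtain ⟨N, hN, h4⟩ := sy_spec (R := Na G) (Na_symm G) _ _ _ h3 hn (Mt_zero _)
      exact chk_spec henv G hG _ _ _ h4 hP hN
    rcases List.mem_cons.mp hx with h5 | h5
    · rw [h5]; exact hy
    · refine ih _ h2 ?_ x h5
      intro z hz
      rcases List.mem_cons.mp hz with h6 | h6
      · rw [h6]; exact hy
      · exact henv z h6

/-! ### Reduction to the start state -/

theorem exists_minimal_sub {V : Type*} [Finite V] [Nonempty V] (G : SimpleGraph V) (hG : D6 G) :
    ∃ H : SimpleGraph V, H ≤ G ∧ D6 H ∧ ∃ v, (H.neighborSet v).ncard = 6 := by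
  obtain ⟨H, ⟨hHG, hH⟩, hmin⟩ := (wellFounded_lt (α := SimpleGraph V)).has_min
    {H | H ≤ G ∧ D6 H} ⟨G, le_rfl, hG⟩
  refine ⟨H, hHG, hH, ?_⟩
  by_contra hne
  push Not at hne
  obtain ⟨u⟩ := ‹Nonempty V›
  have hpos : (H.neighborSet u).Nonempty := by
    rw [← Set.ncard_pos (Set.toFinite _)]
    have := hH u
    omega
  obtain ⟨w, hw⟩ := hpos
  have hw : H.Adj u w := hw
  refine hmin (H.deleteEdges {s(u, w)}) ⟨(deleteEdges_le _).trans hHG, ?_⟩ ?_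
  · intro x
    have h7 : 7 ≤ (H.neighborSet x).ncard := by
      have h1 := hH x
      have h2 := hne x
      omega
    have hsub : ∃ y, H.neighborSet x \ {y} ⊆ (H.deleteEdges {s(u, w)}).neighborSet x := by
      by_cases hx : x = u
      · refine ⟨w, ?_⟩
        rintro z ⟨hz, hzw⟩
        have hz : H.Adj x z := hz
        rw [mem_neighborSet, deleteEdges_adj]
        refine ⟨hz, ?_⟩
        rw [Set.mem_singleton_iff, Sym2.eq_iff]
        rintro (⟨_, h⟩ | ⟨h, _⟩)
        · exact hzw h
        · exact hw.ne (hx.symm.trans h)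
      · refine ⟨u, ?_⟩
        rintro z ⟨hz, hzu⟩
        have hz : H.Adj x z := hz
        rw [mem_neighborSet, deleteEdges_adj]
        refine ⟨hz, ?_⟩
        rw [Set.mem_singleton_iff, Sym2.eq_iff]
        rintro (⟨h, _⟩ | ⟨_, h⟩)
        · exact hx h
        · exact hzu h
    obtain ⟨y, hy⟩ := hsub
    have h1 := Set.ncard_le_ncard hy (Set.toFinite _)
    have h2 := Set.pred_ncard_le_ncard_sdiff_singleton (H.neighborSet x) y
    omega
  · refine lt_of_le_of_ne (deleteEdges_le _) ?_
    intro h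
    rw [← h, deleteEdges_adj] at hw
    exact hw.2 rfl

theorem exists_label {V : Type*} [Fintype V] (H : SimpleGraph V) (hcard : Fintype.card V = 12)
    (v : V) (hv : (H.neighborSet v).ncard = 6) :
    ∃ f : Fin 12 → V, Function.Bijective f ∧
      (∀ j, 1 ≤ j → j ≤ 6 → H.Adj (f (c 0)) (f (c j))) ∧
      (∀ j, 7 ≤ j → j ≤ 11 → ¬ H.Adj (f (c 0)) (f (c j))) := by
  have hN : H.neighborFinset v = (H.neighborSet v).toFinset := rfl
  have hNc : (H.neighborFinset v).card = 6 := by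
    rw [hN, ← Set.ncard_eq_toFinset_card']; exact hv
  have hvN : v ∉ H.neighborFinset v := by simp
  obtain ⟨l1, hl1⟩ : ∃ l : List V, l = (H.neighborFinset v).toList := ⟨_, rfl⟩
  obtain ⟨l2, hl2⟩ : ∃ l : List V, l = (insert v (H.neighborFinset v))ᶜ.toList := ⟨_, rfl⟩
  have n1 : l1.length = 6 := by rw [hl1, Finset.length_toList, hNc]
  have n2 : l2.length = 5 := by
    rw [hl2, Finset.length_toList, Finset.card_compl, Finset.card_insert_of_notMem hvN, hNc, hcard]
  have m1 : ∀ x ∈ l1, H.Adj v x := by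
    intro x hx
    rw [hl1, Finset.mem_toList, mem_neighborFinset] at hx
    exact hx
  have m2 : ∀ x ∈ l2, x ≠ v ∧ ¬ H.Adj v x := by
    intro x hx
    rw [hl2, Finset.mem_toList, Finset.mem_compl, Finset.mem_insert, mem_neighborFinset, not_or] at hx
    exact hx
  have d1 : l1.Nodup := by rw [hl1]; exact Finset.nodup_toList _
  have d2 : l2.Nodup := by rw [hl2]; exact Finset.nodup_toList _
  have hd : (v :: (l1 ++ l2)).Nodup := by
    rw [List.nodup_cons, List.nodup_append]
    refine ⟨?_, d1, d2, ?_⟩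
    · rw [List.mem_append]
      rintro (h | h)
      · exact (m1 v h).ne rfl
      · exact (m2 v h).1 rfl
    · intro a ha b hb hab
      rw [← hab] at hb
      exact (m2 a hb).2 (m1 a ha)
  have hlen : (v :: (l1 ++ l2)).length = 12 := by
    rw [List.length_cons, List.length_append, n1, n2]
  let f : Fin 12 → V := fun i => (v :: (l1 ++ l2))[i.val]'(by rw [hlen]; exact i.isLt)
  have hinj : Function.Injective f := by
    intro i j hij
    exact Fin.ext ((List.Nodup.getElem_inj_iff hd).mp hij)
  have f0 : f (c 0) = v := rfl
  refine ⟨f, (Fintype.bijective_iff_injective_and_card f).mpr ⟨hinj, by simp [hcard]⟩, ?_, ?_⟩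
  · intro j h1 h6
    rw [f0]
    apply m1
    obtain ⟨k, rfl⟩ : ∃ k, j = k + 1 := ⟨j - 1, by omega⟩
    have e : f (c (k + 1)) = l1[k]'(by omega) := by
      have hval : (c (k + 1)).val = k + 1 := val_c (by omega)
      simp only [f, hval, List.getElem_cons_succ]
      rw [List.getElem_append_left]
    rw [e]; exact List.getElem_mem _
  · intro j h7 h11
    rw [f0]
    apply fun h => (m2 _ h).2
    obtain ⟨k, rfl⟩ : ∃ k, j = k + 1 := ⟨j - 1, by omega⟩
    have e : f (c (k + 1)) = l2[k - 6]'(by omega) := by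
      have hval : (c (k + 1)).val = k + 1 := val_c (by omega)
      simp only [f, hval, List.getElem_cons_succ]
      rw [List.getElem_append_right (by omega)]
      simp only [n1]
    rw [e]; exact List.getElem_mem _

theorem start_p {R : Fin 12 → Fin 12 → Prop} (h : ∀ j, 1 ≤ j → j ≤ 6 → R (c 0) (c j)) :
    Dm R 6618611909121 :=
  Dm_cons (h 1 (by omega) (by omega)) <| Dm_cons (h 2 (by omega) (by omega)) <|
  Dm_cons (h 3 (by omega) (by omega)) <| Dm_cons (h 4 (by omega) (by omega)) <|
  Dm_cons (h 5 (by omega) (by omega)) <| Dm_cons (h 6 (by omega) (by omega)) <| Dm_zero R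

theorem start_n {R : Fin 12 → Fin 12 → Prop} (h : ∀ j, 7 ≤ j → j ≤ 11 → R (c 0) (c j)) :
    Dm R 47413004295 :=
  Dm_cons (h 7 (by omega) (by omega)) <| Dm_cons (h 8 (by omega) (by omega)) <|
  Dm_cons (h 9 (by omega) (by omega)) <| Dm_cons (h 10 (by omega) (by omega)) <|
  Dm_cons (h 11 (by omega) (by omega)) <| Dm_zero R

theorem main_of_ref (href : Ref 6618611909121 47413004295) {V : Type*} [Fintype V] (G : SimpleGraph V)
    (hcard : Fintype.card V = 12) (hdeg : D6 G) : G.HasCompleteMinor 6 := by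
  have : Nonempty V := Fintype.card_pos_iff.mp (by omega)
  obtain ⟨H, hHG, hH, v, hv⟩ := exists_minimal_sub G hdeg
  obtain ⟨f, hf, h1, h2⟩ := exists_label H hcard v hv
  refine minor_map f hf.1 (fun x y h => hHG h) (href (H.comap f) (D6_comap hH hf) ?_ ?_)
  · exact start_p (R := (H.comap f).Adj) h1
  · refine start_n (R := Na (H.comap f)) fun j h7 h11 => ⟨fun h => ?_, h2 j h7 h11⟩
    have := c_inj (by omega) (by omega) h
    omega

/-! ### The certificate -/

def c0 : L := L.mk 192132748459537484870832923632919053316240202465793 2825 (.r 16 (.m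
  2363777351108367237225) (.r 21 (.m 2363777350008855609465) (.r 54 (.m 2363777355506413748265)
  (.r 59 (.m 2361471508099187097705) (.r 81 (.m 2363777354406902120505) (.r 119 (.m
  2361471506999675469945) (.r 55 (.r 45 (.r 27 (.m 1180735753671619428465) (.r 42 (.m
  2444481855331334897715) (.r 47 (.m 2361471507549431283825) (.r 18 (.r 35 (.r 14 (.m
  2361471489551336751225) (.r 32 (.m 2361471489551336751225) (.r 40 (.r 30 (.r 33 (.m
  1180735753671619657785) (.f 9 (.r 28 (.m 2361471515795768066145) (.f 2 (.r 41 (.m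
  2361615604730822836305) (.r 46 (.m 1180735753671619788825) (.f 3 (.r 56 (.m
  590368439973936401505) (.f 4 (.m 1180735744976995027275)))))))))) (.r 80 (.r 15 (.m
  2361615608991430320165) (.r 17 (.r 41 (.m 2363777358804948320325) (.f 3 (.m
  1180735753637326784625))) (.f 1 (.m 2361471493811944300605)))) (.f 6 (.m
  2361471489551336996925)))) (.r 15 (.r 33 (.m 2363777350560758382705) (.f 9 (.r 17 (.m
  1185347439518256603225) (.r 56 (.m 2363777350558611423345) (.f 4 (.r 29 (.m
  1180735758688141246500) (.f 2 (.r 43 (.m 1180735753534180778025) (.f 3 (.r 66 (.m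
  1180735753636731699225) (.r 67 (.m 1180735885439605473615) (.r 68 (.m 1180735753671619575885)
  (.f 5 (.m 2361471509198698774605)))))))))))))) (.f 3 (.m 1180735753637326784625)))))) (.f 11 (.r
  14 (.m 2361471489413897805945) (.r 30 (.m 2361471489413898068025) (.r 69 (.m
  2361472635098571997275) (.f 9 (.r 32 (.m 1180735753534180442235) (.f 2 (.r 53 (.m
  1180735758688141377540) (.r 56 (.m 1180735753534180507755) (.f 4 (.m
  1180735885439336989035)))))))))))) (.r 30 (.r 14 (.m 2435258465846174957625) (.r 32 (.m
  2435258465846174957625) (.r 80 (.m 2363777332423111753785) (.f 6 (.r 35 (.m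
  2361471498200327143995) (.f 11 (.r 29 (.m 2361615595796217086235) (.f 2 (.r 15 (.m
  2363777350560758644785) (.f 1 (.m 2361472615305214698105))))))))))) (.f 6 (.m
  2363777332423111737405))))))) (.f 9 (.r 14 (.m 1180735753534180450425) (.r 17 (.m
  1185347439518256603225) (.r 66 (.m 2363778482505832202265) (.r 71 (.m 2361472635098605551705)
  (.r 18 (.r 30 (.m 1180735753671619657785) (.r 42 (.r 40 (.m 2435258484943781117985) (.r 41 (.m
  2435259611943199571985) (.r 53 (.r 28 (.m 1217629373586756092235) (.f 4 (.m
  1180735753671619444845))) (.f 4 (.f 5 (.m 1180735753637528209485)))))) (.f 6 (.m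
  2363777332414588912185)))) (.f 1 (.r 42 (.m 2435258466249968984625) (.f 6 (.m
  1180735753534214258745))))))))))) (.r 56 (.r 53 (.r 66 (.m 2363777358804948549645) (.r 71 (.m
  2361471515795768148045) (.r 28 (.r 45 (.m 1217629241784745920585) (.f 9 (.m
  2509045459589351424105))) (.f 4 (.r 42 (.m 2435258492090606256165) (.r 47 (.m
  2361471515795768049765) (.f 11 (.r 30 (.r 80 (.m 2361471515795734675515) (.f 6 (.m
  2361471515792513188155))) (.f 6 (.m 2361471489405375218235)))))))))) (.f 4 (.r 45 (.m
  1180735753637326817385) (.f 9 (.m 1180735753635381135465))))) (.f 4 (.r 17 (.m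
  1180771782879378210885) (.r 66 (.m 2435258492090606387205) (.r 69 (.m 1180735753637326850145)
  (.f 9 (.r 67 (.m 1180735746900871891275) (.r 68 (.m 1180735753635918006345) (.f 5 (.m
  2361471489541270737540)))))))))))))))))
def c1 : L := L.mk 49185983605641596126933231866451754780478517419377153 2201018133815634497545
  (.r 33 (.r 14 (.m 1217629241681599553625) (.r 17 (.m 3541918994934643449945) (.r 27 (.m
  1217629241819038531665) (.r 32 (.m 1217629241819038498905) (.r 41 (.m 3541918995072082427985)
  (.r 68 (.m 3541918995072082395225) (.r 53 (.r 28 (.m 1217629373586756092235) (.f 2 (.m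
  3544224842960378986500))) (.f 5 (.r 42 (.m 2363921448152353619985) (.r 58 (.m
  2363781855807506219085) (.f 4 (.r 45 (.m 590368580453995200585) (.r 46 (.m
  2361473760998512459845) (.f 3 (.m 2361624611930077495365))))))))))))))) (.f 9 (.r 14 (.m
  3541918994934643449945) (.r 17 (.m 3541918994934710542425) (.r 27 (.m 1217629241819038531665)
  (.r 32 (.m 3541918995072082395225) (.f 2 (.r 41 (.m 3541918994934643474515) (.r 42 (.m
  2361347710784299483155) (.r 47 (.m 2361543565141287780435) (.r 56 (.m 590656107125256898635) (.r
  58 (.m 1180735885439337120075) (.f 4 (.r 19 (.m 3541918994934643408995) (.f 1 (.r 43 (.m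
  1180735753534180593750) (.f 3 (.m 1180735753534180847640))))))))))))))))))
def c2 : L := L.mk 192132748459537484870832923618715060379483847721473 4399625 (.r 16 (.m
  2363786358307621978185) (.r 21 (.m 2363786357208110350425) (.r 54 (.m 2363786362705668489225)
  (.r 59 (.m 2361480515298441838665) (.r 81 (.m 2363786361606156861465) (.r 119 (.m
  2361480514198930210905) (.r 55 (.l 0 205163983024656) (.r 58 (.l 0 201866250302736) (.f 4 (.r 27
  (.m 1217665270579818711105) (.r 41 (.m 1770960060691750389825) (.r 42 (.m
  2444490844936324841475) (.r 45 (.m 1217629241784745920585) (.f 9 (.r 43 (.m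
  590368440300622381125) (.f 3 (.m 2361471516070646255640)))))))))))))))))
def c3 : L := L.mk 3223452621579327643776093276160049636193070111745869283841 288335136775 (.r
  27 (.r 19 (.m 3541918995484399124595) (.r 55 (.m 2361615604730822705265) (.r 79 (.m
  3541918994934643343475) (.f 7 (.m 2361471507274553360505))))) (.r 28 (.r 16 (.m
  2361615613387631247465) (.r 43 (.r 14 (.m 2361615604730822672505) (.r 32 (.m
  2361615604730822672505) (.f 2 (.r 18 (.m 2361615604730822934585) (.r 41 (.m
  2361615604730822819925) (.r 66 (.m 2361615595799975313435) (.r 17 (.r 21 (.m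
  2361328508928801120345) (.r 22 (.m 2361471498199790264925) (.f 1 (.l 0 205099558453536)))) (.f 5
  (.r 21 (.m 2361328007535929802825) (.f 1 (.m 2361472070225010098265))))))))))) (.r 46 (.r 53 (.m
  2361471489541407260745) (.r 69 (.m 2361471515795768082525) (.r 41 (.r 15 (.m
  2363777332412910961365) (.r 42 (.m 2509045441993373942295) (.r 47 (.m 2361471489541136220885)
  (.f 3 (.r 54 (.m 2361471507276666908760) (.r 55 (.m 1180735753671619477605) (.r 58 (.m
  2361471516070646022225) (.f 4 (.m 2361471516070646255640))))))))) (.f 5 (.r 14 (.m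
  2361471498199792377945) (.r 15 (.m 2361473749999603950165) (.r 21 (.m 2509045459589317927005)
  (.r 22 (.m 2509045441993373655645) (.f 1 (.l 0 205099558453536)))))))))) (.r 41 (.r 40 (.r 15
  (.m 2363921447600986882245) (.r 42 (.m 2361615613387866472455) (.f 3 (.m
  2361363403167259197525)))) (.r 15 (.r 45 (.m 2363921447600986816725) (.f 3 (.r 30 (.m
  2361615613387866423315) (.r 54 (.m 2361291368525526499335) (.r 79 (.m 2361615604730823082005)
  (.r 81 (.m 2361345397427403784215) (.r 82 (.m 2509063456391883162135) (.f 6 (.m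
  2361291332224462915095))))))))) (.f 3 (.m 2508901326822477693015)))) (.r 40 (.r 15 (.m
  2363921447602077401220) (.f 3 (.m 2361615613387463540835))) (.f 3 (.r 14 (.m
  2361615613387463483505) (.r 17 (.m 2361615613387866153045) (.r 19 (.m 3541918994934643335285)
  (.r 21 (.m 2508901326804895147125) (.f 1 (.m 2509045459589317828725)))))))))))) (.r 32 (.r 19
  (.m 3541918994934643310715) (.r 43 (.m 3541918994934643310715) (.r 55 (.m
  2363921447602597412985) (.f 7 (.m 2363777350283733500025))))) (.f 2 (.r 43 (.m
  2361615604730822672505) (.r 55 (.m 2361615604730822672505) (.r 79 (.m 2361615604730822672505)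
  (.f 7 (.r 42 (.m 2361471507275727765555) (.r 46 (.m 2361471507275056676955) (.r 47 (.m
  2361471507274654023795) (.f 3 (.m 1180735753499821168650)))))))))))))
def c4 : L := L.mk 825203871124307876806679883889269565400253580234767433138689 2230793 (.r 14
  (.m 2361291400402303983705) (.r 19 (.m 2361543538210232082525) (.r 46 (.m
  2361471515795768082525) (.r 58 (.m 2361471515795768082525) (.r 82 (.m 2361471515795768082525)
  (.f 10 (.l 0 201801825730896)))))))
def c5 : L := L.mk 12591611803044248608500363484456211292213674577611653633 4837460882999543815
  (.r 68 (.l 1 205163983024656) (.r 69 (.r 41 (.r 22 (.m 2509045459589452136535) (.r 58 (.m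
  2361471515795768115285) (.r 82 (.m 2509045459589317951575) (.f 10 (.m
  2361471509198698709085))))) (.r 53 (.r 16 (.m 2508901326822477733965) (.r 55 (.m
  2361328500254850547785) (.r 17 (.l 0 205163983024656) (.r 14 (.l 0 201866250302736) (.f 5 (.r 79
  (.m 2363634343127430594585) (.r 19 (.r 18 (.m 2361543538210232344605) (.r 21 (.m
  3541918994934643302525) (.f 1 (.l 4 201801825730896)))) (.f 7 (.m
  2361471507274553360505))))))))) (.f 5 (.l 0 205163983024656)))) (.r 41 (.r 27 (.m
  2361480522995022741585) (.r 43 (.m 2361615604730822819925) (.r 53 (.r 22 (.m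
  2509045460688963764295) (.r 55 (.m 2361615604730822885445) (.r 82 (.m 2509045460688829579335)
  (.r 94 (.r 46 (.m 2361471510298210336845) (.f 10 (.r 19 (.m 2361471507275190894675) (.f 7 (.m
  2361471507275190894675))))) (.f 7 (.f 10 (.r 17 (.m 2361471507276666970185) (.f 5 (.m
  2361471507276667224075))))))))) (.f 5 (.r 14 (.m 2361615613937621950545) (.r 16 (.m
  2508905830971860852805) (.r 21 (.m 2508901327372233482325) (.r 22 (.m 2509045442543129469525)
  (.r 30 (.m 2363921448150743400465) (.f 2 (.r 19 (.m 2361615605418051108945) (.f 1 (.r 40 (.m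
  2508901326822477766725) (.r 42 (.m 2508829256584056021525) (.r 45 (.m 2508901326822477701205)
  (.f 3 (.m 2509045441993407234645))))))))))))))))) (.f 5 (.r 19 (.m 2361543538210500517965) (.r
  55 (.m 2361615604730822852685) (.r 79 (.m 2361620108330450419725) (.f 7 (.m
  2361471508374064988265)))))))))
def c6 : L := L.mk 12591611803044248608500363484453783977394735506262262273 18897452863785223
  (.r 14 (.r 43 (.m 2361615604730822934585) (.r 55 (.m 2361615604730822934585) (.r 79 (.m
  3541918994934643318905) (.f 7 (.r 42 (.m 1180735754049585168435) (.r 54 (.m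
  2435258484394025287725) (.r 80 (.m 1180735753499829354555) (.r 81 (.m 2435258483294513659965)
  (.f 6 (.m 2361471510916685627460)))))))))) (.f 2 (.r 16 (.m 2508901326805063189545) (.r 19 (.m
  3541918994934643572795) (.r 43 (.m 3541918994934643572795) (.r 55 (.m 2363921447602597675065)
  (.f 7 (.r 21 (.m 2363777350008855593085) (.r 54 (.m 2363777355506413731885) (.r 59 (.m
  2363777351108367220845) (.r 66 (.m 2363786358926097252420) (.r 81 (.m 2363777354406902104125)
  (.r 82 (.m 2363777353925865766980) (.r 119 (.m 2363777350008855593085) (.r 18 (.r 22 (.m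
  1180735753499820976185) (.f 1 (.r 40 (.m 1218782163151855132740) (.f 4 (.r 45 (.m
  1180735753637259724905) (.f 9 (.m 2361471509817173999700))))))) (.f 1 (.f 6 (.r 40 (.m
  1180735753499821058085) (.f 4 (.m 2435258486593014988815))))))))))))))))))))
def c7 : L := L.mk 49185983605641596126954544861147593156435204901110273 4837460882999543815 (.r
  35 (.l 1 205163983024656) (.r 27 (.r 41 (.m 2509054466788606132305) (.r 46 (.m
  2509045459589351391345) (.r 68 (.r 30 (.r 19 (.m 3615705971779237330995) (.r 55 (.m
  3541918994934643605555) (.r 66 (.m 2508901326822477971475) (.r 82 (.m 2509045459589318098995)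
  (.r 53 (.r 16 (.m 2582688303667071754245) (.r 22 (.m 2582832436983801970695) (.f 10 (.r 21 (.m
  2435258483432590147605) (.r 43 (.m 2361471511673103187995) (.f 7 (.r 14 (.m
  2363777350283867717745) (.f 1 (.m 2363777350833489313905))))))))) (.f 5 (.r 22 (.m
  2582832435884290342935) (.f 10 (.m 2435258485493536915485))))))))) (.r 14 (.r 43 (.m
  3541918994934643318905) (.r 55 (.m 2363921448152353226865) (.r 79 (.m 2363921448152353226865)
  (.f 7 (.r 42 (.m 1180735753499829387315) (.r 47 (.m 1180735753499829125235) (.f 3 (.m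
  1180735753499896225905)))))))) (.f 2 (.r 16 (.m 2508901326805062927465) (.r 17 (.r 21 (.m
  2508901326822477668445) (.r 22 (.m 2509045441993373655645) (.r 15 (.r 40 (.m
  2508905830422105071685) (.r 45 (.m 2508901326822477701205) (.r 55 (.m 2361615595799975092305)
  (.r 56 (.m 2508901326822477717585) (.r 58 (.r 69 (.m 2361471515795768082525) (.r 81 (.m
  2509049963188978729065) (.f 9 (.l 1 152400259473936)))) (.f 4 (.f 10 (.m
  2363795365506876702765)))))))) (.f 1 (.r 42 (.m 2361615606792407269395) (.r 47 (.m
  2361615605143139655765) (.f 3 (.m 1770968504665636882515)))))))) (.r 53 (.r 21 (.m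
  2508901889772699533385) (.r 22 (.m 2509045459589317984335) (.f 1 (.r 40 (.m
  2361615606792407064645) (.r 42 (.m 3615705971229481709580) (.r 45 (.m 3541918994934643507275)
  (.f 3 (.m 3541918994934643765260)))))))) (.f 5 (.r 22 (.m 2509045459589317918815) (.r 58 (.m
  2509045459589317918815) (.f 10 (.m 1180735753499829207135))))))))))) (.r 69 (.r 53 (.r 16 (.m
  2508901327372233547845) (.r 17 (.r 14 (.m 2508901327372233498705) (.r 58 (.m
  2361471515795902300245) (.r 82 (.m 2361471515795902300245) (.f 10 (.r 40 (.m
  1180735754049585086535) (.r 42 (.m 2435258485493637595155) (.r 47 (.m 2361471509198799388755)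
  (.f 3 (.r 28 (.m 2361471512016197255220) (.f 2 (.m 1180735753499829354555))))))))))) (.f 5 (.r
  30 (.m 2508901326822477971475) (.r 42 (.m 2508901326822477971475) (.r 14 (.r 43 (.m
  3541918994934643318905) (.r 55 (.m 2363921448152353226865) (.r 79 (.m 2363634343677186408465)
  (.f 7 (.r 47 (.m 1180735753499829125235) (.f 3 (.r 28 (.m 2436411405348876320820) (.f 2 (.m
  590367876749004393585))))))))) (.f 2 (.r 21 (.m 2508901889772431163465) (.r 45 (.m
  2508901326822477742155) (.r 15 (.r 40 (.m 2511207169832781971460) (.f 3 (.l 1 201866251347216)))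
  (.f 1 (.f 3 (.m 1180735753534180655175))))))))))))) (.f 5 (.r 14 (.m 2508901327372233498705) (.r
  16 (.m 2508905830971860852805) (.r 30 (.m 2363669246588789997585) (.f 2 (.r 58 (.m
  2361471515795768082525) (.r 82 (.m 2361471515795768082525) (.f 10 (.r 54 (.m
  2453705227368223211565) (.r 59 (.m 2361471508099187081325) (.f 4 (.m
  590368439752091303940))))))))))))) (.f 5 (.r 14 (.m 2508905830971860869185) (.r 19 (.m
  2361545790010314203205) (.r 21 (.m 2508905830971860852805) (.r 30 (.m 2363673750188417368065)
  (.f 2 (.r 45 (.m 2508901326960185065545) (.r 55 (.m 2361615604730822852685) (.r 81 (.m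
  2508901326943429001220) (.f 9 (.r 79 (.m 2363633217227523817485) (.f 7 (.m
  2361471506999675453565))))))))))))))))) (.r 30 (.l 0 205163983024656) (.f 2 (.r 43 (.m
  2363921447602597412985) (.r 55 (.m 2363921447602597412985) (.r 79 (.m 2363921447602597412985)
  (.f 7 (.r 54 (.m 2363777355506413731885) (.r 81 (.m 2363777354406902104125) (.r 18 (.r 82 (.m
  1180735753499820976185) (.f 6 (.l 0 205163899138656))) (.f 6 (.l 0 205163899138656)))))))))))))
def c8 : L := L.mk 3223452621579327643774753440147126932995314065104630383105
  1314562206665856911623 (.r 14 (.m 2508905830422105055305) (.r 19 (.m 3541918994934643499085) (.r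
  21 (.m 2508901326822746103885) (.r 46 (.m 2363777358804948287565) (.r 82 (.m
  2363777358804948287565) (.r 22 (.r 54 (.m 2582832435884156190735) (.r 59 (.m
  2509045459589317984335) (.r 66 (.m 2582832435884156190735) (.r 58 (.r 69 (.m
  2509045459589317927005) (.f 5 (.r 27 (.m 2509045459589317967955) (.r 42 (.m
  2444481837735390225045) (.r 43 (.m 2509045441993507873365) (.f 7 (.r 35 (.m
  2361471507274553360505) (.f 2 (.r 45 (.m 1180735753499820902475) (.f 3 (.m
  2361471508648942895205))))))))))) (.f 4 (.f 10 (.r 15 (.m 1180663680519330900165) (.r 42 (.m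
  1180735753499829567495) (.r 43 (.m 1180735753499820918855) (.f 7 (.r 45 (.m
  1180735753499887994955) (.f 3 (.m 1180736879399735951475))))))))))))) (.f 1 (.f 10 (.r 45 (.m
  2373000722045710368885) (.r 69 (.m 2363777352207878848605) (.r 81 (.m 1180753767898338566205)
  (.f 9 (.m 2363777350008855593085)))))))))))))
def c9 : L := L.mk 49185983605641596126934103995218912957336070561923585 1314556290116377708551
  (.r 53 (.r 16 (.m 2509054466788572602445) (.r 55 (.m 3541918995072082444365) (.r 17 (.l 0
  205163983024656) (.r 66 (.r 22 (.m 2582832435884156190735) (.r 30 (.m 3544229341544625340425)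
  (.r 46 (.m 2509045459589318246415) (.r 79 (.m 2363921447602597855245) (.r 94 (.r 21 (.m
  2437564326303693799485) (.r 54 (.m 2437564327403205427245) (.r 59 (.m 2363777351108367220845)
  (.r 81 (.m 2437564326303693799485) (.r 119 (.m 2363777350008855593085) (.r 18 (.r 58 (.r 69 (.m
  2435258485493536915485) (.f 5 (.f 9 (.m 2435258486043292729365)))) (.f 4 (.f 10 (.r 15 (.m
  1180735753499829182565) (.f 1 (.r 35 (.m 1180735753499821156365) (.f 11 (.m
  2361471489405308117565)))))))) (.f 6 (.l 0 205163899138656)))))))) (.f 7 (.f 10 (.r 14 (.m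
  2472297194935547863065) (.r 21 (.m 2472296069035641020445) (.f 1 (.r 35 (.m
  3541918994934643761165) (.f 2 (.r 41 (.m 1180740257133807960135) (.f 5 (.m
  1180735753534180864020))))))))))))))) (.f 5 (.r 27 (.m 2508901326959916662865) (.r 43 (.m
  3541918995072082411605) (.r 19 (.r 14 (.r 79 (.m 3541918994934643318905) (.f 7 (.r 54 (.m
  2453705227368223211565) (.r 59 (.m 2379918251073385005165) (.r 81 (.m 2435258483294513659965)
  (.r 28 (.r 58 (.m 1180735753499829506070) (.f 4 (.r 30 (.m 3615705971229481676820) (.f 6 (.m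
  1180735753498210437255))))) (.f 4 (.m 1180735753635649095885)))))))) (.r 35 (.l 1
  201866250302736) (.f 2 (.m 3615705971229481517115)))) (.f 7 (.r 14 (.m 1180735753499829100665)
  (.r 21 (.m 2363777350008855593085) (.f 1 (.r 35 (.m 2366083193018103103545) (.f 2 (.r 40 (.m
  1180735753499821103130) (.r 42 (.m 3544224837943857414165) (.r 45 (.m 1180735753499821168650)
  (.f 3 (.m 1180735753499829239895))))))))))))))))))) (.r 66 (.r 30 (.m 2363921447602664898585)
  (.r 79 (.m 2363921447602597789725) (.r 69 (.r 22 (.m 2582832435884156125215) (.r 46 (.m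
  2509045459589318180895) (.r 58 (.m 2363777358804948484125) (.f 10 (.r 16 (.m
  2382224094082565144685) (.r 17 (.m 2363777352207878848605) (.f 5 (.r 54 (.m
  1180735753637268357165) (.r 59 (.m 2379918251073385005165) (.f 4 (.m
  1180735753499820918855))))))))))) (.f 5 (.r 14 (.m 2582688303117315891225) (.r 27 (.m
  2582688303254754869265) (.f 2 (.r 19 (.m 2435402581163133501465) (.r 43 (.m
  2435402581025795211285) (.f 7 (.m 2435258483569391566905))))))))))) (.f 5 (.r 27 (.m
  2508901326959916662865) (.r 43 (.m 3541918995072082411605) (.r 46 (.m 2363777358804948222045)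
  (.r 58 (.m 2363777358804948222045) (.r 82 (.m 2363777358804948222045) (.f 10 (.r 42 (.m
  2444481857530358136855) (.r 47 (.m 2370694881235519930455) (.f 3 (.m
  1180735753498210117845)))))))))))))
def c10 : L := L.mk 192132748459537484870832923628196686833370557252097 4837460882999543815 (.r
  71 (.l 2 205163983024656) (.r 68 (.l 0 205163983024656) (.r 69 (.r 41 (.r 27 (.m
  2509054466788606132305) (.r 43 (.m 3541918995072082411605) (.r 66 (.r 30 (.m
  3541919003729729847315) (.r 35 (.l 2 201866250302736) (.f 2 (.l 0 201866250302736)))) (.f 5 (.r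
  14 (.m 2508901327372233498705) (.r 19 (.m 3541918995484399247445) (.r 55 (.m
  2363921448152353407045) (.f 7 (.r 35 (.m 2363777350283867717745) (.f 2 (.l 0
  201866250302736))))))))))) (.f 5 (.r 16 (.m 2582688303117315940365) (.r 46 (.m
  2435258492090606288925) (.r 55 (.m 2435402581025661059085) (.r 58 (.m 2435258492090606288925)
  (.r 82 (.m 2509045459589317927005) (.f 10 (.r 40 (.m 1180735754049585348615) (.r 42 (.m
  2435258485493637578775) (.r 47 (.m 2435258485493637578775) (.f 3 (.r 28 (.m
  2435258483912988950580) (.f 4 (.m 2435258466799657832970))))))))))))))) (.f 5 (.r 14 (.m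
  2582692807266699075585) (.r 16 (.m 2582692807266699059205) (.r 19 (.m 3615705971779237519365)
  (.r 21 (.m 2582688303667340124165) (.r 22 (.m 2582832435884290408455) (.f 1 (.r 27 (.m
  2582692806716943286275) (.r 30 (.m 3541923507879112998915) (.f 2 (.r 40 (.m
  2582688303117315973125) (.r 42 (.m 2508829256584324456965) (.r 43 (.m 2435330514505338757125)
  (.r 45 (.m 2582688303117584343045) (.f 3 (.m 2582832435884156198925)))))))))))))))))))
def c11 : L := L.mk 12591611803044248608500364360011116687583248891259322881 76064443402761 (.r
  22 (.m 2509045460688963764295) (.r 82 (.m 2509045460688829546575) (.f 10 (.r 21 (.m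
  2361471507137751941205) (.r 81 (.m 2361471511398225281055) (.f 9 (.m
  2361471506999675453565)))))))
def c12 : L := L.mk 12591611803044248608495130622778459642724354152651227649
  327081678449748830914567 (.r 41 (.m 2361480522995022741585) (.r 46 (.m 2361471515795768000625)
  (.r 71 (.r 53 (.l 0 205163983024656) (.f 5 (.r 16 (.m 2508905830971860852805) (.r 19 (.m
  2361363403854453940305) (.r 21 (.m 2508901327372233482325) (.r 22 (.m 2509045442543129469525)
  (.r 30 (.m 2363669246588789997585) (.r 79 (.m 2363921448152353603605) (.r 14 (.r 28 (.m
  2508905830971860869185) (.f 2 (.r 42 (.m 2361543534353351467665) (.r 47 (.m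
  2361363403579576049745) (.r 45 (.r 15 (.m 2361363457992046977105) (.f 3 (.l 1 205163983020816)))
  (.f 3 (.f 9 (.m 2361331950384626835525)))))))) (.f 1 (.f 2 (.r 40 (.m 2508905830422105071685)
  (.r 42 (.m 2508829256584056021525) (.r 43 (.m 2361620110392034635780) (.f 3 (.f 7 (.m
  2361471507824309174385))))))))))))))))) (.f 5 (.r 14 (.m 2435154953825605935105) (.r 16 (.m
  2582692807266699059205) (.r 19 (.m 3615710475378864824325) (.r 21 (.m 2582692807266699059205)
  (.r 22 (.m 2582832436983801970695) (.f 1 (.r 30 (.m 3541959808805394055170) (.f 2 (.r 40 (.m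
  2435267500385212841985) (.r 42 (.m 2508829256584056021525) (.r 43 (.m 3615710474829109043205)
  (.f 3 (.m 2582692806699360732195)))))))))))))))))
def c13 : L := L.mk 49185983605641596126934103995228357690301809852350977
  327081678449748830914567 (.r 27 (.l 0 205163983024656) (.r 28 (.r 32 (.r 43 (.m
  2361620108330450042985) (.l 1 201866250302736)) (.f 2 (.r 17 (.m 2361480505407433613385) (.r 21
  (.m 2361620116987023728745) (.r 66 (.m 2363925951201688436745) (.f 5 (.r 45 (.m
  2361365654967072931905) (.f 9 (.m 2361327374353752522900))))))))) (.f 2 (.r 66 (.m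
  2363669246040107663385) (.r 17 (.r 53 (.m 3541959527329679040585) (.f 5 (.l 0 201866250302736)))
  (.f 5 (.l 0 201866250302736)))))))
def c14 : L := L.mk 192132748459537484870832923637641419799109847679489 327081678449748830914567
  (.r 68 (.l 0 205163983024656) (.r 71 (.r 41 (.r 27 (.m 2361480522995022741585) (.r 32 (.l 0
  201866250302736) (.f 2 (.r 17 (.m 2361620117537249321025) (.f 5 (.m 2363925951750370770945))))))
  (.f 5 (.r 14 (.m 2361543538485378424905) (.r 27 (.r 30 (.m 2363673750188417368065) (.f 2 (.l 0
  201866250302736))) (.f 2 (.m 2363673749638661554185)))))) (.f 5 (.r 14 (.m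
  3615710475378931933185) (.r 27 (.m 2435154867513612836865) (.f 2 (.m
  2508905830971861123075)))))))
def c15 : L := L.mk 192132748459537484870832923623474320350500912038401 20060878001021213 (.r 41
  (.r 28 (.r 27 (.m 2509054467888117760065) (.f 2 (.r 17 (.m 2582841444183056605185) (.f 5 (.m
  2363673749639735033865))))) (.f 2 (.m 2435267499289860947985))) (.f 5 (.r 14 (.m
  3615710474829176119305) (.f 2 (.m 2363673749638661554185)))))
def c16 : L := L.mk 750518548670068300276691107885172499220726481409 47413004295 (.r 34 (.l 15
  205163983024656) (.r 67 (.l 15 201866250302736) (.r 29 (.l 13 205163983024656) (.r 33 (.l 5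
  205163983024656) (.r 69 (.l 5 201866250302736) (.r 35 (.l 1 205163983024656) (.r 71 (.l 1
  201866250302736) (.r 32 (.l 0 205163983024656) (.r 68 (.l 0 201866250302736) (.f 2 (.f 5 (.m
  2582692807266699075585))))))))))))
def c17 : L := L.mk 12591611803044248608494906565531242451642463151938798081
  6442296987792681708151217129479 (.r 56 (.m 3578812483082062471245) (.r 40 (.r 33 (.m
  3578812483082062504005) (.r 69 (.m 3541918994934643400805) (.f 9 (.l 0 152529091838256)))) (.f 3
  (.r 68 (.m 1180740820083828359265) (.f 8 (.l 0 170117016461616))))))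
def c18 : L := L.mk 12591611803044248608494906565531242451643026101892219393
  1499956810505664399367 (.r 15 (.m 3541918994934643335285) (.r 42 (.m 3541918994934643597365) (.r
  82 (.r 47 (.m 2370694879036496945205) (.r 41 (.r 17 (.m 1180735753534180597845) (.r 43 (.m
  1217629241681599561815) (.r 16 (.l 0 205163983024656) (.f 1 (.r 30 (.m 1217665397989822177305)
  (.r 66 (.m 1180735753534180851735) (.f 6 (.l 0 205163899138656)))))))) (.r 43 (.r 46 (.m
  1180735753534180458615) (.f 3 (.r 28 (.m 608814761560168744035) (.r 33 (.m
  590368017486459192435) (.r 69 (.r 16 (.m 3541918994934643400805) (.r 54 (.m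
  1180735753534180786215) (.r 58 (.m 1180735753534180524135) (.r 59 (.m 2379774188659685752935)
  (.f 4 (.m 590368017486593426535)))))) (.f 9 (.l 1 152529091838256))))))) (.f 3 (.r 56 (.m
  1180735753534180896780) (.r 68 (.m 1180735753534180474995) (.f 8 (.l 1 170117016461616))))))))
  (.r 54 (.r 30 (.m 3541918994934643638315) (.f 6 (.r 56 (.m 1217629241681599856655) (.r 68 (.m
  3541918994934643752975) (.f 8 (.l 1 170117016461616)))))) (.f 6 (.r 33 (.m
  1217629241681599807515) (.r 69 (.m 3541918994934643703835) (.f 9 (.l 1 152529091838256)))))))))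
def c19 : L := L.mk 3223452621579327643774696263400627729896599039088781361665
  383993129033392007874823 (.r 16 (.r 66 (.m 2509054467884862939405) (.f 6 (.m
  2509045460688829693995))) (.f 1 (.r 33 (.m 2453705227370336641065) (.r 43 (.m
  1180758271532317302825) (.r 67 (.m 1180758271532317302825) (.f 7 (.r 69 (.m
  1180735753499829440550) (.f 9 (.m 2361471506999742562425)))))))))
def c20 : L := L.mk 12591611803044248608494906565531242451859198884006003201 5859270067158714631
  (.r 15 (.m 2509045459589317828725) (.r 42 (.m 1180735753534180728885) (.r 54 (.l 0
  205163983024656) (.f 6 (.r 14 (.m 2509045428803059327545) (.f 1 (.l 0 205163899138656)))))))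
def c21 : L := L.mk 49185983605641596126933228771606415826435897282462209 1499956810505664399367
  (.r 19 (.l 2 205163983024656) (.r 79 (.l 2 205163899138656) (.r 22 (.l 0 205163983024656) (.r 82
  (.l 0 205163899138656) (.r 16 (.r 66 (.r 15 (.m 1217633745281227202565) (.f 1 (.m
  2509054466788572618825))) (.f 6 (.m 2363849408700324544545))) (.f 1 (.m
  2509054466788572569685)))))))
def c22 : L := L.mk 825229540813388257045470338931400176076611608847943068746241
  1499956810505664399367 (.r 16 (.m 3541923498534270967845) (.r 54 (.m 2361331878504054391845) (.r
  66 (.m 2372856589263305048085) (.r 82 (.m 2373000722045710630965) (.f 6 (.r 14 (.m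
  3541849180343252312625) (.r 19 (.m 3541849180343252296245) (.f 1 (.l 5 188538350093136)))))))))
def c23 : L := L.mk 3223552893802297879083821759541869753419950408327659454977
  1499956810505664399367 (.r 67 (.m 2361480514199064412245) (.r 94 (.m 2361471506999809671285) (.r
  79 (.l 0 205163983024656) (.r 19 (.r 30 (.m 3541849180343319405105) (.r 54 (.m
  3541923498534270967845) (.f 6 (.l 0 205163899138656)))) (.f 7 (.r 16 (.m 2361327444585976275045)
  (.r 17 (.m 2361327444585976340565) (.f 1 (.l 6 188538350158416)))))))))
def c24 : L := L.mk 12591611803044248608494906482898744829270709258430906881 8597741171970213895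
  (.r 43 (.m 3541918994934643318905) (.r 55 (.m 3541918994934643318905) (.r 67 (.m
  3541918994934643318905) (.r 79 (.m 3541918994934643318905) (.f 7 (.r 30 (.m
  1180735753499829354555) (.r 35 (.m 1180735753499829092475) (.r 66 (.r 47 (.m
  2390294544614813073510) (.r 59 (.m 2390294544614813073510) (.f 11 (.l 7 205159956488976)))) (.f
  6 (.m 1180740257648139067425))))))))))
def c25 : L := L.mk 192132748459537484606127598482598504965035167777281 7 (.r 19 (.m
  3541918994934643310715) (.r 43 (.m 3541918994934643310715) (.r 55 (.m 3541918994934643310715)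
  (.r 67 (.m 3541918994934643310715) (.f 7 (.m 1180735753499829092475))))))
def c26 : L := L.mk 825203871124307876806322191263252145990548754294068383777281
  98301852137427423852038151 (.r 40 (.m 2509045459589317894245) (.r 54 (.m 2509054748263549607940)
  (.r 56 (.m 2509045459589317845105) (.f 4 (.l 4 205099558446096)))))
def c27 : L := L.mk 211252191007822816462422581688895174164706032150029570882601473
  25165274313275303966299195399 (.r 16 (.m 2509045459589317877865) (.r 15 (.l 0 205163983024656)
  (.f 1 (.r 54 (.m 1180735753499862974505) (.r 66 (.m 2435330514505070288925) (.f 6 (.l 0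
  205163899138656)))))))
def c28 : L := L.mk 49185983605641596126934183223376704854627844507238913
  383990673163081889679367 (.r 119 (.r 15 (.l 4 205163983024656) (.r 42 (.l 4 205163899138656) (.r
  47 (.r 19 (.l 11 205163983020336) (.r 22 (.l 11 188538350093136) (.f 1 (.m
  2361480515300555251785)))) (.r 43 (.r 41 (.m 3541918994934643458135) (.f 3 (.m
  1180740257133807829095))) (.f 3 (.r 16 (.m 2361471507001788964965) (.r 54 (.m
  2361471507001789218855) (.r 55 (.m 1180735753534180524135) (.r 56 (.m 3541918994934710566995)
  (.r 59 (.m 2361471507001788956775) (.f 4 (.m 1180735738104780474435)))))))))))) (.f 9 (.r 29 (.m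
  1217629241681599545435) (.r 34 (.m 1180735753534180442235) (.r 14 (.l 3 205163983024656) (.r 30
  (.l 3 205163899138656) (.r 35 (.l 2 205163983024656) (.f 2 (.r 58 (.m 1180735753534180507755)
  (.r 22 (.l 0 205163983024656) (.r 82 (.l 0 205163899138656) (.f 10 (.r 56 (.m
  1180735753499820738675) (.r 68 (.m 1180735753499820738675) (.f 8 (.m
  2494057480029429301260))))))))))))))))
def c29 : L := L.mk 3223552893802297879083821515119584061806434699438553498113
  25165326960859639157709408263 (.r 14 (.m 2361480514201043624025) (.r 66 (.r 107 (.r 19 (.m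
  2361480514198896648285) (.r 67 (.m 2363786357208110334045) (.r 79 (.m 2363786357208110596125)
  (.r 94 (.m 2363777350008855593085) (.f 7 (.l 7 205163983020816)))))) (.f 8 (.l 7
  205099558453776))) (.r 41 (.r 67 (.r 15 (.m 2363633217776205824085) (.r 16 (.m
  2361331948735359492165) (.f 1 (.l 12 188667266343696)))) (.f 5 (.r 19 (.m
  2361331948735393038405) (.r 22 (.m 2361471508101434835015) (.f 1 (.m
  2361331887178277462085)))))) (.f 5 (.m 2361543565691043577935)))))
def c30 : L := L.mk 192132748459537484870832923623474319787550958617089 1499956810505664399367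
  (.r 45 (.l 8 205163983024656) (.r 69 (.l 1 205163983024656) (.f 9 (.r 29 (.m
  2509054466788572545115) (.r 68 (.l 1 201866250302736) (.r 17 (.l 0 205163983024656) (.r 66 (.l 0
  205163899138656) (.f 5 (.m 2361331948735359483975)))))))))
def c31 : L := L.mk 3223452621579327643790761555350224848453755990142846435841 1343490824 (.r 47
  (.m 2361471489963653603445) (.r 59 (.m 1180740257650286010405) (.r 107 (.m
  2361471489963653603445) (.r 119 (.m 1180735754050658639925) (.f 11 (.r 32 (.m
  2361471490231015318065) (.f 8 (.m 2361489506552596406805))))))))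
def c32 : L := L.mk 49185983605641596127177651366778298351951761618698753 5859270067158649096
  (.r 42 (.r 33 (.m 1180735754083936518195) (.r 54 (.m 1180740257683630981155) (.f 6 (.r 69 (.m
  1180735754084003741715) (.f 9 (.m 2361471507001856262195)))))) (.f 6 (.r 32 (.m
  1180740257133808074795) (.r 68 (.m 1180740257133875298315) (.f 8 (.m
  2361471489413965217835))))))
def c33 : L := L.mk 49185983605641596127177651366778169151841226683777537 5859206291155257608
  (.r 79 (.r 15 (.l 1 205163983024656) (.r 16 (.l 1 205099558453776) (.r 42 (.l 1 205163899138656)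
  (.r 54 (.l 1 205099474567776) (.f 1 (.f 6 (.r 27 (.m 1180771769105057325105) (.r 28 (.m
  1180699711515448582185) (.r 29 (.m 1180771769101165011225) (.r 32 (.m 1180771769104923107385)
  (.r 33 (.m 1180699711515180146745) (.f 2 (.m 2361471498200327143995))))))))))))) (.r 30 (.l 0
  205163983024656) (.f 6 (.m 2509045460688963895335))))
def c34 : L := L.mk 49185983605641596127177651366778168934542544663151105 22887773716681746 (.r
  16 (.m 3541923499084026486885) (.f 1 (.r 28 (.m 2509054467888218398785) (.r 33 (.m
  2509054466788706771025) (.r 42 (.m 2435267473457746550805) (.f 6 (.r 27 (.m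
  1180740539158540599330) (.r 29 (.m 1217633745829943066625) (.r 32 (.m 1180740539158540599330)
  (.f 2 (.m 2361471512499481235490)))))))))))
def c35 : L := L.mk 750518548670068300276691107885172217745749770753 5859206291155257608 (.r 82
  (.r 22 (.l 1 205163983024656) (.r 79 (.l 1 201866166416736) (.r 15 (.l 0 205163983024656) (.r 16
  (.l 0 205099558453776) (.d 1))))) (.r 79 (.r 42 (.r 54 (.m 3541923499084026740775) (.f 6 (.l 2
  201866250302736))) (.f 6 (.l 2 201866250302736))) (.f 6 (.m 1217633745830982991875))))
def c36 : L := L.mk 2931713080742454297955824640176439677606363649 47413004295 (.r 20 (.l 19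
  205163983024656) (.r 21 (.l 19 205099558453776) (.r 80 (.l 19 205163899138656) (.r 81 (.l 19
  205099474567776) (.r 18 (.r 32 (.l 5 205163983024656) (.r 33 (.l 5 205099558453776) (.r 68 (.l 5
  201866250302736) (.r 69 (.l 5 201801825731856) (.f 8 (.f 9 (.r 29 (.m 2361480514198896656475)
  (.r 34 (.m 2361471506999641915515) (.r 14 (.r 15 (.m 2361327374217299141745) (.r 16 (.m
  2361327374217299174505) (.r 17 (.m 2361480514198896664665) (.f 1 (.m 2361472069949595320445)))))
  (.f 2 (.r 15 (.m 2361327374217299141745) (.r 16 (.m 2361327374217299174505) (.f 1 (.m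
  2361471506999641907325)))))))))))))) (.r 19 (.l 0 205163983024656) (.r 22 (.l 0 201866250302736)
  (.r 79 (.l 0 205163899138656) (.r 82 (.l 0 201866166416736) (.f 1 (.f 6 (.m
  1217633745795557630085))))))))))))
def c37 : L := L.mk 750518548670068299959778472235599575590944047617 91306878109703 (.r 82 (.r
  59 (.m 2361471508099288006695) (.r 119 (.m 2361471506999776378935) (.r 35 (.l 0 205163915916816)
  (.f 11 (.l 0 205163967296016))))) (.r 80 (.l 0 205163932705296) (.r 81 (.r 18 (.r 15 (.m
  3541918995484399378485) (.r 20 (.m 3541918994934643564605) (.r 29 (.m 2363786361606291079185)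
  (.r 34 (.m 2363777354407036338225) (.r 42 (.m 2363921448152353472565) (.r 67 (.m
  2363786361606291062805) (.r 94 (.m 2363777354407036321845) (.r 66 (.r 40 (.m
  2373009730346623959045) (.r 41 (.m 2363921448152353603605) (.r 45 (.m 2373009729247112331285)
  (.f 3 (.r 30 (.m 2363786366000982704145) (.f 6 (.r 56 (.m 2363786341271633920005) (.r 68 (.m
  1180735753534214373405) (.f 8 (.m 2363786361606156877845)))))))))) (.f 6 (.r 40 (.m
  2363921448152353538085) (.r 56 (.m 2363921448152353538085) (.r 68 (.r 17 (.m
  3541918994934643695645) (.r 41 (.r 45 (.m 2363786361608303837205) (.r 46 (.r 27 (.m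
  2363777354409049112625) (.f 3 (.r 32 (.m 1180735753774841471025) (.f 8 (.m
  2363777354406902136885))))) (.f 10 (.l 0 205163931783696)))) (.f 5 (.l 11 201866250302736))))
  (.f 8 (.l 0 205163932689936)))))))))))))) (.r 66 (.r 16 (.m 2363786358307756441605) (.r 21 (.m
  2363786357208244813845) (.r 42 (.m 1217629242231355605015) (.f 6 (.r 32 (.m
  2509054466788707024915) (.r 68 (.m 3541918995484399501335) (.r 20 (.r 14 (.m
  1217629241681599815705) (.r 17 (.m 3541918994934643695645) (.f 1 (.m 2370703868642491114005))))
  (.f 8 (.l 0 205163932828176))))))))) (.f 6 (.r 20 (.m 3541918994934643589175) (.r 32 (.m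
  3541918994934643589175) (.r 56 (.m 3541918994934643589175) (.f 8 (.m
  2361615604593383997495)))))))) (.r 18 (.r 54 (.r 15 (.m 3541923499084026748965) (.r 40 (.m
  2363921448152353538085) (.r 42 (.m 2363925951751980843045) (.f 6 (.r 27 (.m
  2363786367100494331905) (.r 41 (.m 2363925951751980974085) (.f 3 (.m
  2363786358859524997125)))))))) (.f 6 (.m 2363786340172122292245))) (.f 6 (.m
  1217633745830982975495))))))
def c38 : L := L.mk 2931713080742454296717884600891059402707239425 91306878109703 (.r 47 (.l 0
  205163983024656) (.r 59 (.l 0 205099558453776) (.r 35 (.l 1 205163915916816) (.f 11 (.l 1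
  135968029229856)))))
def c39 : L := L.mk 825203871124307876635517842944238879083954970349061460394497 589438222 (.r
  15 (.m 2373009733643011620885) (.r 41 (.m 3541918994934643720215) (.r 47 (.m
  2370703890633797926935) (.r 27 (.r 40 (.m 608814616424634534915) (.r 43 (.m
  295192980758179367955) (.f 3 (.m 1180735753500433395720)))) (.f 2 (.r 40 (.m
  590370124150872231075) (.f 3 (.m 1180735753500357593175))))))))
def c40 : L := L.mk 825203871124307876635519187972472527047195444932453173756417
  5918312698940557319 (.r 15 (.m 1770959497742207983665) (.r 46 (.m 1189959127770125828115) (.r 47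
  (.m 2370838976630305849395) (.r 94 (.r 43 (.l 1 205163932705296) (.r 41 (.r 20 (.m
  1180735753499888224275) (.r 27 (.r 40 (.m 608814621098497838115) (.f 3 (.m
  590367877024788286515))) (.f 3 (.r 16 (.m 1180735753499888195610) (.r 22 (.m
  1180735753499888138280) (.f 1 (.f 10 (.m 1180735753499821066275)))))))) (.f 3 (.m
  590367877024788286515)))) (.f 10 (.l 3 205163965329936))))))
def c41 : L := L.mk 3223452621579327643107491594283342725054848736184678679041 91599963097863
  (.r 47 (.m 2373144819639519543345) (.r 35 (.r 19 (.m 3541918994934643572795) (.r 43 (.m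
  3544224837943857266745) (.f 7 (.m 1180735753499829362745)))) (.f 11 (.m
  2363633217226513122345))))
def c42 : L := L.mk 192132748459537484831064425119145858396633480495617 1537010737190785320967
  (.r 29 (.m 1217629241681599807515) (.r 34 (.m 1180735753534180704315) (.r 66 (.m
  1217629241681666899995) (.f 6 (.r 67 (.r 14 (.m 3544224837943857266745) (.r 35 (.m
  3541918994934643572795) (.r 32 (.l 2 205163983024656) (.r 33 (.l 2 205099558453776) (.d 2)))))
  (.r 71 (.r 68 (.l 1 205163983024656) (.r 69 (.l 1 205099558453776) (.f 5 (.r 43 (.m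
  1475776685001131722755) (.r 55 (.m 1770924590176055396355) (.f 7 (.l 5 92772293023911))))))) (.r
  68 (.l 0 205163983024656) (.r 69 (.l 0 205099558453776) (.d 5)))))))))
def c43 : L := L.mk 192132748459537484809985694807778495288765849993729 357863345929 (.r 21 (.m
  3541918994934710673465) (.r 54 (.m 3544229341543551729705) (.f 6 (.r 33 (.m
  2511360309797786501145) (.r 69 (.m 3544224837943924490265) (.f 9 (.m
  2363786357210324697105)))))))
def c44 : L := L.mk 2931713080742454297027369610712404471432020481 6003948162069891079 (.r 81
  (.r 18 (.r 14 (.m 3541918994934710673465) (.r 17 (.m 1217629241681599799325) (.r 19 (.m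
  3541918994934643564605) (.r 22 (.m 1180735753534180696125) (.r 30 (.m 3544224837943924359225)
  (.r 34 (.m 2437564326303693815865) (.r 66 (.m 2511360309797786484765) (.f 6 (.r 94 (.m
  2437564326303693799485) (.f 10 (.r 15 (.m 1180771770204501844005) (.f 1 (.m
  1180735753500441741330))))))))))))) (.r 30 (.l 1 205163983024656) (.r 66 (.l 1 201866250302736)
  (.d 6)))) (.r 18 (.r 30 (.l 0 205163983024656) (.r 66 (.l 0 201866250302736) (.d 6))) (.f 6 (.m
  1217633745281294270475))))
def c45 : L := L.mk 11452004221650212085612272834729556291289601 47413004295 (.r 83 (.l 8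
  205163983024656) (.r 79 (.l 6 205163983024656) (.r 82 (.l 6 201866250302736) (.r 80 (.l 0
  205163983024656) (.r 81 (.l 0 205099558453776) (.f 6 (.m 1217633745831083638785)))))))
def c46 : L := L.mk 192132748459537484566279866928086940169607210795521 1517768880183937927175
  (.r 69 (.r 17 (.m 1180735753534180565085) (.r 18 (.m 1180735753534180827165) (.r 29 (.m
  1180735753534180573275) (.f 5 (.r 30 (.m 1180735753534180835355) (.r 83 (.m
  2472151971441899225115) (.r 79 (.l 0 205163963102736) (.f 6 (.r 15 (.m 1180735753534180728885)
  (.r 27 (.m 1180735753534180737075) (.r 40 (.m 590367872351327063175) (.r 43 (.m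
  590367872351327538195) (.r 45 (.m 590367872351326997655) (.f 3 (.m
  1180735753499896479795))))))))))))))) (.r 53 (.r 17 (.m 1180740257133807935565) (.f 5 (.m
  1180740257133807943755))) (.f 5 (.r 14 (.m 1180760807006130946050) (.r 15 (.m
  1180758553007294136330) (.r 16 (.m 1180740257133807935565) (.r 20 (.m 1180760804807107821570)
  (.r 21 (.m 1180735753534180565085) (.f 1 (.r 27 (.m 1180758553007294128140) (.r 28 (.m
  1180740257133807943755) (.r 30 (.m 1180742792607621464130) (.r 32 (.m 1180760804807107813380)
  (.f 2 (.m 1180735753534180573275)))))))))))))))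
def c47 : L := L.mk 12591611803044248608474137457327683506887229880486003201 77013226948615 (.r
  41 (.m 2435258474494762705425) (.r 53 (.m 2435258474503486857225) (.r 68 (.m
  2435258492091109498905) (.r 69 (.m 2435258485495650344985) (.f 5 (.l 1 205163979879696))))))
def c48 : L := L.mk 49185983605641596038420793570764980650359425708786177 5928450196148652039
  (.r 83 (.r 20 (.l 2 205163964142176) (.r 21 (.l 2 205163965002336) (.r 19 (.l 2 205163963101536)
  (.r 14 (.l 0 205163983024656) (.r 30 (.l 0 205163899138656) (.f 1 (.r 29 (.m
  3541923499084630466625) (.r 32 (.m 2509045460688829456485) (.r 33 (.m 2509045459589452079205)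
  (.f 2 (.m 2361471498209739186180))))))))))) (.r 79 (.l 2 205163963102736) (.r 80 (.l 2
  205163964162576) (.r 81 (.l 2 205163965329936) (.f 6 (.m 3544229342093307543585))))))
def c49 : L := L.mk 750518548670068298209315479019267621263465710081 1590352357525882887 (.r 16
  (.m 1180740257099523563625) (.r 21 (.m 1180735753499896193145) (.f 1 (.r 47 (.m
  1185379246190624800770) (.r 59 (.m 2363777351108367237225) (.r 119 (.m 2363777350008855609465)
  (.r 71 (.l 3 205163979878736) (.f 11 (.m 2361471489413897805945)))))))))
def c50 : L := L.mk 12591611803044336073005488100577036450296166337392869889 460351344392 (.r 41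
  (.m 1180740257649212399685) (.r 42 (.m 1180740257649212661765) (.r 68 (.m
  1180740257099456585805) (.r 80 (.m 1180740257099456847885) (.f 8 (.r 45 (.m
  2382224094082565144685) (.f 3 (.m 1180663687116400658535))))))))
def c51 : L := L.mk 192132748459538819473350353012594759481136009904641 8 (.r 15 (.m
  1180740257649212661765) (.r 20 (.m 1180740257099456847885) (.r 41 (.m 2474457815550758748165)
  (.r 42 (.m 2474457815550758748165) (.r 47 (.m 2363777357705571205125) (.r 68 (.m
  2474457815550624530445) (.r 80 (.m 2474457815550624530445) (.r 107 (.m 2363777357705436987405)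
  (.f 8 (.r 45 (.m 2492904558524822454285) (.f 3 (.m 1180663687118011271175))))))))))))
def c52 : L := L.mk 49185983605641937785177687892879048633958400327352833 249478252808 (.r 59
  (.r 15 (.m 2363777351108501438565) (.r 20 (.m 2363777351108367220845) (.r 41 (.m
  2363777351109038309445) (.r 42 (.m 2363777351110112051205) (.r 47 (.m 2361471508099287744615)
  (.r 68 (.m 2363777351108904091725) (.r 80 (.m 2363777351109977833485) (.r 107 (.m
  2361471508099153526895) (.f 8 (.r 21 (.m 2379918251073351450735) (.f 1 (.r 43 (.m
  2363777351108434329705) (.f 3 (.m 1180735753499829141615)))))))))))))) (.r 54 (.l 0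
  205163983024656) (.r 53 (.r 15 (.m 1180740257649212399685) (.r 20 (.m 1180740257099456585805)
  (.r 68 (.m 2400670839255786324045) (.r 80 (.m 2474457815550624530445) (.r 107 (.m
  2363777353307390476365) (.f 8 (.r 28 (.m 1180663687116937513035) (.f 4 (.r 21 (.m
  1180735753499820787815) (.f 1 (.l 0 205163967296016))))))))))) (.f 4 (.r 21 (.m
  1180735753499820771435) (.r 45 (.m 1180735753499820771435) (.r 69 (.m 1185356446717502883915)
  (.r 81 (.m 1185374461116012365835) (.f 9 (.m 2475610735953572888580))))))))))
def c53 : L := L.mk 750518548670068298925775741886903050714497614337 5928450196148652039 (.r 58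
  (.r 17 (.l 4 205163983024656) (.r 18 (.l 4 205163967296016) (.r 20 (.l 3 205163983024656) (.r 21
  (.l 3 205099558453776) (.f 1 (.m 3541923499084026892290)))))) (.f 10 (.r 16 (.r 15 (.m
  1180740257649212268645) (.r 20 (.m 1180740257099456454765) (.r 47 (.m 2363777351108501438565)
  (.r 107 (.m 2363777351108367220845) (.r 17 (.l 2 205163983024656) (.r 18 (.l 2 205163967296016)
  (.f 1 (.r 59 (.m 2379918251075113058310) (.r 71 (.l 7 205163979878736) (.f 11 (.m
  2361471506997493916025))))))))))) (.r 17 (.l 0 205163983024656) (.r 18 (.l 0 205163967296016)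
  (.r 20 (.l 3 205163983024656) (.f 1 (.m 1180735754049576982530))))))))
def c54 : L := L.mk 2931713080742454292678801862326865287530611201 23157961317222407 (.r 22 (.r
  71 (.l 8 205163978830416) (.r 67 (.l 8 205163979879696) (.r 68 (.l 7 205163983024656) (.r 69 (.l
  7 205099558453776) (.f 5 (.m 1180740257683563757635)))))) (.r 46 (.l 0 205163983024656) (.r 58
  (.l 0 205099558453776) (.d 10))))
def c55 : L := L.mk 750518548670068300039316105408118368907181621761 1518345339836729722887 (.r
  83 (.r 81 (.r 22 (.m 2435258483294480121915) (.r 46 (.m 2435258483294480121915) (.f 10 (.m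
  2435258483294480105535)))) (.r 54 (.r 19 (.m 2435259610293898575915) (.r 30 (.m
  3541923498534338035755) (.f 6 (.l 0 201866249253456)))) (.f 6 (.r 16 (.m 2361332511135624331305)
  (.r 21 (.m 2361328007535996960825) (.r 58 (.r 14 (.m 2361471515796808163385) (.r 15 (.m
  2361471515795902447665) (.r 20 (.m 2361471515795768229945) (.f 1 (.m 2361471480887313965625)))))
  (.r 53 (.r 19 (.m 2398366122147553222665) (.l 0 201866249253456)) (.r 55 (.r 14 (.m
  2361615608991430238265) (.r 15 (.m 2361615605280578748465) (.r 20 (.m 2361615604730822934585)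
  (.f 1 (.m 2361472606512342901305))))) (.f 4 (.r 19 (.m 2361403926751173689385) (.l 0
  201866249253456))))))))))) (.r 81 (.r 18 (.r 19 (.m 3541918994934643564605) (.l 0
  201866249253456)) (.f 6 (.r 22 (.m 1180735753534180704315) (.r 46 (.m 1180735753534180704315)
  (.f 10 (.m 1180735753499820967995)))))) (.f 6 (.m 3541923498534338043945))))
def c56 : L := L.mk 2931713080742454294226226911433590631154516481 5928498574660274183 (.r 79
  (.l 10 205163963102736) (.r 80 (.l 0 205163983024656) (.r 81 (.l 0 205099558453776) (.f 6 (.m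
  3541923499084093849635)))))
def c57 : L := L.mk 3223452621579327642408255136957061810106585667343961227777 89107854854151
  (.r 21 (.m 1180735885444571471925) (.r 69 (.m 1180735754084003749905) (.r 119 (.r 45 (.m
  1180735762329233293365) (.f 9 (.l 11 205163965068816))) (.f 9 (.l 11 205163965068816)))))
def c58 : L := L.mk 49185983605641937785239251581952815363122294750904833 74814203693063 (.r 20
  (.m 1180740257099523694665) (.r 80 (.m 1180740257099456847885) (.r 107 (.m
  1180740257099523694665) (.f 8 (.l 12 205163980997136)))))
def c59 : L := L.mk 12591611803044336073010863813431725536864563990855090689 74814203693063 (.r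
  20 (.m 1180740257099523694665) (.r 80 (.m 1180740257099523956745) (.r 107 (.m
  1180740257099523694665) (.f 8 (.l 13 205163980924176)))))
def c60 : L := L.mk 49185983605641937785177687892864826195684945146610177 23157961317222407 (.r
  71 (.l 14 205163978830416) (.r 68 (.l 14 205163980935696) (.r 69 (.r 29 (.r 17 (.l 1
  205163983024656) (.r 41 (.r 20 (.m 1180740257099448240195) (.r 56 (.m 1180735753499820869715)
  (.r 80 (.m 1180740261497494751235) (.f 8 (.m 1180740257099448240195))))) (.f 5 (.r 83 (.l 14
  205163962053216) (.r 59 (.l 14 205163978895936) (.r 107 (.l 1 169855325180736) (.f 11 (.m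
  2361471508099287744615)))))))) (.r 67 (.r 17 (.l 1 205163983024656) (.f 5 (.r 20 (.m
  1180735753499887962195) (.r 32 (.m 1180735753499820853335) (.r 56 (.m 1180735753499887962195)
  (.f 8 (.m 1180735757897934473235))))))) (.f 5 (.l 1 205163983024656)))) (.r 29 (.r 53 (.r 67 (.r
  17 (.l 0 205163983024656) (.f 5 (.r 20 (.m 1180741382999355066435) (.r 32 (.m
  1180740257099448223815) (.r 80 (.m 1180741387397401577475) (.f 8 (.m
  1180663687383093413955))))))) (.f 5 (.m 3544229342093307412545))) (.f 5 (.r 54 (.m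
  3544247356491816894465) (.r 79 (.m 3544229342093240320065) (.r 80 (.m 1180740261497494751235)
  (.r 81 (.m 3544229342093240565765) (.f 6 (.m 1183047217245761700105)))))))) (.f 5 (.m
  3544229342093307412545))))))
def c61 : L := L.mk 192132748459538819472795758283161212522989592183297 9 (.r 21 (.m
  2379918251073351450735) (.r 33 (.m 2379918251073351450735) (.r 45 (.m 2379918251073351450735)
  (.r 69 (.m 2379918251073351467115) (.f 9 (.m 2361471506999910350955))))))
def c62 : L := L.mk 12591611803044336073005529537537090799498063046420660737 47413004295 (.r 20
  (.m 2363777351108367220845) (.r 47 (.m 2361471508099287744615) (.r 107 (.m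
  2361471508099153526895) (.r 32 (.r 35 (.r 19 (.m 2361471508099220635755) (.r 43 (.m
  2361471508099220635755) (.r 67 (.m 2361471508099220635755) (.r 79 (.m 2361471508099757506635)
  (.f 7 (.r 21 (.m 2366083193155508240505) (.r 33 (.m 1180735753499829092475) (.r 69 (.m
  1180744760699083833435) (.r 81 (.m 1180753767898338705435) (.f 9 (.m
  2361471506999709007995))))))))))) (.r 83 (.l 16 205163962053216) (.f 11 (.l 16
  205163978830416)))) (.r 56 (.l 0 205163983024656) (.f 8 (.l 16 205163980935696)))))))
def c63 : L := L.mk 12591611803044336073005488893489720981891188708513874433 47413004295 (.r 33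
  (.m 1180735753499829149805) (.r 45 (.m 1180735753499829149805) (.r 69 (.m
  1180735753499829149805) (.r 81 (.m 1180735753499829149805) (.f 9 (.l 0 151369517568576))))))
def c64 : L := L.mk 211252191007824283873404856393400152322078020950438492015624705
  64918599043079 (.r 83 (.m 2435258456910764073225) (.r 119 (.l 1 152400309785136) (.r 71 (.l 18
  205163978830416) (.f 11 (.l 1 203037974020656)))))
def c65 : L := L.mk 750518548670073513564986995699302791046320292353 9 (.r 21 (.m
  1180735753499820787815) (.r 33 (.m 1180735753499820787815) (.r 69 (.m 1180735753499820787815)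
  (.r 81 (.m 1180753767898330269735) (.f 9 (.m 1180735753499820787815))))))
def c66 : L := L.mk 750518548670073513564986995699303635471250424321 3672328 (.r 32 (.l 0
  205163983024656) (.r 20 (.l 0 205163983024416) (.r 68 (.l 0 205163979879696) (.r 80 (.l 0
  205163963102736) (.d 8)))))
def c67 : L := L.mk 12591611803044336073005488814261558467628539964830188033
  1092553034235497744391 (.r 16 (.r 20 (.m 1180740257099523563625) (.r 107 (.m
  2363777351108367237225) (.r 32 (.r 35 (.r 21 (.m 1180735753499821053990) (.r 33 (.m
  1180735753499821062180) (.r 69 (.m 1180735753499821062180) (.r 81 (.m 1180753767898330282020)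
  (.f 9 (.m 2361471506997493965165)))))) (.r 83 (.l 21 205163962053216) (.f 11 (.m
  2361471506999776116855)))) (.f 8 (.l 21 205163980935696))))) (.f 4 (.r 35 (.l 0 205163983024656)
  (.r 71 (.l 0 205163979879696) (.r 83 (.l 0 205163963102736) (.f 11 (.m
  2361471506999641915515)))))))
def c68 : L := L.mk 12591611803044336073005488655805233439099864777742287361
  1092553034235497744391 (.r 55 (.l 0 205163983024656) (.f 4 (.r 20 (.m 1180749264298770208770)
  (.r 107 (.m 2363777353307390492745) (.r 80 (.l 22 205163964162576) (.f 8 (.l 22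
  205163980935696)))))))
def c69 : L := L.mk 12591611803044336073005488735033395953364202371286237697
  99463575409042253500975111 (.r 56 (.r 53 (.r 35 (.r 16 (.l 5 205163983024656) (.r 55 (.r 33 (.l
  6 205163982894096) (.r 14 (.l 4 205163983024656) (.r 30 (.r 32 (.r 21 (.m
  1180736316449774475300) (.r 69 (.m 627261364896524422155) (.r 81 (.m 664154853043943394315) (.f
  9 (.m 2402976681165488390235))))) (.f 2 (.r 20 (.m 1180663687116400805955) (.r 68 (.m
  1180663687116400936995) (.r 80 (.m 1180663687116400805955) (.f 8 (.m
  2361471489405310283820))))))) (.f 2 (.r 19 (.m 1180663687116409159755) (.r 20 (.m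
  1180663687116400805955) (.r 21 (.m 1180736316449774475300) (.f 1 (.l 6 43196734612401)))))))))
  (.f 4 (.r 33 (.r 17 (.m 1180735753499829280845) (.r 18 (.m 1180735753499829411885) (.r 41 (.m
  1180735753499829415980) (.r 42 (.m 1180735753499829153900) (.r 71 (.m 2416811739220770553935)
  (.r 83 (.m 2453705227368189657135) (.r 30 (.r 67 (.l 6 205163981845776) (.f 5 (.m
  590367870152036076555))) (.f 6 (.m 590367876749910559755))))))))) (.r 14 (.l 4 205163983024656)
  (.r 30 (.r 32 (.r 19 (.m 1180740257099456593995) (.r 43 (.m 1180663687116400658535) (.r 67 (.m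
  1180663689315432546315) (.f 7 (.m 1180663691514455670795))))) (.f 2 (.r 19 (.m
  1180627685802751705155) (.r 20 (.m 1180663687116400805955) (.r 45 (.m 1180735753500433395720)
  (.r 67 (.m 1180636693002006577155) (.r 69 (.m 1180744760699075741715) (.r 79 (.m
  1180645700201261187075) (.f 7 (.r 21 (.m 1180754612323260336180) (.f 1 (.f 9 (.m
  2361471511398040731690))))))))))))) (.f 2 (.r 19 (.m 1180663687116400932900) (.r 43 (.m
  1180663687116400658535) (.r 79 (.m 1180663691514447181860) (.f 7 (.l 23
  205163980924176)))))))))))) (.r 71 (.l 23 205163978830416) (.r 83 (.l 23 205163962053216) (.f 11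
  (.m 2361471506999642046555))))) (.r 16 (.l 5 205163983024656) (.f 4 (.r 35 (.r 71 (.l 23
  205163978830416) (.r 69 (.l 8 205163982041616) (.r 17 (.r 41 (.m 1183511081384810676225) (.f 5
  (.m 1180663687108115105805))) (.f 5 (.l 10 201801828876576))))) (.r 71 (.l 23 205163978830416)
  (.r 83 (.l 23 205163962053216) (.f 11 (.m 2361471506999641899135)))))))) (.r 53 (.l 0
  205163983024656) (.f 4 (.l 1 205163983024656))))
def c70 : L := L.mk 49185983605641937785177687892864844642429018856161793
  388529512621907722700807 (.r 59 (.l 7 205163983024656) (.r 54 (.l 0 205163983024656) (.r 53 (.r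
  56 (.r 16 (.l 6 205163983024656) (.f 4 (.r 83 (.l 24 205163962053216) (.r 30 (.l 0
  205163967296016) (.r 81 (.l 4 201801808954896) (.f 6 (.m 3544152771827532496905))))))) (.l 1
  205163983024656)) (.f 4 (.l 6 205163983024656)))))
def c71 : L := L.mk 750518548670068298925775741830986076266088825345 5928463390288185351 (.r 58
  (.r 83 (.l 25 205163962053216) (.r 79 (.r 80 (.l 25 205163964162576) (.r 81 (.l 25
  205163965329936) (.r 18 (.r 42 (.l 13 205163983024656) (.r 54 (.l 13 205099558453776) (.d 6)))
  (.f 6 (.r 20 (.m 1180740257133808091175) (.r 32 (.m 1180740257408685998115) (.r 68 (.m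
  1180740257133808091175) (.f 8 (.m 1180663722293122369575))))))))) (.r 80 (.l 25 205163964162576)
  (.r 81 (.l 25 205163965329936) (.f 6 (.m 1183046100692844675105)))))) (.f 10 (.r 28 (.l 10
  205163983024656) (.r 29 (.l 0 205163983024656) (.r 30 (.l 0 205163967296016) (.r 35 (.r 32 (.r
  33 (.r 19 (.m 1180735753499829092475) (.r 43 (.m 1180735753499829092475) (.r 55 (.m
  1180735753499829092475) (.r 67 (.m 1180735753499829092475) (.f 7 (.m
  1180735753499829092475)))))) (.f 2 (.r 43 (.m 1180767560172189026310) (.r 47 (.m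
  1180767560172197412870) (.r 107 (.m 2361471514902381723660) (.r 59 (.r 19 (.m
  2361471480611429425785) (.r 21 (.m 1180735753499820714105) (.r 67 (.m 2361471508099220635755)
  (.r 79 (.m 2361471508099220635755) (.f 7 (.r 119 (.m 2361472069949662429305) (.r 69 (.l 25
  205163980989456) (.f 9 (.l 4 205099558384656))))))))) (.r 71 (.l 25 205163978830416) (.f 11 (.l
  9 205027080811536))))))))) (.f 2 (.l 5 201801828869136))) (.f 2 (.l 5 201801828869136))))))))
def c72 : L := L.mk 750518548670068299005003904345250413859632775681 1517695660406109440007 (.r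
  83 (.l 26 205163962053216) (.r 80 (.l 26 205163964162576) (.r 30 (.l 0 205163979879696) (.f 6
  (.m 1183041597093150195765)))))
def c73 : L := L.mk 2931713080742454289880138534002024299677024769 5928463390288185351 (.r 66
  (.l 1 205163983024656) (.r 71 (.l 27 205163978830416) (.r 29 (.r 68 (.l 27 205163980935696) (.r
  69 (.r 67 (.l 0 205163983024656) (.f 5 (.m 1183041597093217173585))) (.f 5 (.m
  1183046100692777435205)))) (.r 67 (.l 0 205163983024656) (.f 5 (.m 1180735753534180565085))))))
def c74 : L := L.mk 11452004221650212069834606031046886128026113 5928463390288185351 (.r 46 (.l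
  0 205163983024656) (.r 58 (.l 0 205099558453776) (.d 10)))
def c75 : L := L.mk 825203871124313608884930052253047670268190773871221078688257
  99515909686663898884278279 (.r 30 (.r 42 (.l 15 205099542725136) (.r 54 (.l 15 205163967296016)
  (.f 6 (.r 68 (.l 29 205163980935696) (.r 20 (.l 0 94699889591226) (.r 32 (.l 29 205163964147216)
  (.f 8 (.l 0 167926616371776)))))))) (.r 42 (.l 15 205099542725136) (.f 6 (.l 15
  205163967296016))))
def c76 : L := L.mk 211252191007824283874890531881267715856479455393610739772228097
  1517686640012715165703 (.r 15 (.m 2361220400551403987505) (.r 16 (.m 2361620099675151409185) (.r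
  20 (.m 2361471489542814204465) (.r 21 (.m 2361471507135001296945) (.f 1 (.l 0
  205163899138656))))))
def c77 : L := L.mk 211252191007824283874890542520507244588579518668366739369296385
  5931610446373458442 (.r 20 (.m 2361471489542747111985) (.r 21 (.m 2361471507135001296945) (.r 54
  (.m 3544229342093307543585) (.f 6 (.r 15 (.m 2361219274651497161265) (.f 1 (.l 2
  89199651275706)))))))
def c78 : L := L.mk 12591611803044336073031633081331967400927559419684913665
  1517686640012715165703 (.r 80 (.l 32 205163964162576) (.r 81 (.l 32 205163965329936) (.r 18 (.r
  79 (.l 2 205163983024656) (.r 30 (.r 83 (.r 42 (.l 1 205163983024656) (.r 54 (.l 1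
  205099558453776) (.d 6))) (.f 6 (.m 3578816987231546507265))) (.f 6 (.m
  3541923499084093857825)))) (.r 30 (.r 83 (.r 42 (.l 0 205163983024656) (.r 54 (.l 0
  205099558453776) (.d 6))) (.f 6 (.m 3544229342093240565765))) (.f 6 (.m
  3544229342093240434725))))))
def c79 : L := L.mk 3223452621579350034689410369312636714566101074397496541697 47413004295 (.r
  21 (.m 1180735753499896586265) (.r 27 (.m 1180740538574424819810) (.r 41 (.m
  1180663687384173388305) (.r 42 (.m 1180663687383636648465) (.r 69 (.m 1180735753499896586265)
  (.r 81 (.m 1180735753499896586265) (.r 119 (.m 2474457814451112919065) (.f 9 (.r 43 (.m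
  1180735753499820722295) (.r 47 (.m 1180735760234337828885) (.f 3 (.l 15
  205099542725136))))))))))))
def c80 : L := L.mk 3223452621579350034689410369150155842335059462499680322049 23137157187591
  (.r 69 (.m 1180744761248906747985) (.r 81 (.m 1180735754049652269105) (.r 119 (.m
  2363777350008989827185) (.f 9 (.l 16 205099542725136)))))
def c81 : L := L.mk 12591611803044336073005509255127487166272975797995373057 5914930601173518343
  (.r 20 (.l 1 205163983024656) (.r 21 (.l 1 205099558453776) (.r 18 (.r 15 (.l 0 205163983024656)
  (.r 16 (.l 0 205099558453776) (.d 1))) (.f 1 (.r 80 (.m 1180740257099523956745) (.r 81 (.m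
  1180735754049652400145) (.r 83 (.m 3541923499084093726785) (.f 6 (.m
  147592003276511518725)))))))))
def c82 : L := L.mk 49185983605641937785015428616054576661943367835517441 37512731822343 (.r 33
  (.r 19 (.m 1180735753499829092475) (.r 43 (.m 1180735753499829092475) (.r 55 (.m
  1180735753499829092475) (.r 67 (.m 1180735753499829100665) (.f 7 (.m
  1180735753499829100665)))))) (.f 2 (.l 16 201866253443856)))
def c83 : L := L.mk 49185983605641937785177770527841746237149704645444097
  388527779846557929113607 (.r 30 (.l 1 205163983024656) (.r 29 (.r 18 (.l 1 205163967296016) (.r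
  80 (.l 37 205163964162576) (.r 81 (.l 37 205163965329936) (.f 6 (.m 3544229342093307543585)))))
  (.r 35 (.r 32 (.l 0 205163983024656) (.r 33 (.l 0 205099558453776) (.d 2))) (.f 2 (.l 17
  201801828869136)))))
def c84 : L := L.mk 192132748459538819473350666124381821226767094055425 1517686640012715165703
  (.r 14 (.r 71 (.l 5 205163983024656) (.r 83 (.l 5 205163967296016) (.r 35 (.r 68 (.l 38
  205163980935696) (.r 69 (.l 38 205163982041616) (.r 17 (.r 67 (.r 41 (.l 24 205099558453776) (.f
  5 (.l 24 205163983024656))) (.f 5 (.m 3544229342093307412545))) (.f 5 (.r 18 (.m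
  3618016318388078510085) (.r 19 (.m 3541923499084026626115) (.r 20 (.m 1180664250058169194500)
  (.f 1 (.m 1180735744702386571335))))))))) (.r 107 (.l 9 170117049692736) (.f 11 (.m
  2363777350008989810805)))))) (.r 17 (.l 0 205163983024656) (.r 18 (.l 0 205163967296016) (.r 20
  (.r 16 (.m 1180740257099456454765) (.f 1 (.m 1180735753499829084285))) (.f 1 (.m
  1180735754049576982530))))))
def c85 : L := L.mk 192132748459538819473746806936953142914734813807105 388530089076062956357639
  (.r 18 (.l 0 205163978830416) (.r 80 (.l 39 205163964162576) (.r 81 (.l 39 205163965329936) (.f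
  6 (.m 3541923499084026740775)))))
def c86 : L := L.mk 750518548670068298291950441716869968142853669377 5135865040243066887 (.r 68
  (.l 40 205163980935696) (.r 69 (.l 40 205163982041616) (.f 5 (.m 3544229342093240303685))))
def c87 : L := L.mk 192132748459538819472716518031389184666143505449473
  25786719517975120521877587975 (.r 80 (.l 41 205163964162576) (.f 6 (.l 2 205163963102736)))
def c88 : L := L.mk 44734391490821140897791429791180401082881 47413004295 (.r 70 (.l 42
  205163983024656) (.r 82 (.l 42 205163967296016) (.r 34 (.r 66 (.l 33 205163983024656) (.r 71 (.l
  31 205163983024656) (.r 83 (.l 31 205163967296016) (.r 67 (.l 42 205163979879696) (.r 68 (.r 69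
  (.r 79 (.l 42 205163963102736) (.r 80 (.r 81 (.r 17 (.r 19 (.m 3541918994934643433565) (.r 29
  (.m 3544224837943924228185) (.f 5 (.r 43 (.m 3544224837943857152085) (.f 7 (.m
  1180735753499829280845)))))) (.f 5 (.r 15 (.m 2373144819639519412305) (.r 16 (.m
  2382080031668966654025) (.r 19 (.m 3541918994934643441755) (.r 22 (.m 1180735753534180573275)
  (.f 1 (.r 30 (.m 590367872351407185945) (.f 6 (.r 43 (.m 590367877299674555445) (.f 7 (.m
  1180735753499820836955)))))))))))) (.f 6 (.m 3544229341543551729705))) (.f 6 (.m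
  3544224838493680173105)))) (.f 5 (.m 3544229341543551598665))) (.f 5 (.m
  3544224838493680042065))))))) (.r 22 (.l 13 205163983024656) (.f 10 (.r 66 (.l 3
  205163983024656) (.r 71 (.l 2 205163983024656) (.r 83 (.l 2 205163967296016) (.r 17 (.l 1
  205163983024656) (.r 18 (.l 1 205163967296016) (.r 29 (.l 0 205163983024656) (.r 30 (.l 0
  205163967296016) (.f 5 (.f 6 (.m 1180735753499829432360)))))))))))))))
def c89 : L := L.mk 192132748459537484808716806276974161061232177775105 393474910069778683594759
  (.r 66 (.r 18 (.r 58 (.m 1199182497607890247725) (.r 70 (.m 1217629241681599799325) (.r 94 (.r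
  34 (.m 1180735753499820939330) (.f 10 (.m 1180735753499829346365))) (.f 10 (.m
  1180735753534180675650))))) (.f 6 (.r 58 (.m 1199182497607890255915) (.r 70 (.m
  1217629241681599807515) (.r 94 (.r 34 (.m 1180735753499820967995) (.f 10 (.l 0
  201866235503376))) (.f 10 (.m 1180735753534180704315))))))) (.f 6 (.r 67 (.m
  3544225963844569399305) (.r 70 (.m 1236077111619791364105) (.r 71 (.m 3597259790105792741385)
  (.f 5 (.m 295165922878626471945)))))))
def c90 : L := L.mk 750518548670068297973797381822857822569238823425 393474907241834776954887
  (.r 79 (.l 1 205163965068816) (.r 80 (.l 0 205163983024656) (.f 6 (.r 55 (.m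
  3544225964393788342305) (.r 58 (.m 1199183624022128074785) (.r 59 (.m 3560366302508129452065)
  (.r 56 (.l 0 205163950584336) (.f 4 (.m 304389292716457992225)))))))))
def c91 : L := L.mk 2931713080742454288639728697045821725354426881 5856149610040985607 (.r 82
  (.l 2 201866235491856) (.r 83 (.l 2 205163965002336) (.r 54 (.l 0 205163983024656) (.r 66 (.l 0
  205163982041616) (.f 6 (.l 2 205163965068816))))))
def c92 : L := L.mk 11452004221650212054066624344463665782784513 5856149610040985607 (.r 53 (.l
  0 205163983024656) (.r 54 (.l 0 205163967296016) (.r 58 (.l 3 201866253317136) (.r 59 (.l 3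
  205163982828096) (.f 4 (.l 3 205163982894096))))))
def c93 : L := L.mk 11452344504017133034899400187511264935870977 1518489163654224218119 (.r 34
  (.l 4 188667264066336) (.r 58 (.l 4 188667281875776) (.r 70 (.l 4 188667280827216) (.f 10 (.l 0
  188667282072336)))))
def c94 : L := L.mk 192138725149768464508363236851580607160587231887873 1518489163654224218119
  (.r 80 (.l 5 205163965145616) (.r 83 (.l 5 205163965002336) (.r 79 (.l 0 205163983024656) (.f 6
  (.r 56 (.m 2363635540494582546465) (.r 58 (.m 1199183061107666583585) (.r 59 (.m
  2379774752159462326305) (.r 55 (.l 0 205163950584336) (.f 4 (.m 152203654127744458785))))))))))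
def c95 : L := L.mk 44734391490821140836160280817214532289025 5856149610040985607 (.r 33 (.l 2
  205163983024656) (.f 9 (.r 82 (.l 6 188667264050016) (.r 30 (.r 54 (.l 0 205163983024656) (.r 66
  (.l 0 205163982041616) (.r 80 (.l 6 205163965145616) (.f 6 (.l 1 205163983024656))))) (.r 79 (.l
  1 205163983024656) (.r 80 (.l 6 205163965145616) (.f 6 (.l 6 205163965002336))))))))
def c96 : L := L.mk 174743716761020081391251080445258039809 47413004295 (.r 57 (.l 7
  205163983024656) (.r 69 (.l 7 205163982041616) (.r 81 (.l 7 205163965329936) (.r 21 (.l 0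
  205163983024656) (.f 9 (.l 0 152400309785136))))))
def c97 : L := L.mk 49187513660731989886691283250750500110898758894682625 12714799876605959 (.r
  46 (.l 0 188667282071856) (.r 43 (.l 0 205163983020816) (.r 42 (.r 47 (.l 0 205163983016496) (.f
  3 (.r 58 (.m 2361476010599269318755) (.r 70 (.m 2361480514198896689235) (.r 82 (.m
  2361489521398151430195) (.f 10 (.m 2361471506999641899135))))))) (.f 3 (.l 0
  205163983016496)))))
def c98 : L := L.mk 192138725237234335494887506036957677948576305709569 12714799876605959 (.r 41
  (.l 0 205163983024656) (.r 42 (.l 0 205163967296016) (.r 46 (.l 1 188667282071856) (.f 3 (.l 1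
  205163983020816)))))
def c99 : L := L.mk 682592643597734691995555314673058305 47413004295 (.r 44 (.l 2
  205163983024656) (.r 45 (.l 2 205099558515216) (.r 56 (.l 2 205163982963216) (.r 57 (.l 2
  205099558453776) (.r 68 (.l 2 205163981918736) (.r 69 (.l 2 205099557409296) (.r 80 (.l 2
  205163965145616) (.r 81 (.l 2 205099540636176) (.f 8 (.f 9 (.r 40 (.l 0 205163983024656) (.r 41
  (.l 0 205163982041616) (.r 42 (.l 0 205163965329936) (.r 53 (.l 0 205163980997136) (.r 54 (.l 0
  205163964285456) (.r 66 (.l 0 205163947512336) (.f 3 (.f 4 (.f 5 (.f 6 (.m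
  2361471506999641935990)))))))))))))))))))))
def c100 : L := L.mk 2666377514053651138337142124773889 47413004295 (.r 31 (.l 0
  205163983024656) (.r 43 (.l 0 205163983020816) (.r 55 (.l 0 205163982955536) (.r 67 (.l 0
  205163981907216) (.r 79 (.l 0 205163965130256) (.d 7))))))
def c101 : L := L.mk 10415537164272074740433451942401 47413004295 (.r 23 (.l 0 205163983024656)
  (.r 35 (.l 0 205163983024416) (.r 47 (.l 0 205163983020336) (.r 59 (.l 0 205163982954816) (.r 71
  (.l 0 205163981906256) (.d 11))))))
def c102 : L := L.mk 825203771600430879400475724786817638399652433201295926690305 7 (.r 31 (.m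
  2361471507137751941205) (.r 43 (.m 2361471507137684832345) (.r 55 (.m 2361471507137751941205)
  (.r 67 (.m 2363777350008989810805) (.f 7 (.m 2361471507137751941205))))))
def c103 : L := L.mk 3223452232814183122644800259527798022347511539967037997569 512463800583 (.r
  31 (.m 2361471507137751941205) (.r 43 (.m 2361471507137684832345) (.r 55 (.m
  2361471507137684832345) (.r 79 (.m 2361471507137751941205) (.f 7 (.r 33 (.m
  1180735754049584898165) (.f 9 (.m 2363777350008922701945))))))))
def c104 : L := L.mk 12591610284430402822831251013780461024794670080544932353 47413004295 (.r
  119 (.l 2 151433942151696) (.r 57 (.r 19 (.m 2398364996246639738955) (.r 31 (.m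
  2361471508099824615495) (.r 43 (.m 2361471508099757506635) (.r 67 (.m 2361471508099254190185)
  (.f 7 (.m 2361472633999597240395)))))) (.r 81 (.r 21 (.l 1 205163983024656) (.r 69 (.l 1
  205163978830416) (.f 9 (.r 14 (.m 2361471515796405510225) (.r 27 (.m 1180735762431339415665) (.r
  28 (.m 2361471515796405567555) (.r 29 (.m 2361471515795902316625) (.r 31 (.m
  1180735754187015473265) (.f 2 (.m 2361473767595581653105)))))))))) (.r 21 (.l 0 205163983024656)
  (.r 69 (.l 0 205163978830416) (.d 9))))))
def c105 : L := L.mk 12591610284408011558535435433652896430165023687853670913 30473 (.r 21 (.m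
  2361471507137752203285) (.r 57 (.m 2361472633999597502475) (.r 69 (.m 2361472635098605813785)
  (.f 9 (.r 14 (.m 2361473767596084977745) (.r 27 (.m 1180771923169753710705) (.r 28 (.m
  2361473767596085035075) (.r 29 (.m 2361473767595581784145) (.r 30 (.m 1180735894375821754425)
  (.f 2 (.m 2361471524728192647225)))))))))))
def c106 : L := L.mk 3223452232808450956258778039858913802741275312547120218625 0 (.r 14 (.m
  2361471515796405510225) (.r 15 (.m 2361471515796338417745) (.r 16 (.m 2398509093015949156425)
  (.r 18 (.m 2361471515796405755925) (.r 19 (.m 2361615607067284873305) (.f 1 (.m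
  2361471515796338384985)))))))
def c107 : L := L.mk 12591610284408011547885851718198882041957809817185878529 131246939769095
  (.r 81 (.r 18 (.m 2361471515796405755925) (.r 28 (.m 2361473767596085035075) (.r 40 (.m
  2361472641696178208835) (.r 54 (.r 21 (.m 2398364995284634501125) (.r 31 (.m
  2361473743404214321155) (.r 43 (.m 2361472617504374587395) (.f 7 (.r 14 (.m
  2361472617512827887705) (.r 15 (.m 2361473743412734730325) (.r 16 (.m 2361545790010851074085)
  (.f 1 (.m 2361471492162676858965))))))))) (.r 58 (.r 16 (.m 2398365003943287791685) (.f 4 (.m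
  2361472641696178176075))) (.f 4 (.r 14 (.m 2398366129843060416585) (.r 15 (.m
  2398367255742967259205) (.r 17 (.m 3541849173745377223365) (.r 19 (.m 2398151082956826879045)
  (.f 1 (.m 2398365003943287726165)))))))))))) (.r 21 (.l 0 205163983024656) (.r 69 (.l 0
  205163978830416) (.d 9))))
def c108 : L := L.mk 49185977673468795108929105486384181737367805108617729 47413004295 (.r 94
  (.l 3 205163983024656) (.r 119 (.l 3 188534371012896) (.r 79 (.l 2 205163983024656) (.r 57 (.l 2
  188534371012896) (.r 55 (.l 0 205163983024656) (.r 81 (.l 0 188534371012896) (.r 31 (.r 21 (.m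
  2361471507137751957585) (.f 9 (.m 2361471509198832943185))) (.f 7 (.r 14 (.m
  2361615606792406982745) (.r 15 (.m 1180664848191963799665) (.r 17 (.m 2361544699285921079385)
  (.r 18 (.m 2361615606792407228445) (.r 21 (.m 2361471491879345332305) (.f 1 (.f 9 (.m
  1180735754049618575445))))))))))))))))
def c109 : L := L.mk 3223552892283661642021883394935288762416637890464284082689 9 (.r 33 (.m
  2361473758799489269845) (.r 45 (.m 2361472632899582427225) (.r 57 (.m 2361472632899582427225)
  (.r 81 (.m 2361472632899582427225) (.f 9 (.m 2509045459589452136535))))))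
def c110 : L := L.mk 12591610284408011543851395780614800690850506132961821185 4670727 (.r 31 (.m
  2363779602908180922465) (.r 43 (.m 2363777351108434362465) (.r 79 (.m 2363779602908181168165)
  (.r 67 (.r 29 (.m 2361473741351687307345) (.r 41 (.m 2361471508099220799555) (.r 66 (.m
  2361473759899034714115) (.f 5 (.m 2363777351108434460745))))) (.f 7 (.m
  2361473759899034320995))))))
def c111 : L := L.mk 12591610284408011902789725879088107126876034770120409601 131302637111559
  (.r 69 (.r 29 (.m 2361473769794604908625) (.r 31 (.m 2361473767595581653105) (.r 33 (.m
  2361473767595581653105) (.r 28 (.r 40 (.m 2509045477177611534435) (.r 53 (.m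
  2509047693802045718595) (.r 55 (.m 2361473741351418871905) (.r 57 (.m 2509047711389131554915)
  (.r 56 (.r 54 (.m 2509047693793992655395) (.f 4 (.m 2509045477177477316715))) (.f 4 (.m
  2509045477177510871145))))))) (.r 14 (.r 15 (.m 2509047693792717578865) (.r 17 (.m
  2508910334021262647385) (.r 18 (.m 2509045477177276244025) (.r 21 (.m 2508901326822007906425)
  (.r 22 (.m 2509045477177275981945) (.f 1 (.r 40 (.m 2361471515795801612385) (.r 53 (.m
  2361651633663938404425) (.r 54 (.m 1254558759173713109025) (.r 56 (.m 2361363404128862085225)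
  (.f 4 (.m 2361471515795801579625)))))))))))) (.f 2 (.r 15 (.m 2509045477177376653425) (.r 40 (.m
  2509045477177611534435) (.r 42 (.m 2361651633526902112305) (.r 43 (.m 2361471524727253123185)
  (.r 47 (.m 2361471533521198661745) (.f 3 (.l 9 6151373996571))))))))))))) (.r 57 (.l 0
  205163983024656) (.r 21 (.r 14 (.m 2509047693792719675505) (.r 33 (.m 2509047711389131489395)
  (.f 9 (.r 15 (.m 2509046585489224671345) (.r 18 (.m 2509046585489224900665) (.r 22 (.m
  2509046585489224638585) (.r 40 (.m 2527493329562934214755) (.r 42 (.m 2509046585489224925235)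
  (.r 43 (.m 2361471507137147994225) (.r 47 (.m 2509046585489224663155) (.f 3 (.r 17 (.m
  2509045459585728528465) (.f 1 (.r 28 (.m 2509045459589452095585) (.r 53 (.m
  2509045459589385125955) (.r 55 (.m 2361615604868261617785) (.f 4 (.m
  2509046585489224957995)))))))))))))))))) (.f 9 (.m 2361473767595581653105)))))
def c112 : L := L.mk 192132725286987480832690010262364295191244950405633 30234418153588743 (.r
  71 (.l 3 205163983024656) (.r 119 (.r 70 (.r 83 (.r 67 (.l 2 205163983024656) (.r 31 (.l 2
  205163979887376) (.r 43 (.l 2 205163980935696) (.r 94 (.l 10 151433942151696) (.f 7 (.r 14 (.m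
  2361471526789776957465) (.r 15 (.m 2361471526789776973845) (.r 17 (.m 2361471525140509630485)
  (.r 18 (.m 2361471515792514261045) (.r 22 (.m 2361471525140509499445) (.f 1 (.r 28 (.m
  2361615595795478749545) (.r 30 (.m 2361471491750360268825) (.r 33 (.m 2361471507000212586525)
  (.f 2 (.m 2361471507000246140955)))))))))))))))) (.r 35 (.l 3 205163979887376) (.f 11 (.l 3
  205163980935696)))) (.r 67 (.r 53 (.r 28 (.m 2363777332973404241985) (.r 40 (.m
  2363777332698526351425) (.r 58 (.r 31 (.m 2361471525139503054915) (.r 33 (.m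
  2363777350008990007365) (.r 43 (.m 2361471524864692256835) (.r 45 (.m 2363777350008922898505)
  (.r 79 (.m 2361472650490660716555) (.r 81 (.m 2363777350008990007365) (.r 55 (.r 69 (.m
  2447945123444849901600) (.f 9 (.m 2361471507001856032875))) (.f 7 (.m
  2361471524864558039115))))))))) (.r 56 (.r 54 (.m 2363777332973404487685) (.r 57 (.m
  2361492054673042571280) (.f 4 (.r 22 (.r 35 (.m 2366083175982081056865) (.r 47 (.m
  2370694861725630537825) (.f 11 (.r 29 (.m 1185275408310878677065) (.r 30 (.m
  2435258465983613968425) (.r 31 (.m 2361471524589747118185) (.f 2 (.m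
  2361471507276801056865)))))))) (.f 10 (.l 10 151433942151696)))))) (.r 57 (.r 16 (.m
  2361492054673042571280) (.f 4 (.r 18 (.m 2361481921575021707280) (.r 21 (.m
  2361471507001923403815) (.r 29 (.m 2361473758799506063440) (.r 30 (.m 2361473758799489273940)
  (.r 31 (.m 2361473758799505932400) (.r 33 (.m 2361473758801602871335) (.f 2 (.r 15 (.m
  2363795381995389862065) (.r 19 (.m 2361489521398352719920) (.f 1 (.m
  2366101207416713125905))))))))))))) (.f 4 (.r 30 (.m 2363777332697989709865) (.r 31 (.m
  2363777367598961197065) (.r 33 (.m 2363795364407499358245) (.r 35 (.m 2361615604730822983725)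
  (.f 2 (.m 1254452950387170285570)))))))))))) (.r 66 (.r 33 (.m 2361473758799489531925) (.r 45
  (.m 2361472632899582689305) (.r 57 (.m 2361472632899582689305) (.r 69 (.r 21 (.m
  2509045459589452398615) (.f 9 (.r 29 (.m 2361473758799489286225) (.r 31 (.m
  2361473758799489155185) (.r 41 (.m 2361472632899582459985) (.f 5 (.r 43 (.m
  590367877299137684565) (.r 55 (.m 2361327445135732121685) (.r 79 (.m 2363633217776206041120) (.f
  7 (.m 2363777350008989810805))))))))))) (.f 9 (.m 2509045459589452398615)))))) (.r 69 (.r 31 (.m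
  2361471506999809687665) (.r 43 (.m 2361471506999742595185) (.r 79 (.m 2361472632899582558265)
  (.r 94 (.m 2361471506999742562425) (.f 7 (.r 17 (.m 590369002649288713305) (.f 5 (.r 14 (.m
  2361471509200946356305) (.r 15 (.m 2361471509200879263825) (.r 18 (.m 1254522730069570521105)
  (.r 21 (.m 1180735753809058496595) (.f 1 (.m 1180735753774732314705))))))))))))) (.f 5 (.r 14
  (.m 1180665976290826788945) (.r 27 (.m 1180807945232263954515) (.r 28 (.m
  1180665976291095224385) (.r 31 (.m 1189887094329306007635) (.r 33 (.m 1189959125537212352595)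
  (.f 2 (.m 2363777332973404176465))))))))))) (.r 69 (.r 31 (.m 2361471506999809687665) (.r 43 (.m
  2361471506999742595185) (.r 79 (.m 2361472632899582558265) (.f 7 (.m 2361471506999742562425)))))
  (.r 53 (.r 66 (.r 17 (.r 14 (.m 2379918277458945662985) (.r 15 (.m 2379918277458945679365) (.r
  18 (.m 2379936292406137200645) (.r 21 (.m 2379918242824331468805) (.r 22 (.m
  2379918278008701460485) (.f 1 (.r 31 (.m 2379918268663456997385) (.r 35 (.m
  2379918233753361063945) (.r 43 (.m 2379918268663524106245) (.r 47 (.m 2379918234028238970885)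
  (.f 11 (.r 55 (.m 2361472923172362846210) (.f 7 (.m 2379918269213179248645)))))))))))))) (.f 5
  (.r 14 (.m 2379936291856381403145) (.r 27 (.m 1254630801890051377155) (.r 28 (.m
  2379936291856381394955) (.r 31 (.m 2361489539536603594755) (.r 33 (.m 2361489513148326100995)
  (.f 2 (.m 2361473785184244482115))))))))) (.f 5 (.r 14 (.m 2379882189303935148105) (.r 15 (.m
  2379882189304002256965) (.r 18 (.m 2379936291856515604485) (.r 21 (.m 2379918242548514037825)
  (.r 22 (.m 2379918277458006122565) (.f 1 (.r 27 (.m 1180807937535682560195) (.r 28 (.m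
  1189824141790591590465) (.r 31 (.m 1180665974264332042305) (.r 33 (.m 1180772345829566464065)
  (.f 2 (.m 2379920469883591598145)))))))))))))) (.f 5 (.r 14 (.m 1254630800790481018905) (.r 27
  (.m 1254630800790539749395) (.r 28 (.m 2379936291856414949385) (.r 31 (.m
  2363795347361178861585) (.r 33 (.m 2361489513148091219985) (.f 2 (.m
  2361471533385269657625)))))))))))) (.r 83 (.r 35 (.l 0 205163983024656) (.r 47 (.l 0
  205163983020816) (.d 11))) (.f 11 (.r 27 (.m 2361471533521198661745) (.r 69 (.r 29 (.m
  2361471517994925441105) (.r 31 (.m 2361471515795902185585) (.r 33 (.m 2361471515795902185585)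
  (.r 41 (.m 2361471517994858348625) (.r 43 (.m 2361471515795835093105) (.r 45 (.m
  2361471515795835093105) (.r 30 (.r 42 (.m 2361651633525828632625) (.f 3 (.r 14 (.m
  2509045477177343107185) (.f 2 (.m 2509045477177343164515))))) (.f 2 (.r 15 (.m
  2509045477177343107185) (.f 3 (.m 2509045477177343164515))))))))))) (.r 81 (.r 33 (.m
  2361471515795902185585) (.r 45 (.m 2361471515795835093105) (.f 9 (.l 1 205163983024656)))) (.r
  57 (.l 1 205163983024656) (.f 9 (.m 2509045459589384929395))))))))))
def c113 : L := L.mk 3223452232814183122999704134482229787093462493805737607681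
  33613476092125707 (.r 69 (.l 11 6151105561371) (.r 29 (.r 66 (.m 2361473767870459936785) (.r 67
  (.r 14 (.m 2363777332964816339025) (.r 27 (.m 2361615604731359576145) (.r 28 (.m
  2361471489955602710595) (.f 2 (.m 2361473741342562861105))))) (.f 5 (.m
  2379918242419595837505)))) (.r 67 (.r 14 (.m 2363777350283867717745) (.r 28 (.m
  2361471508374165651555) (.f 2 (.m 2361471524727119122500)))) (.f 5 (.m
  2379936256809448276485)))))
def c114 : L := L.mk 192132725287329144635246132673931605428151928422913
  129856948318699375112554503 (.r 119 (.l 12 151433942151696) (.f 11 (.r 33 (.l 0 205163983024656)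
  (.r 69 (.l 0 205163979879696) (.r 57 (.r 19 (.m 2361471508099287744615) (.r 45 (.m
  2363777351110514212965) (.f 9 (.r 15 (.m 2361471498199389708405) (.r 18 (.m
  2361363403580112904245) (.r 22 (.m 2361471515795868622965) (.f 10 (.r 16 (.m
  2361471511399835443245) (.f 1 (.l 12 96898951636026)))))))))) (.f 9 (.m
  2361471507139227844725)))))))
def c115 : L := L.mk 825203771598963468061227537581202324571424918737640294121985 511690542857
  (.r 14 (.m 2361615605143206633585) (.r 19 (.m 2361615605143139524725) (.r 21 (.m
  2361471515795868622965) (.r 27 (.m 2361615604730889797745) (.r 45 (.m 2361471515795767984245)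
  (.r 33 (.r 17 (.r 29 (.m 2509045442551249772625) (.f 2 (.r 16 (.m 2509045477177511133225) (.f 1
  (.m 2509045477178316242985))))) (.f 1 (.r 28 (.m 2509189557181214638185) (.f 2 (.m
  2509189557182019944505))))) (.f 2 (.f 9 (.m 2509045461788475342915)))))))))
def c116 : L := L.mk 750518458152294847002695352549817661774635401729 30234418153588743 (.r 34
  (.l 3 205163983024656) (.r 35 (.l 3 188534373093936) (.r 70 (.l 3 205163979879696) (.r 71 (.l 3
  188534369948976) (.r 94 (.l 1 205163983024656) (.r 119 (.l 1 188534373093936) (.f 10 (.f 11 (.r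
  15 (.m 2509045477177343090805) (.r 31 (.l 0 205163983024656) (.r 33 (.l 0 188534406525456) (.r
  14 (.r 27 (.m 2509045477177343107185) (.f 2 (.m 2509045477177544417385))) (.f 2 (.m
  2509045477177343164515))))))))))))))
def c117 : L := L.mk 750518458152294847002707455975113256675318104577 30234418153588743 (.r 34
  (.l 0 205163982955536) (.r 70 (.l 0 205163981918736) (.r 22 (.l 0 205163982950976) (.f 10 (.l 0
  205163982963216)))))
def c118 : L := L.mk 12591610284408011547885851797425840352769028845339869697 357846503177 (.r
  33 (.m 2361328502316300771345) (.r 57 (.m 2361331880016021299205) (.r 69 (.m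
  2361336382516137041925) (.f 9 (.r 30 (.m 2361327376432429039635) (.f 6 (.m
  2361327376432630366215)))))))
def c119 : L := L.mk 3223452232808450956258778060141023607122945568919441834497
  29927951385233929 (.r 81 (.r 15 (.r 22 (.m 2361471525689325789285) (.r 34 (.m
  2361472646094224662545) (.r 58 (.m 2361476023793945190405) (.f 10 (.m
  2361480518940808970250))))) (.r 27 (.r 22 (.m 2361472083144271249425) (.r 34 (.m
  2361471525689325797475) (.r 58 (.m 2361476023793945198595) (.f 10 (.m
  2361480518803370016780))))) (.r 40 (.r 22 (.m 2361472083144271298565) (.r 34 (.m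
  2361472646094224719875) (.r 58 (.m 2361471524864692125795) (.f 10 (.m
  2361480518803168690200))))) (.f 3 (.r 22 (.m 2361472078745956417605) (.r 34 (.m
  2361472641695909838915) (.r 58 (.m 2361476019395429040195) (.f 10 (.m
  2361471524864692191315))))))))) (.r 79 (.r 18 (.m 2361615605692895600685) (.r 30 (.m
  2361615605692895608875) (.f 6 (.m 2361615604868261937195)))) (.r 18 (.l 0 205163983024656) (.r
  30 (.l 0 205163983024416) (.r 54 (.l 0 205163982893376) (.r 66 (.l 0 205163981844816) (.d
  6)))))))
def c120 : L := L.mk 211252165529334642092647134373473966741336382260634096022782465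
  456664305418 (.r 18 (.m 3542031571729174765605) (.r 34 (.m 2361472641696178151505) (.r 58 (.m
  2361476019395898679365) (.r 70 (.m 2361480522995257614405) (.f 10 (.r 30 (.m
  2361471515796305100825) (.f 6 (.m 2361471515796305149965))))))))
def c121 : L := L.mk 49185920538869066726604023348095077818313055188222465 116906079047434 (.r
  34 (.m 2361472642245934194705) (.r 58 (.m 2361476019945654722565) (.r 70 (.m
  2361480523545013657605) (.f 10 (.r 30 (.m 2361471500399417500185) (.f 6 (.m
  2361471500399618826765)))))))
def c122 : L := L.mk 3223452232808450956258778060141642577142588259056891396609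
  7661555692111407882 (.r 81 (.r 15 (.l 1 205163983024656) (.r 27 (.l 1 205163983024416) (.r 40
  (.l 1 205163982893376) (.d 3)))) (.r 18 (.l 0 205163983024656) (.r 30 (.l 0 205163983024416) (.r
  54 (.l 0 205163982893376) (.d 6)))))
def c123 : L := L.mk 12591610284408011547885851797424631426949401022025630209 29927951385233929
  (.r 43 (.l 3 205163983024656) (.r 79 (.l 3 205163932705296) (.r 45 (.l 0 205163983024656) (.r 81
  (.l 0 205163932705296) (.r 15 (.r 30 (.r 18 (.m 2361473787383603273745) (.f 6 (.r 27 (.m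
  2509047728978364743715) (.f 3 (.m 2508973371480078319635))))) (.f 6 (.m
  2509047728978364735525))) (.f 3 (.r 30 (.m 2509063491576121016355) (.f 6 (.m
  2508973441573940412435)))))))))
def c124 : L := L.mk 3223552892283661642019177984134589496209625668146046370305 456664287753 (.r
  66 (.r 21 (.m 2361498528597674590215) (.r 33 (.m 2361498528597674590215) (.r 57 (.m
  2361498528597473263635) (.r 81 (.r 22 (.m 2361472069949863788645) (.r 34 (.m
  2361472632899817209955) (.r 58 (.m 2361476010599336411235) (.f 10 (.m
  2361471507000245878875))))) (.f 9 (.r 18 (.m 2361336382514962923525) (.r 30 (.m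
  2361336382514996477955) (.f 6 (.m 2361336381691364967435))))))))) (.r 79 (.r 18 (.m
  2366227290611811360825) (.r 30 (.m 2363921447602597675065) (.f 6 (.m 2363633217226446013485))))
  (.r 81 (.r 22 (.m 2366083755968022741105) (.r 34 (.m 2363778475908762468465) (.r 58 (.m
  2363781853608482996325) (.f 10 (.m 2361480514198963781715))))) (.f 6 (.r 14 (.m
  2379846233057503748265) (.r 15 (.m 2366011105752383496225) (.r 16 (.m 2366011175002422911145)
  (.r 19 (.m 2366011109599734669345) (.r 21 (.m 2365939060235798118435) (.f 1 (.m
  2366083210608241868835)))))))))))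
def c125 : L := L.mk 3223552892283661642019214391853036922038087017579090739713
  22283849573140487 (.r 67 (.m 2361473777487965716485) (.r 94 (.l 23 151433942151696) (.f 7 (.m
  2361473744512246620165))))
def c126 : L := L.mk 3223552892283661642019177984134278802273984708448146883073
  32906131134101142046169958407 (.r 81 (.r 94 (.l 1 205027030622736) (.r 67 (.r 19 (.m
  2361482765998978760775) (.f 7 (.m 2361482765998978760775))) (.f 7 (.r 14 (.m
  2361554797200240812625) (.r 15 (.m 2361473758800260898885) (.r 16 (.m 2361554797200442139205)
  (.r 17 (.m 2361482765998978768965) (.r 18 (.m 2361271070450492907525) (.f 1 (.m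
  2361471507000580907205)))))))))) (.r 66 (.r 15 (.l 0 205163932574736) (.r 27 (.l 0
  205163932509216) (.r 40 (.l 0 205163932508736) (.d 3)))) (.f 6 (.r 14 (.m
  2361444455710835352585) (.r 15 (.m 2361444454903448608785) (.r 16 (.m 2361444454886402958345)
  (.r 17 (.m 2361435448529364459525) (.r 19 (.m 2366085429421769498625) (.f 1 (.m
  2361473752199233282065))))))))))
def c127 : L := L.mk 825229540424617380356909563938613367354692703099378502664705 456664287751
  (.r 34 (.m 2379919377525161336865) (.r 58 (.m 2366087697169599701025) (.r 70 (.m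
  2361480514751068119045) (.f 10 (.l 2 205027080942096)))))
def c128 : L := L.mk 3223552892283661642019177984135208466229268358283495932417
  29927951923546631 (.r 18 (.l 0 205163983024656) (.r 30 (.l 0 205163983024416) (.d 6)))
def c129 : L := L.mk 825203771598963445673379363089627669914375594885740094489089 456057956874
  (.r 15 (.m 2361259812001717166085) (.r 34 (.m 2363777358805015592985) (.r 58 (.m
  2363777358805216919565) (.r 70 (.m 2361471515796539973645) (.f 10 (.r 27 (.m
  2361471489542749360140) (.f 3 (.m 2367236121119779455000))))))))
def c130 : L := L.mk 49185977673468795093169435538655087571816250698039809 29927951385242122 (.r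
  79 (.r 15 (.m 2366227290611811131505) (.r 27 (.m 2363921447602597445745) (.f 3 (.m
  2361615604868261838915)))) (.r 81 (.r 66 (.r 18 (.l 0 205163983024656) (.r 30 (.l 0
  205163983024416) (.d 6))) (.f 6 (.r 14 (.m 2379702091481148826665) (.r 15 (.m
  2365866994420248748065) (.r 16 (.m 2365867033426067989545) (.r 19 (.m 2365867029029095220265)
  (.r 21 (.m 2365975089031873045545) (.f 1 (.m 2366083201814195666985))))))))) (.f 6 (.r 14 (.m
  2379711054699938457225) (.r 15 (.m 2365876001619235053585) (.r 16 (.m 2365875996644857620105)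
  (.r 19 (.m 2366227292810834616345) (.r 21 (.m 2365975091247807733785) (.f 1 (.m
  2380062348940897427625))))))))))
def c131 : L := L.mk 825203771598963445673370042713862656729731771377625638044161
  23450724091046698 (.r 15 (.m 2361381418527975546885) (.f 3 (.r 14 (.m 2527285003441330724865)
  (.r 16 (.m 2513449945935871483905) (.r 17 (.m 2508919341220853063685) (.r 22 (.m
  2513657145608315633745) (.f 1 (.r 30 (.m 2379810149303157030915) (.f 6 (.m
  3541955024006003326995))))))))))
def c132 : L := L.mk 3223452232808450959661601729351026002850514718745398804993
  23450724091046698 (.r 18 (.l 0 205163983024656) (.r 30 (.l 0 205163983024416) (.d 6)))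
def c133 : L := L.mk 49185977673468795093169435541072939211045509047452161 23450724091046698 (.r
  81 (.r 41 (.l 0 205163983024656) (.r 66 (.l 0 205163932705296) (.f 3 (.f 6 (.m
  2508829291201228226595))))) (.f 6 (.r 15 (.m 2513515266840278867985) (.f 3 (.m
  2508829326660476239875)))))
def c134 : L := L.mk 192132725286987480832693107535036514354060192842241
  129857170403592894843258887 (.r 42 (.r 71 (.l 10 205163983024656) (.f 11 (.r 43 (.l 9
  205163983024656) (.r 79 (.l 9 205163932705296) (.r 41 (.l 7 205163983024656) (.r 66 (.l 7
  205163932705296) (.r 45 (.l 5 205163983024656) (.r 81 (.l 5 205163932705296) (.f 3 (.f 6 (.m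
  2361435447549713481765))))))))))) (.r 43 (.l 3 205163983024656) (.r 79 (.l 3 205163932705296)
  (.r 45 (.l 0 205163983024656) (.r 81 (.l 0 205163932705296) (.f 3 (.f 6 (.m
  2511288221413400412165))))))))
def c135 : L := L.mk 2931712727157401746104278498887418188046467585 30234418153588743 (.r 44 (.l
  18 205163983024656) (.r 80 (.l 18 205163932705296) (.f 8 (.r 47 (.l 17 205163983024656) (.r 83
  (.l 17 205163932705296) (.r 35 (.l 0 205163983024656) (.r 71 (.l 0 205163979879696) (.d
  11))))))))
def c136 : L := L.mk 11452002840458600570719837885419154892325377 30234418153588743 (.r 23 (.l 0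
  205163983024656) (.r 35 (.l 0 205163983024416) (.r 71 (.l 0 205163979878736) (.f 11 (.r 22 (.l 0
  188534373102096) (.r 34 (.l 0 188534373101856) (.r 70 (.l 0 188534369956176) (.f 10 (.l 34
  151433942151696)))))))))
def c137 : L := L.mk 11452002840458599951749818242729017442763265 7740089116956100615 (.r 22 (.l
  0 205163933734176) (.r 34 (.l 0 205163933738256) (.f 10 (.l 0 205163967296016))))
def c138 : L := L.mk 3223452232808450871872785539254894839627477148877388448257 357863273993 (.r
  21 (.m 2509047711389668622355) (.r 45 (.m 2509046585489795317785) (.r 57 (.m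
  2509047711389702176785) (.r 69 (.m 2509047713588188561425) (.f 9 (.r 15 (.m
  2361473758799992725525) (.r 22 (.m 2361472069950132453405) (.r 42 (.m 2361473758800026271765)
  (.f 6 (.r 19 (.m 2398220862364651373595) (.r 41 (.m 2509047711389165420565) (.r 43 (.m
  2398367246946908242005) (.f 3 (.r 16 (.m 2398220862365729136645) (.f 1 (.m
  2361257564023350634005))))))))))))))))
def c139 : L := L.mk 12591610284408011218253068512714432966573680524018254337
  507254572488126831855623 (.r 54 (.r 31 (.m 2379920487615362760705) (.r 43 (.m
  2379919361715523026945) (.r 94 (.r 19 (.m 2379918255472069050375) (.r 57 (.m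
  2398366122146513027145) (.r 69 (.m 2416812865120710950985) (.r 119 (.m 2379919376973828718665)
  (.r 33 (.r 35 (.m 2379920503148613468225) (.f 11 (.l 1 151369483969296))) (.f 9 (.r 14 (.m
  2379919377592270454850) (.r 16 (.m 2416955836815586107405) (.r 17 (.m 2416955836815586107405)
  (.r 22 (.m 1180735897536917676045) (.f 1 (.m 2379920503011140960325)))))))))))) (.r 55 (.r 23
  (.m 2398509093290558890005) (.r 22 (.r 19 (.m 1180753768482982600725) (.f 7 (.r 35 (.m
  2379918233762485510185) (.f 11 (.m 2379918251073485819970))))) (.f 10 (.l 1 148846694478906))))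
  (.f 7 (.r 22 (.m 1180666080754019606565) (.f 10 (.l 1 148846694478906)))))))) (.r 30 (.l 0
  205163983024656) (.r 42 (.l 0 205163983020816) (.d 6))))
def c140 : L := L.mk 49185977673468793821301048877743492352094318815805953
  507254572488126831855623 (.r 44 (.l 0 205163983024656) (.r 56 (.l 0 188534403319056) (.d 8)))
def c141 : L := L.mk 192132725286987475864216736553312520341929985245697
  507254572488126831855623 (.r 71 (.l 0 205163983024656) (.r 23 (.r 14 (.m 2509046589887271149625)
  (.r 15 (.m 2509046589887271182385) (.r 22 (.m 2509045463987431415865) (.r 43 (.m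
  2363778480306808979505) (.r 70 (.r 17 (.m 2509045463987431546905) (.r 31 (.m
  2363777354407438991385) (.r 67 (.m 2363777354406969344025) (.r 19 (.r 55 (.m
  3541937009608030691385) (.f 7 (.r 119 (.m 2361471506999742562425) (.f 11 (.l 0
  205163979879696))))) (.f 1 (.f 7 (.m 2363777350008922701945))))))) (.f 10 (.r 21 (.m
  2363777350008922701945) (.r 119 (.m 2361471506999742562425) (.f 11 (.l 3
  151369432785696)))))))))) (.f 11 (.r 14 (.m 2509189557182019944505) (.r 15 (.m
  2361472637299742253105) (.r 30 (.m 2509189557182019944505) (.r 43 (.m 2361473758799522693235)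
  (.r 94 (.m 2361471506999709007995) (.r 42 (.r 21 (.m 2361473758799522955315) (.r 41 (.m
  2509046568039846412305) (.r 44 (.m 2509046567902440882225) (.f 8 (.r 40 (.m
  2361615605694002659365) (.f 3 (.r 22 (.m 2379918814023305134125) (.f 1 (.f 10 (.m
  2379927258272673308745)))))))))) (.f 6 (.l 39 146647809475371)))))))))))
def c142 : L := L.mk 750518458152294827594596627123618277161385001473 507254572488126831855623
  (.r 34 (.l 0 205163983024656) (.r 35 (.l 0 188534406464016) (.r 70 (.l 0 205163979879696) (.r 71
  (.l 0 188534403319056) (.f 10 (.f 11 (.m 2361471506999675453565)))))))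
def c143 : L := L.mk 49185977673468791105484654651020306399287121207820801
  129857170557306819429599239 (.r 23 (.m 2509191808981867175985) (.r 33 (.m
  1189960251608381259825) (.r 45 (.m 1183043848343208083505) (.r 119 (.r 21 (.r 34 (.m
  1189959125812627122225) (.f 10 (.l 41 151433942151696))) (.f 9 (.r 35 (.m
  2366085444817916788785) (.f 11 (.m 2361472069950199595025))))) (.f 9 (.f 11 (.m
  2361336381692576800785)))))))
def c144 : L := L.mk 192132725286987465255799432230547927180878836597249
  507254572489226343483399 (.r 70 (.r 21 (.m 1189959690994890047505) (.r 33 (.m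
  1189960253807404515345) (.r 119 (.r 57 (.r 23 (.m 2363779601809273520145) (.r 35 (.m
  2366085444818453659665) (.f 11 (.m 2361473758800026271765)))) (.f 9 (.r 22 (.m
  2509046023089094393905) (.r 34 (.m 2509046586039014260785) (.f 10 (.m
  2385682858596956110920)))))) (.f 9 (.m 1217629241819038777365))))) (.r 22 (.l 0 205163983024656)
  (.r 34 (.l 0 205163983024416) (.d 10))))
def c145 : L := L.mk 12591610284408010523040682295068985679615684256997769729
  129857170557317814545876999 (.r 33 (.m 2527492766888395800585) (.r 69 (.m
  2527492768812071387145) (.r 119 (.r 45 (.r 56 (.m 2379918814023372242985) (.f 8 (.l 0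
  205163980920096))) (.f 9 (.m 3689497451397751250985))) (.f 9 (.m 3689492947798392315945)))))
def c146 : L := L.mk 750518458152294786155466484889298371617652670977
  129857170557317814545876999 (.r 42 (.l 1 205163983024656) (.f 6 (.r 22 (.l 0 205163983024656)
  (.r 34 (.l 0 205163983024416) (.r 70 (.l 0 205163979878736) (.d 10))))))
def c147 : L := L.mk 2931712727157401508419790955877669675347411457 129857170557317814545876999
  (.r 30 (.l 0 205163983024656) (.r 66 (.l 0 205163979879696) (.d 6)))
def c148 : L := L.mk 11452002840458599642264808421383948717982209 507254572488126831855623 (.r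
  81 (.r 18 (.l 5 205163983024656) (.r 30 (.l 5 205163983024416) (.r 66 (.l 5 205163979878736) (.d
  6)))) (.r 18 (.l 0 205163983024656) (.r 30 (.l 0 205163983024416) (.r 66 (.l 0 205163979878736)
  (.d 6)))))
def c149 : L := L.mk 192132725287329144167637489317207237161112297472513 7819529 (.r 21 (.m
  2379920494348730376225) (.r 57 (.m 2363779602910395236385) (.f 9 (.l 47 198324854936361))))
def c150 : L := L.mk 49185977673556260943363322398306090068973520588833281 7733614092980127751
  (.r 119 (.l 48 151433942151696) (.r 23 (.l 0 205163983024656) (.r 35 (.l 0 205163983024416) (.r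
  71 (.l 0 205163979878736) (.d 11)))))
def c151 : L := L.mk 12591610284408006777239742048055053631535474153175056897 33613575097355015
  (.r 16 (.m 1190032295871108882465) (.r 19 (.m 2527638553330387525665) (.r 23 (.m
  2527494473326683758625) (.f 11 (.r 14 (.m 2527494475250829123585) (.r 17 (.m
  2527494473326683889665) (.f 1 (.r 31 (.m 2379711054699945271305) (.f 7 (.m
  2361256468910440580115))))))))))
def c152 : L := L.mk 44734386095541391511670773916911370699265 30234418153588743 (.r 82 (.l 15
  205163983024656) (.r 83 (.l 15 188534406464016) (.r 80 (.l 14 205163983024656) (.r 79 (.l 3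
  205163983024656) (.r 81 (.l 3 188534406464016) (.f 6 (.r 94 (.l 1 205163983024656) (.r 119 (.l 1
  188534406464016) (.r 22 (.l 0 205163983024656) (.r 34 (.l 0 205163983024416) (.r 70 (.l 0
  205163979878736) (.d 10))))))))))))
def c153 : L := L.mk 12591610284408007118887785248370286385407903969925333505
  507254497323312933832711 (.r 83 (.l 0 205163965329936) (.r 119 (.r 94 (.m
  2379918251073418559595) (.f 10 (.l 0 149235454661136))) (.f 11 (.r 14 (.m
  2361471489952983294705) (.r 15 (.m 2361471489678172496625) (.r 17 (.m 2361471489689312567385)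
  (.r 18 (.m 2361471489689312829465) (.r 19 (.m 2361471489688775696505) (.f 1 (.m
  2361471515795868622965))))))))))
def c154 : L := L.mk 49185977673468777808155411126446393578357189656117761
  507254497323312933832711 (.r 34 (.l 0 205163983024656) (.f 10 (.r 119 (.m
  2379918814023304872045) (.r 83 (.l 1 205163965329936) (.f 11 (.l 0 205163982897936))))))
def c155 : L := L.mk 12591610284408006436957415692554762768777640408737055233 460757207817 (.r
  23 (.m 2379920485562835804225) (.r 33 (.m 1189960251470942183505) (.r 81 (.m
  2527494459860954783745) (.r 119 (.r 45 (.m 2379918814023372111945) (.f 9 (.m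
  1189959125846449987665))) (.f 9 (.f 11 (.m 2435118854387116548105)))))))
def c156 : L := L.mk 192132725286987402907675410347819826877340514976257
  129856948328306907716061191 (.r 29 (.r 82 (.l 3 205163964162576) (.r 22 (.l 0 205163983024656)
  (.r 34 (.l 0 205163983024416) (.d 10)))) (.f 5 (.r 33 (.m 737942385726029070405) (.r 81 (.m
  664154846620823879685) (.r 119 (.r 21 (.m 2379774681241436061765) (.f 9 (.r 22 (.m
  1183041596509579706445) (.r 34 (.m 3546530681091046572105) (.f 10 (.m
  1254522730138256451600)))))) (.f 9 (.m 3689492947522742714445)))))))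
def c157 : L := L.mk 750518458152294542608107071671171186640671670785 507253704406104516659207
  (.r 69 (.r 82 (.l 4 205163964162576) (.r 22 (.l 2 205163983024656) (.r 34 (.l 2 205163983024416)
  (.d 10)))) (.r 17 (.l 0 205163983024656) (.r 29 (.l 0 205163983024416) (.d 5))))
def c158 : L := L.mk 192132725286987413312551537021126754362280424702465
  33243421291863776347317405703 (.r 82 (.l 5 205163964162576) (.r 83 (.l 5 205163965329936) (.r 79
  (.r 23 (.m 2380064600466907078725) (.f 11 (.r 29 (.m 2379774118428380644425) (.f 5 (.m
  2365939060373098529865))))) (.f 6 (.m 590368998251276338185)))))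
def c159 : L := L.mk 2931712727157400554892849141080852009696035329
  33243421291863776347317405703 (.r 69 (.r 17 (.l 0 205163983024656) (.r 29 (.l 0 205163983024416)
  (.d 5))) (.f 5 (.r 21 (.m 592674839097667256385) (.r 33 (.m 594980119156927529025) (.r 81 (.m
  737942385726029070405) (.f 9 (.r 22 (.m 1183041596784457613385) (.r 34 (.m
  1185347439656232353865) (.f 10 (.m 1260287337455132248080))))))))))
def c160 : L := L.mk 174743695685708517850345742414177829377 30234418153588743 (.r 68 (.l 7
  205163983024656) (.r 80 (.l 7 205163967296016) (.f 8 (.r 70 (.l 7 205163980935696) (.r 71 (.l 7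
  205163982041616) (.r 66 (.r 67 (.l 2 205163983024656) (.r 69 (.l 2 188534406464016) (.f 5 (.r 19
  (.m 1780183995540993802305) (.r 31 (.m 1780183432728479334465) (.r 79 (.m
  1780183436851647938565) (.f 7 (.l 9 205163967296016)))))))) (.r 67 (.l 0 205163983024656) (.r 69
  (.l 0 188534406464016) (.d 5)))))))))
def c161 : L := L.mk 682592561272298657033040684355092993 30234418153588743 (.r 59 (.l 0
  205163983024656) (.r 71 (.l 0 205163982041616) (.r 83 (.l 0 205163965329936) (.f 11 (.r 56 (.l 0
  205163982894096) (.r 68 (.l 0 205163981845776) (.f 8 (.l 0 205163965068816))))))))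
def c162 : L := L.mk 2666377192469915616835901447143937 30234418153588743 (.r 46 (.l 0
  205163983024656) (.r 58 (.l 0 205163982963216) (.r 70 (.l 0 205163981918736) (.r 82 (.l 0
  205163965145616) (.d 10)))))
def c163 : L := L.mk 10415535908085604485168044900865 30234418153588743 (.r 32 (.l 0
  205163983024656) (.r 44 (.l 0 205163983020816) (.r 56 (.l 0 205163982955536) (.d 8))))
def c164 : L := L.mk 40685687140959377122713076225 47413004295 (.r 106 (.l 62 205163983024656)
  (.r 107 (.l 62 188534406525456) (.r 20 (.l 0 205163983024656) (.r 32 (.l 0 205163983024416) (.r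
  44 (.l 0 205163983020336) (.r 56 (.l 0 205163982954816) (.r 68 (.l 0 205163981906256) (.d
  8))))))))
def c165 : L := L.mk 49185977673377244509747170501668497511279792761274881 30234776028448775 (.r
  80 (.r 14 (.m 2509049963738700996705) (.r 16 (.m 2509046586038980517985) (.r 27 (.m
  2509049963326384160865) (.r 40 (.m 2509046585626663682145) (.r 42 (.m 3541919558984108638245)
  (.r 43 (.r 44 (.m 3541919558984108376165) (.r 46 (.r 17 (.m 2398364995286915383365) (.r 23 (.m
  2361471507139496280165) (.r 20 (.r 22 (.m 1180668331453382140005) (.f 1 (.r 30 (.m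
  1185275513864533844025) (.r 54 (.m 1199110571919816007725) (.r 66 (.m 1180668191292897894405)
  (.r 81 (.m 599595893123880854565) (.f 6 (.m 2361471499299840892965)))))))) (.f 1 (.m
  1180668331453382402085))))) (.f 3 (.r 17 (.m 1771000164003447054405) (.r 22 (.m
  3541995547330202312805) (.f 10 (.r 18 (.m 3541851432143068078125) (.f 1 (.m
  2363777333515109040165))))))))) (.r 44 (.r 29 (.m 2370838976630272180305) (.r 30 (.m
  2370696005073842733105) (.r 31 (.m 2370696005073842471025) (.f 2 (.f 7 (.m
  2370550746271535087715)))))) (.f 3 (.r 68 (.m 3541851432279970185285) (.f 8 (.l 0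
  188361049784856))))))))))) (.r 44 (.r 31 (.m 2370696005073842471025) (.r 43 (.m
  3541919558984108376165) (.f 7 (.m 1199183060523492081765)))) (.f 8 (.r 14 (.m
  2398366121596723667025) (.r 16 (.m 2398369499296444194885) (.r 17 (.m 3541851432142531207245)
  (.r 22 (.m 2398364995697085259845) (.r 30 (.m 2398366121596723929105) (.r 31 (.m
  2398366121596723667025) (.r 54 (.m 2398369499296444456965) (.r 55 (.m 2398369499296444194885)
  (.f 7 (.r 23 (.m 2398223115263976416325) (.f 1 (.r 66 (.m 1770964135208575836165) (.r 81 (.m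
  3541937010432664444965) (.f 6 (.m 2361471507551813378085))))))))))))))))))
def c166 : L := L.mk 49185977673377244462975220269907450296458218028859905 2003522315 (.r 40 (.m
  2370696005074110906465) (.r 53 (.m 2370696005074647777345) (.r 59 (.m 2361472633587011944545)
  (.f 11 (.r 16 (.m 2361476011151172051045) (.r 54 (.m 2361476011147985436705) (.f 4 (.m
  2361329617373693493345))))))))
def c167 : L := L.mk 192132725286629861183496954179325256567351618503169 2202902647434736437255
  (.r 67 (.l 1 205163983024656) (.r 83 (.l 1 132605863531056) (.r 31 (.l 0 205163983024656) (.r 55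
  (.l 0 205163982894096) (.d 7)))))
def c168 : L := L.mk 12591610284384925771214849878509917967396862512481894913
  2202902647434736437255 (.r 55 (.m 2361476010736775331945) (.r 82 (.m 2361471507137148223545) (.r
  43 (.l 0 205163983016496) (.f 7 (.r 70 (.m 2361471507135470780505) (.f 10 (.l 3
  5124894642711)))))))
def c169 : L := L.mk 750518458150897895248032507427632043712017793537 2202902647434736437255 (.r
  47 (.l 1 205163983024656) (.r 83 (.r 23 (.r 35 (.l 0 205163983024656) (.r 59 (.l 0
  205163982894096) (.d 11))) (.f 11 (.r 14 (.m 2361615605692928901225) (.r 28 (.m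
  2361615613525036646505) (.r 30 (.m 2361615605692929163305) (.r 31 (.m 2361615605692928901225)
  (.r 55 (.m 2361615604868295229545) (.f 7 (.r 27 (.m 2361615605693029564515) (.f 2 (.m
  2361615605693029695555))))))))))) (.f 11 (.r 14 (.m 2361615605690815488105) (.r 27 (.m
  2361476011288611012705) (.r 28 (.m 2361616176337551114345) (.r 30 (.m 2361327938267774992425)
  (.r 31 (.m 2361327938266701250665) (.f 2 (.m 2361476010738855198825))))))))))
def c170 : L := L.mk 750518458150913635428483373959007178119555777025
  144369427902308180248037383 (.r 46 (.r 35 (.r 14 (.m 2366083193155776938025) (.r 17 (.m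
  2398364995284835762185) (.r 23 (.m 2361471507137416658985) (.r 27 (.m 2366101207966603026465)
  (.r 33 (.m 2366083193018337992745) (.r 41 (.m 2398369499296511565825) (.r 47 (.m
  2361476011149092462625) (.f 11 (.r 30 (.m 2361471490788321132585) (.f 2 (.r 66 (.m
  2379846167104992722955) (.r 68 (.m 2398365012738172862475) (.r 69 (.m 2361336390227880591435)
  (.f 5 (.f 9 (.m 2361471508101837619215)))))))))))))))) (.r 23 (.r 59 (.m 2361471507137349550125)
  (.f 11 (.r 22 (.m 2361476011152245792805) (.f 10 (.l 0 135967967236416))))) (.f 11 (.m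
  2361489521948175638565)))) (.f 10 (.r 35 (.l 0 170112987844896) (.r 47 (.r 14 (.m
  1199184749683655319585) (.r 15 (.m 2370699400227235831845) (.r 16 (.m 1180738006434579488805)
  (.r 17 (.m 2398369499299664896005) (.r 20 (.m 1199184749408777412645) (.f 1 (.m
  2361476011152245792805))))))) (.f 11 (.m 2361471490505895321645))))))
def c171 : L := L.mk 2931712727151944903312626944452488740997366273 563943077743292528003079 (.r
  34 (.l 1 205163983024656) (.r 82 (.l 0 205163983024656) (.f 10 (.r 35 (.l 0 170112987518496) (.r
  83 (.r 47 (.r 14 (.m 2509049963738768089185) (.r 15 (.m 2509049980776970461285) (.r 16 (.m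
  2509045460139342045285) (.r 17 (.m 2361476011151172182085) (.r 18 (.m 2361476011151172313125)
  (.f 1 (.m 2361476011151172051045))))))) (.f 11 (.r 43 (.m 2361471490504955797605) (.r 67 (.m
  2361471490505358450765) (.f 7 (.l 6 6224406266391)))))) (.f 11 (.m 2361471507549666156645)))))))
def c172 : L := L.mk 11452002840437284778564949001190286228128257 563943077743292528003079 (.r
  21 (.l 0 205163983024656) (.r 81 (.l 0 205163899138656) (.f 9 (.r 22 (.l 0 135967967351616) (.r
  82 (.l 0 135967962129216) (.f 10 (.r 14 (.m 1180735754634228949065) (.r 28 (.m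
  1180735903031523033195) (.r 29 (.m 1180735903031791468635) (.r 30 (.m 1180735754634229202955)
  (.r 31 (.m 1180735754634228940875) (.f 2 (.m 2398364995149476413515)))))))))))))
def c173 : L := L.mk 11452002840437284778512984523134646421225985 36958573542997126179715614727
  (.r 59 (.r 68 (.r 35 (.r 57 (.r 46 (.l 0 205163982963216) (.r 22 (.l 0 170113004291616) (.f 10
  (.l 0 205163982897936)))) (.r 21 (.l 0 188534355027216) (.f 9 (.l 0 151369515418896)))) (.f 11
  (.l 8 2788414608411))) (.f 8 (.l 8 6297654538776))) (.f 11 (.r 68 (.r 57 (.l 8 5051862372891)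
  (.r 21 (.l 0 135968017433376) (.f 9 (.l 0 151369515418896)))) (.f 8 (.r 57 (.l 8 5051862372891)
  (.r 69 (.l 0 151369515614736) (.f 9 (.m 2361615604867188400185))))))))
def c174 : L := L.mk 750518458150897834401114442409561217761351500289 563943077743292528003079
  (.r 43 (.l 1 170113005463056) (.r 55 (.l 1 170113004480016) (.f 7 (.l 9 5060470133271))))
def c175 : L := L.mk 44734386095458143666065477428893597237761 563943077743292528003079 (.r 56
  (.l 2 205163983024656) (.r 47 (.l 2 151369514435856) (.r 44 (.l 1 205163983024656) (.r 59 (.l 1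
  151369514435856) (.f 8 (.f 11 (.r 57 (.r 46 (.l 0 205163983024656) (.r 34 (.l 0 149235402413376)
  (.f 10 (.m 2361471526787629981725)))) (.r 33 (.l 0 188534356317216) (.f 9 (.m
  2361615606791333748765))))))))))
def c176 : L := L.mk 174743695685373640657498981714452742657 563943077743292528003079 (.r 79 (.l
  0 205163983024656) (.r 80 (.l 0 170113021268256) (.r 81 (.l 0 188534405534256) (.r 82 (.l 0
  201801828737856) (.r 83 (.l 0 186400343531856) (.f 6 (.r 43 (.r 34 (.m 1199660428896423133185)
  (.f 10 (.m 1199255813145235587105))) (.f 7 (.r 34 (.m 3560440039742476664865) (.f 10 (.r 14 (.m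
  1181204115777243848745) (.r 15 (.m 1181204115777310957605) (.r 16 (.m 1181204167991362592805)
  (.r 17 (.m 1181204167991631028245) (.r 20 (.m 1180807943034851303445) (.f 1 (.f 8 (.m
  295183936192853844045))))))))))))))))))
def c177 : L := L.mk 682592561270929152305982938556858881 563943077743292528003079 (.r 71 (.l 0
  205163983024656) (.r 83 (.l 0 205163967296016) (.f 11 (.r 67 (.l 0 205163978830416) (.r 79 (.l 0
  205163962053216) (.f 7 (.r 34 (.m 2361476028739063136355) (.r 46 (.m 2361476028464185245795) (.f
  10 (.l 0 205163982041616))))))))))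
def c178 : L := L.mk 2666377192464326253100092476293633 563943077743292528003079 (.r 58 (.l 0
  205163983024656) (.r 70 (.l 0 205163982041616) (.r 82 (.l 0 205163965329936) (.d 10))))
def c179 : L := L.mk 10415535908062834003977082962433 563943077743292528003079 (.r 45 (.l 0
  205163983024656) (.r 57 (.l 0 205163982963216) (.r 69 (.l 0 205163981918736) (.d 9))))
def c180 : L := L.mk 40685687140866771855375270401 563943077743292528003079 (.r 32 (.l 0
  205163983024656) (.r 44 (.l 0 205163983020816) (.r 56 (.l 0 205163982955536) (.d 8))))
def c181 : L := L.mk 158928465393996529597088257 47413004295 (.r 93 (.l 16 205163983024656) (.r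
  94 (.l 16 151369517642256) (.r 106 (.l 16 135968033354256) (.r 107 (.l 16 170113023357456) (.r
  119 (.l 16 149235455767056) (.r 19 (.l 0 205163983024656) (.r 31 (.l 0 205163983024416) (.r 43
  (.l 0 205163983020336) (.r 55 (.l 0 205163982954816) (.r 67 (.l 0 205163981906256) (.d
  7)))))))))))
def c182 : L := L.mk 2929213088967932462192253617367040583106889052027101577729 9 (.r 21 (.m
  2361473758800260890695) (.r 33 (.m 2361473758801066197015) (.r 45 (.m 2361472632901159354395)
  (.r 57 (.m 2361473758801066197015) (.f 9 (.m 2361473758800260890695))))))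
def c183 : L := L.mk 191968908998600908891903213751837659143373725700698278482608641 23815 (.r
  14 (.m 2509045445300028710985) (.r 21 (.m 2509045459590123102285) (.r 31 (.m
  2361473747802193412115) (.r 43 (.r 16 (.m 2435402580888221982765) (.r 18 (.m
  2435411588087476658205) (.r 23 (.m 2361624616190684962845) (.f 1 (.r 27 (.m
  2361516529797650464785) (.r 40 (.m 2361615607891918618695) (.r 41 (.m 2361615608991430377495)
  (.r 42 (.m 2361615611190453501975) (.r 44 (.m 2361615611190453501975) (.f 3 (.m
  2361507535798270992405))))))))))) (.r 67 (.r 15 (.m 2370694901024581230645) (.r 16 (.m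
  2361615608991430287405) (.r 17 (.m 1770964001066412157005) (.f 1 (.m 2361615605692895338605)))))
  (.f 7 (.r 15 (.m 2370694901024581230645) (.r 16 (.m 2951767301963036827725) (.r 18 (.m
  2951767301963037024285) (.f 1 (.m 2361615611190453477405)))))))))))
def c184 : L := L.mk 749878550775784800358996928718115856028600557422580829716993 6097159 (.r 33
  (.l 0 205163983024656) (.r 45 (.l 0 205163983020816) (.r 57 (.l 0 202973499253776) (.r 81 (.l 0
  202973499246096) (.d 9)))))
def c185 : L := L.mk 2929213088967909376402331752805140062611720913133993394689 2311 (.r 93 (.r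
  19 (.l 2 205163983024656) (.r 31 (.l 2 153495507395616) (.r 43 (.l 2 153495506347056) (.r 55 (.l
  2 188671292682816) (.r 67 (.l 2 205163978830416) (.d 7)))))) (.r 19 (.l 0 205163983024656) (.r
  31 (.l 0 153495507395616) (.r 43 (.l 0 153495506347056) (.r 55 (.l 0 188671292682816) (.r 67 (.l
  0 205163978830416) (.d 7)))))))
def c186 : L := L.mk 191968908998600891742630156081788463302392225525800408210145793 1397903634
  (.r 14 (.m 2361615607893059444745) (.r 28 (.m 2951767301964110577675) (.r 29 (.m
  2361615605693969219595) (.r 32 (.m 2361615607892992344075) (.r 33 (.m 2361472055654872006665)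
  (.f 2 (.r 42 (.m 2951776306963268534295) (.f 6 (.m 2361473776389494079495)))))))))
def c187 : L := L.mk 749878550775784733369649047194486184774840431115700411761153 5460487 (.r 18
  (.m 2361473779689102254085) (.r 19 (.m 2361473779688028512325) (.r 81 (.r 31 (.m
  2361472074348447137805) (.r 43 (.m 2361472074348447137805) (.r 55 (.m 2361473763198072520725)
  (.f 7 (.m 2361473758799757574245))))) (.r 30 (.l 0 205163983024656) (.r 42 (.l 0
  205163983020816) (.d 6))))))
def c188 : L := L.mk 2929213088967909110967401494772276848640916293899474108929 1397903695 (.r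
  14 (.m 2361507556684227158025) (.r 18 (.m 2361507556684227158025) (.f 6 (.r 15 (.m
  2361615613389074079765) (.r 16 (.m 2361615613388537274405) (.r 17 (.m 2361615613388537339925)
  (.f 1 (.l 6 204127318848006))))))))
def c189 : L := L.mk 2929213088967909111659945040091113781209303858777054970369 5441799 (.r 82
  (.l 3 205163950322256) (.r 79 (.l 1 205163983024656) (.r 81 (.l 1 205027080942096) (.r 30 (.l 0
  205163983024656) (.r 42 (.l 0 188671307621136) (.d 6))))))
def c190 : L := L.mk 11442238628780894967421660312855913207776207256881922561 564436601095 (.r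
  83 (.l 4 205163983024656) (.r 23 (.l 0 205163983024656) (.r 71 (.l 0 205163978830416) (.d 11))))
def c191 : L := L.mk 749878550775784732410381086600101733493903649971506971345409 1195786768 (.r
  17 (.m 2361473776390030499925) (.r 19 (.m 2361473776389493629045) (.r 53 (.m
  2361473776390030557255) (.f 5 (.r 14 (.m 2379920520463740067905) (.r 15 (.m
  2379919394563833241665) (.f 1 (.m 2370696004936672084035))))))))
def c192 : L := L.mk 44696244643675370955923484722477368328941147657536001 36991325145008391 (.r
  70 (.l 1 205163983024656) (.r 71 (.l 1 188671308411456) (.r 82 (.l 1 205163967296016) (.r 83 (.l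
  1 188671292682816) (.f 10 (.f 11 (.r 16 (.m 2361473785183707603045) (.r 66 (.r 67 (.r 18 (.m
  2361473776390030762005) (.r 30 (.m 2361476028189844455435) (.r 42 (.m 2361476028189844471815)
  (.f 6 (.m 2361473741342562844725))))) (.r 69 (.r 18 (.m 2361473761000626069525) (.r 30 (.m
  2361476012800439762955) (.r 42 (.m 2361476012800439779335) (.f 6 (.m 2361473758799489400885)))))
  (.r 17 (.r 29 (.m 2361615613387933229145) (.f 5 (.m 2361615613388000395335))) (.f 5 (.m
  2361615613387933286475))))) (.r 67 (.l 0 205163983024656) (.r 29 (.l 0 204715964274456) (.r 41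
  (.l 0 204647513233176) (.r 69 (.l 0 205027080942096) (.d 5)))))))))))))
def c193 : L := L.mk 2929213088967909110967396424252509661326915683207310672385 250068082460 (.r
  29 (.m 2370695459577293455425) (.r 41 (.m 2951767862714235519045) (.r 40 (.r 15 (.m
  2361507553385356763205) (.r 42 (.m 2366083210608912924675) (.r 44 (.m 2951767862714772258885)
  (.r 45 (.m 2366083738374496092225) (.f 3 (.m 2951767862713967382540)))))) (.f 4 (.r 14 (.m
  2361507555583843131465) (.r 30 (.m 2361507555583876939785) (.f 2 (.l 11 151333901848836))))))))
def c194 : L := L.mk 11442238628780894964716391806544602825154007531746689537 3815431 (.r 28 (.m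
  2370695459576756584545) (.r 31 (.m 2370695459576488149105) (.r 57 (.r 19 (.m
  2370694880136075411555) (.r 43 (.m 2366083757067534336105) (.r 67 (.m 2370695443086028832865)
  (.f 7 (.m 2370695441986517205105))))) (.r 53 (.l 0 205163983024656) (.r 54 (.l 0
  205163967296016) (.d 4))))))
def c195 : L := L.mk 44696244643675370955922771346226786852825799051117057 9469779430412519687
  (.r 58 (.l 2 205163982897936) (.r 55 (.l 0 205163983024656) (.r 57 (.l 0 205027080942096) (.r 53
  (.r 54 (.r 16 (.r 28 (.m 2361615615586654502985) (.f 4 (.r 19 (.m 2361473778586638360645) (.r 43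
  (.m 2366083775755205509185) (.r 67 (.m 2366083777956644192265) (.f 7 (.m
  2370695461776585195525))))))) (.f 4 (.r 17 (.m 2361616180736134496265) (.r 18 (.m
  2361616178537648111625) (.r 19 (.m 2361473778586637844675) (.r 21 (.m 2361473752198358778435)
  (.f 1 (.m 2361615615587577315330)))))))) (.f 4 (.m 2361616176338087985225))) (.f 4 (.m
  2361616176338624856105))))))
def c196 : L := L.mk 174594705639356917796573325571197664989562970243585 9469779237122148359 (.r
  56 (.l 3 205163983024656) (.r 32 (.l 0 205163983024656) (.r 44 (.l 0 205163983020816) (.d 8))))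
def c197 : L := L.mk 749878550775784732672058164190670238265785556145174351118849 791422990 (.r
  15 (.m 2361615606793614925845) (.r 18 (.m 2361615606793614925845) (.r 19 (.m
  2361615606792406966365) (.r 27 (.m 2361615606793614934035) (.f 3 (.r 17 (.m
  2509046572291362684945) (.f 1 (.m 2398366121048041619475))))))))
def c198 : L := L.mk 11442238628780894968750887515107960789454829505451590145
  158876534337193332796098567 (.r 15 (.m 2361472652688744259665) (.r 19 (.m
  2361472652688610041945) (.r 45 (.r 31 (.m 2361472070499888005205) (.r 55 (.m
  2361472070499888005205) (.r 67 (.m 2361472633449338110065) (.f 7 (.m 2361472632900119167065)))))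
  (.f 3 (.r 32 (.m 2379918831614014013505) (.f 8 (.l 1 188671308538176)))))))
def c199 : L := L.mk 174594705639356917858137321664898911440571317027329 2424263524290000390151
  (.r 83 (.l 2 202973496239376) (.f 11 (.r 44 (.l 2 205163983020336) (.r 42 (.r 56 (.l 2
  188671308538176) (.f 8 (.r 14 (.m 2361509811781501984785) (.r 40 (.r 15 (.m
  2379954299658492190725) (.r 16 (.m 2361615613388805644325) (.r 18 (.m 2379954299658492190725)
  (.r 27 (.m 2379954299658492198915) (.r 28 (.m 2361615613388805652515) (.r 30 (.m
  2379954299658492198915) (.r 19 (.r 31 (.m 2380062350866116526155) (.f 2 (.r 17 (.m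
  2379920498471395672065) (.f 1 (.m 2379920502874775240835))))) (.f 1 (.r 29 (.m
  2379920498479983509505) (.f 2 (.m 2379920502874775764995))))))))))) (.r 43 (.l 1
  205163983024656) (.r 45 (.l 1 205027080942096) (.f 3 (.m 2361615617786046857235)))))))) (.r 43
  (.l 0 205163983024656) (.r 45 (.l 0 205027080942096) (.f 3 (.m 2380062357461709889605))))))))
def c200 : L := L.mk 682010568903737960142863292121327939120615588353 9469779237122148359 (.r 47
  (.l 3 205163983024656) (.r 71 (.l 0 205163983024656) (.r 83 (.l 0 205163967296016) (.d 11))))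
def c201 : L := L.mk 2664103784780226406808059733983667786306748929 9469779237122148359 (.r 34
  (.l 0 205163983024656) (.r 58 (.l 0 205163982894096) (.f 10 (.r 47 (.l 0 152400273232176) (.r 23
  (.l 0 185385621873936) (.f 11 (.l 0 185385621872976)))))))
def c202 : L := L.mk 10406655409297759401593983335858304815661569 9469779237122148359 (.r 20 (.l
  0 205163983024656) (.r 32 (.l 0 188671308546336) (.r 44 (.l 0 205163983016496) (.d 8))))
def c203 : L := L.mk 11442238628780895319667079353992146973371873272111759873
  9469765253667162887 (.r 14 (.m 2384529954681816883305) (.r 16 (.m 2384529954681816883305) (.r 23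
  (.m 2366087714207734702185) (.f 11 (.r 15 (.m 2361476030388330602565) (.r 17 (.m
  2398367264536912732245) (.f 1 (.r 27 (.m 2361474884699899306065) (.r 28 (.m
  2361477136499712991305) (.r 30 (.m 2361478543874596544580) (.r 31 (.m 2361476014997886205965)
  (.f 2 (.f 7 (.m 2361472637298165678105))))))))))))))
def c204 : L := L.mk 44696244643675372342449528726531824114719582006215169 144496977971463 (.r
  43 (.m 2366088263965696589865) (.r 45 (.m 2366088259567650340905) (.r 67 (.m
  2366087701015776722985) (.r 69 (.m 2366087696617730474025) (.r 93 (.m 2366087696617730211945)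
  (.r 19 (.l 0 205163983024656) (.r 21 (.l 0 205027080942096) (.f 7 (.f 9 (.r 23 (.m
  2363777350006774759785) (.f 11 (.m 2370695441986987229205))))))))))))
def c205 : L := L.mk 44696244643675369626694695095198878772846983618167297
  158876536942005944868080135 (.r 14 (.m 2951770114514854363185) (.r 34 (.m
  2951767862715174895665) (.f 10 (.r 19 (.m 2379920522662226706435) (.r 29 (.m
  2379918268664597594115) (.r 55 (.m 2951767301963037065235) (.r 67 (.m 2379918268663389798435)
  (.r 31 (.r 18 (.r 16 (.m 2970216297836560261125) (.r 21 (.m 2970216297836560261125) (.r 23 (.m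
  2379920522662226698245) (.f 1 (.f 11 (.m 2370694896627608461365)))))) (.f 6 (.m
  2379918268663389913095))) (.f 2 (.f 7 (.m 2379918251073938653260)))))))))))
def c206 : L := L.mk 174594705639356912604276152715620043167333798314497
  620611472429710721092103 (.r 27 (.m 2951767862715040710705) (.r 30 (.l 0 205163983024656) (.f 6
  (.r 16 (.m 2379956549259685273605) (.l 0 188671308546336)))))
def c207 : L := L.mk 682010568903737939860453688432764027025945199105
  158876536942004548718364679 (.r 81 (.r 58 (.l 2 205163983024656) (.r 47 (.l 2 188671308546336)
  (.f 10 (.f 11 (.l 2 153495524426256))))) (.r 42 (.l 0 205163983024656) (.r 54 (.l 0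
  188671308546336) (.d 6))))
def c208 : L := L.mk 2664103784780225453268976437392977078759129601 2424263560573884106759 (.r
  82 (.l 5 205163962065456) (.r 83 (.l 5 205163963233296) (.r 79 (.l 0 205163983024656) (.r 81 (.l
  0 205027080942096) (.f 6 (.r 14 (.m 2380064611460949499905) (.r 16 (.m 2366229553405667385345)
  (.r 19 (.m 2527494475250829107205) (.r 21 (.m 2970216306631579279365) (.r 23 (.m
  2380064611460949483525) (.f 1 (.f 11 (.m 2379739202198085574665)))))))))))))
def c209 : L := L.mk 10406655409297755676831938487412028906603009 2424263560573884106759 (.r 32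
  (.l 0 205163983024656) (.r 56 (.l 0 205163982894096) (.d 8)))
def c210 : L := L.mk 40650997692569358112624759701055763317249 9469779237122148359 (.r 80 (.l 7
  205163983024656) (.r 20 (.l 0 205163983024656) (.r 32 (.l 0 188671308546336) (.r 44 (.l 0
  205163983016496) (.d 8)))))
def c211 : L := L.mk 44696244643675353665574945489598466968325896861319681
  158876536073922526403168263 (.r 82 (.l 0 185385640928016) (.f 10 (.r 28 (.m
  2951767300311890280675) (.r 29 (.m 2951767300314306199635) (.r 30 (.m 2951767300314306461715)
  (.r 31 (.m 2951767300313769328755) (.r 53 (.m 2951767300314306248775) (.f 5 (.r 14 (.m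
  2509045442551719419985) (.f 2 (.m 2379918251073385136205)))))))))))
def c212 : L := L.mk 11442238628780891220281147882999050343547548848881861121 2204845835 (.r 14
  (.m 2380062348667630149705) (.r 16 (.m 2380064600467443818565) (.r 19 (.m
  1189968133835441842245) (.r 21 (.m 1189959126636723972165) (.r 23 (.m 2361617857493245894725)
  (.f 1 (.f 11 (.m 2361615605693432254530))))))))
def c213 : L := L.mk 174594705639356850113934481795132313202330303660545 2424263550932659342090
  (.r 69 (.r 17 (.l 0 205163983024656) (.r 29 (.l 0 188671308546336) (.d 5))) (.f 5 (.r 14 (.m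
  1328381749422163238985) (.r 15 (.m 1328381749387870611525) (.r 16 (.m 2508973369555664511045)
  (.r 19 (.m 1190031174333278201925) (.r 21 (.m 2379956514349119447105) (.f 1 (.m
  2361509805185170415685)))))))))
def c214 : L := L.mk 158792959736599012385538138491605680641 144083436242951 (.r 106 (.l 32
  204133190873616) (.r 107 (.l 32 186609724305936) (.r 68 (.l 3 205163983024656) (.r 80 (.l 3
  205163967296016) (.f 8 (.r 70 (.l 3 185385657639696) (.r 71 (.l 3 185385658564896) (.r 66 (.r 67
  (.l 2 205163983024656) (.r 69 (.l 2 205027080942096) (.f 5 (.r 14 (.m 4132178762200598454345)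
  (.r 15 (.m 4132178762200665563205) (.r 16 (.m 4132178761651043967045) (.r 19 (.m
  2509047728977827864645) (.r 21 (.m 2951769560358578036805) (.f 1 (.m
  2361617865187948240965)))))))))) (.r 67 (.l 0 205163983024656) (.r 69 (.l 0 205027080942096) (.d
  5)))))))))))
def c215 : L := L.mk 620284998971089651527025089646363137 144083436242951 (.r 59 (.l 0
  205163983024656) (.r 71 (.l 0 205163982041616) (.r 83 (.l 0 205163965329936) (.f 11 (.l 33
  186609724305936)))))
def c216 : L := L.mk 2422988277230818154967136144130561 144083436242951 (.r 46 (.l 0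
  205163983024656) (.r 58 (.l 0 205163982963216) (.r 70 (.l 0 205163981918736) (.r 82 (.l 0
  205163965145616) (.d 10)))))
def c217 : L := L.mk 9464797957932879741069180469761 144083436242951 (.r 35 (.l 0
  205163983024656) (.r 47 (.l 0 205163983020816) (.r 59 (.l 0 205163982955536) (.r 71 (.l 0
  205163981907216) (.d 11)))))
def c218 : L := L.mk 36971867023175293892053631489 144083436242951 (.r 22 (.l 0 205163983024656)
  (.r 34 (.l 0 205163983024416) (.r 46 (.l 0 205163983020336) (.r 58 (.l 0 205163982954816) (.d
  10)))))
def c219 : L := L.mk 11341967924446987592969032244047308352128775486137631233 2204830216 (.r 32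
  (.m 2366085444817882972275) (.r 56 (.m 2361473759074601926755) (.r 80 (.m
  2361473759075407233075) (.f 8 (.r 22 (.m 2370694879311374581875) (.r 58 (.m
  2361476010874281394275) (.r 70 (.m 2370694879311374581875) (.f 10 (.m
  2361489521673163505715)))))))))
def c220 : L := L.mk 44304562204870692966721102172429318180600961690698241 33613570529363975 (.r
  31 (.m 2361473759074367045745) (.r 57 (.m 2361473759074367111265) (.r 79 (.r 81 (.m
  2366085444817916788785) (.f 9 (.l 1 123606114054681))) (.f 7 (.r 44 (.m 2361616730630729531505)
  (.r 21 (.r 32 (.m 2361473741480001544305) (.r 56 (.m 2361328501233830338665) (.f 8 (.m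
  2361473745603170148405)))) (.f 9 (.l 1 123467869868841))))))))
def c221 : L := L.mk 173064696112776144401251828220063987532317233185281 37004523562665991 (.r
  67 (.m 2361473759074367176785) (.r 93 (.r 55 (.m 2361473759074367045745) (.r 79 (.m
  2361473759074367045745) (.r 19 (.l 1 205163983024656) (.r 43 (.l 1 202973549695536) (.d 7)))))
  (.r 55 (.l 0 205163983024656) (.r 79 (.l 0 205163949601296) (.f 7 (.r 53 (.m
  2361473762098024038465) (.r 56 (.m 2361473759074601926755) (.r 57 (.m 2361473759899000782945)
  (.r 58 (.m 2361476010874180730985) (.f 4 (.m 2361187815961608593505)))))))))))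
def c222 : L := L.mk 11341967924446897400861833929832390119340950187646583297
  9462689737059601162 (.r 15 (.m 2366083210608241549425) (.r 27 (.m 2363777367599027863665) (.f 3
  (.l 3 193940481856026))))
def c223 : L := L.mk 676033969190531814067389902000978715821813727745 9473158036354304007 (.r 46
  (.l 1 205163983024656) (.r 58 (.l 1 205163982963216) (.r 82 (.l 1 205163949416976) (.f 10 (.r 44
  (.l 1 205163983016496) (.r 45 (.l 1 205163983020816) (.r 43 (.l 0 205163983024656) (.r 41 (.l 0
  11584977252651) (.f 3 (.m 2509045477177276014705))))))))))
def c224 : L := L.mk 2640757692150514898700741803969887345894949377 9473158036354304007 (.r 33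
  (.l 0 205163983024656) (.r 45 (.l 0 205163983020816) (.r 57 (.l 0 205163982955536) (.r 81 (.l 0
  205163949401616) (.d 9)))))
def c225 : L := L.mk 10315459734962948823049772671741974970302977 9473158036354304007 (.r 20 (.l
  0 205163983024656) (.r 32 (.l 0 205163983024416) (.r 44 (.l 0 205163983020336) (.r 56 (.l 0
  205163982954816) (.d 8)))))
def c226 : L := L.mk 2903543788658405650573595561553373190426642565608639758849
  2425128534276827580423 (.r 93 (.l 0 204133175144976) (.l 102 201624191730201))
def c227 : L := L.mk 743307209896551846636677719105163494301831841575422239375873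
  158933223786232995891447815 (.r 57 (.l 0 202973549511456) (.r 56 (.r 34 (.m
  2361472635098840702985) (.r 46 (.m 2361473760998747545605) (.r 58 (.m 2509045460139073871925)
  (.f 10 (.m 2361480514748921159685))))) (.r 58 (.r 32 (.m 2361476012798359904265) (.r 44 (.m
  2361476012798427013125) (.f 8 (.m 2361476011149562224645)))) (.r 55 (.l 104 7126597730841) (.f 4
  (.l 8 165646341185796))))))
def c228 : L := L.mk 2903543788658405650924522340254544899616530617955541778945
  620832905414787939764231 (.r 54 (.l 1 205163983024656) (.r 18 (.l 0 205163983024656) (.r 30 (.l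
  0 205163983024416) (.r 42 (.l 0 205163983020336) (.d 6)))))
def c229 : L := L.mk 743307209896551846633952749547047678075594432892994972746241
  2425128532077804324871 (.r 14 (.m 2508910409320629280785) (.r 93 (.l 3 204133175144976) (.r 55
  (.r 16 (.m 2370559763365119401985) (.r 19 (.m 2370559762265607774225) (.r 20 (.m
  2370559762265607774225) (.r 22 (.m 2370559762248432099345) (.f 1 (.r 27 (.m
  2361336464977390747665) (.r 28 (.m 2370559763365085855745) (.r 29 (.m 2361435518331072299025)
  (.r 31 (.m 2361336390228853669905) (.f 2 (.f 7 (.m 1180736316450311276565)))))))))))) (.r 19 (.r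
  31 (.m 2361336442992493346835) (.f 7 (.m 2361328493540604387345))) (.f 7 (.m
  2361327930590650974225))))))
def c230 : L := L.mk 2903543788658405650913877927918154992353518572160837419521
  40686905289282731105940211719 (.r 30 (.l 0 205163983024656) (.r 66 (.l 0 205163979879696) (.d
  6)))
def c231 : L := L.mk 11341967924446897073882335655930292938880918724051927553
  158933223786260483682142215 (.r 54 (.r 93 (.l 5 204133175144976) (.r 19 (.r 32 (.m
  2370712895634096529425) (.r 44 (.m 2361494027196936232965) (.r 56 (.m 2361491775397256765445)
  (.f 8 (.m 2398401023944079822850))))) (.r 31 (.r 20 (.m 2370712895634062983185) (.r 44 (.m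
  2361494027196936241155) (.r 56 (.m 2361491775397256773635) (.f 8 (.m 2398401023944079814660)))))
  (.f 7 (.r 15 (.m 2361327930590785208325) (.r 16 (.m 2361327930590651023365) (.r 20 (.m
  2361336381553930174485) (.r 22 (.m 2361472072146471911445) (.f 1 (.m
  2361400548931458441225)))))))))) (.r 18 (.l 0 205163983024656) (.r 30 (.l 0 205163983024416) (.d
  6))))
def c232 : L := L.mk 743281731781060393506415827870455331572750116142238623007233 400759262727
  (.r 31 (.m 2398220923940523491355) (.r 32 (.m 2398220871176850259995) (.r 34 (.m
  2398401023945153200155) (.f 2 (.r 43 (.m 2361336390778475266065) (.f 7 (.m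
  2361327999842636660745)))))))
def c233 : L := L.mk 44304562204870691694852873655944612612479966511301121
  620832905414787939764231 (.r 79 (.r 45 (.l 4 205163983024656) (.r 57 (.l 4 205163982963216) (.f
  9 (.l 7 204133175144976)))) (.r 42 (.l 1 205163983024656) (.r 54 (.l 1 205163982963216) (.f 6
  (.r 14 (.m 2508910408770873466905) (.r 17 (.m 2508902527471995330585) (.r 29 (.m
  2508901964522041917465) (.r 93 (.l 7 204133175144976) (.r 19 (.l 0 205163983024656) (.r 31 (.l 0
  205163983024416) (.r 67 (.l 0 205163979878736) (.d 7))))))))))))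
def c234 : L := L.mk 11341967924446896391988373818273285787166123095805329921
  158933223786544157682108423 (.r 19 (.m 2361473760999619698705) (.r 67 (.m
  2361473758938035519505) (.r 18 (.r 32 (.m 2361473760998546219025) (.r 56 (.m
  2366085447017174933505) (.r 68 (.m 2361473758937431687185) (.f 8 (.m 2361336381984563273745)))))
  (.r 66 (.r 20 (.m 2361473741343703564305) (.r 32 (.m 2361473758936962039825) (.r 56 (.m
  2361473760998747553795) (.f 8 (.m 2361327937735262076945))))) (.f 6 (.r 31 (.m
  2361473778588517203975) (.r 55 (.m 2361473778588517154835) (.f 7 (.l 8 205099542786576)))))))))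
def c235 : L := L.mk 44304562204870689031204585227577983836103128492737025
  158933223786544157682108423 (.r 46 (.l 0 205163983024656) (.r 58 (.l 0 205163982963216) (.f 10
  (.r 14 (.m 2509045477178349723705) (.r 17 (.m 2361472659284069195865) (.r 18 (.m
  2509046587689321635865) (.r 19 (.m 2361472635100718964825) (.r 20 (.m 2361472635100718964825)
  (.f 1 (.r 27 (.m 2509045477178349756465) (.r 28 (.m 2509045477178349789225) (.r 29 (.m
  2509045477177746014235) (.r 32 (.m 2398365012738172796955) (.f 2 (.m
  2398364995149207978075)))))))))))))))
def c236 : L := L.mk 2903543788658405473624090729227070096558293558792808497665 2203204106 (.r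
  14 (.m 2508910338969064972305) (.r 17 (.m 2508973371754952008725) (.r 19 (.m
  2361472635095486046225) (.r 20 (.m 2509046587688248180755) (.r 22 (.m 2509046587689455853585)
  (.f 1 (.f 10 (.m 2509045477178349916170))))))))
def c237 : L := L.mk 44304562204870688989624849538602169869421357345997313 9462997751207496199
  (.r 54 (.r 34 (.r 19 (.m 2370696007136500523025) (.r 43 (.m 2361472652688744579075) (.r 55 (.m
  2361472652688878764035) (.f 7 (.m 2370551313602090909745))))) (.r 46 (.r 19 (.m
  2366085447017979977745) (.r 31 (.m 2361473778588584312835) (.r 55 (.m 2361473778588785590275)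
  (.f 7 (.m 2365939627583663538225))))) (.f 10 (.l 18 193746671457306)))) (.f 6 (.r 58 (.r 16 (.m
  2513661651407469551625) (.r 17 (.m 2366231807403967389705) (.r 19 (.m 2366087698817793662985)
  (.r 20 (.m 2365948076229933409305) (.r 22 (.m 2366087698819940622345) (.f 1 (.r 27 (.m
  2508847266566869362225) (.r 28 (.m 2518273337425896955905) (.r 29 (.m 2508849520015952585745)
  (.r 31 (.m 2361336368776465097745) (.r 32 (.m 2508910334005223646225) (.f 2 (.m
  2509045461789549019155))))))))))))) (.r 34 (.l 0 205163983024656) (.r 46 (.l 0 205163983020816)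
  (.d 10))))))
def c238 : L := L.mk 173064696112776128865722068477015421969365907735041 9462997751207496199 (.r
  42 (.l 0 205163983024656) (.r 54 (.l 0 205163982963216) (.d 6)))
def c239 : L := L.mk 676033969190531753381726829987836509462630433281 620832905414787939764231
  (.r 82 (.r 33 (.l 5 205163983024656) (.r 45 (.l 5 205163983020816) (.r 57 (.l 5 205163982955536)
  (.d 9)))) (.r 79 (.r 30 (.l 3 205163983024656) (.r 42 (.l 3 205163983020816) (.r 54 (.l 3
  205163982955536) (.d 6)))) (.r 30 (.l 0 205163983024656) (.r 42 (.l 0 205163983020816) (.r 54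
  (.l 0 205163982955536) (.d 6))))))
def c240 : L := L.mk 2640757692150514661647370429639969868102173185 2425128536475850835975 (.r
  81 (.l 14 205163967296016) (.r 21 (.l 0 205163983024656) (.r 33 (.l 0 205163983024416) (.r 45
  (.l 0 205163983020336) (.d 9)))))
def c241 : L := L.mk 44304562204870687660396856545096014454948636532081153 37004417379797513 (.r
  21 (.r 34 (.m 2370696007135695478785) (.r 46 (.m 2366085447017174933505) (.f 10 (.m
  2402976698756600176665)))) (.r 33 (.r 22 (.m 2370695444185742065665) (.r 46 (.m
  2363779604007961247745) (.f 10 (.m 2400670855747386490905)))) (.f 9 (.l 22 193677700322361))))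
def c242 : L := L.mk 44304562204870687660396853753686296964769872135520769
  620832905133609332640008 (.r 56 (.l 0 205163983024656) (.r 20 (.l 0 205163982832416) (.r 44 (.l
  0 205163982963216) (.d 8))))
def c243 : L := L.mk 173064696112776123673425209942187792594444648382977
  158933223786544454051694856 (.r 42 (.l 0 205163983024656) (.r 54 (.l 0 205163982963216) (.d 6)))
def c244 : L := L.mk 676033969190531733099317226336165241090449015297
  158933223786544454051694856 (.r 30 (.l 0 205163983024656) (.r 42 (.l 0 205163983020816) (.d 6)))
def c245 : L := L.mk 40294764589699001867630806049078491939329 9473158036354304007 (.r 83 (.l 19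
  205163983024656) (.f 11 (.r 80 (.l 4 205163983024656) (.r 82 (.l 4 202973549703696) (.r 81 (.l
  19 205163967296016) (.r 79 (.r 18 (.l 0 205163983024656) (.r 30 (.l 0 205163983024416) (.d 6)))
  (.f 6 (.r 20 (.r 34 (.m 2518269940068113317905) (.r 46 (.m 2513659379949592772625) (.f 10 (.m
  2513661618425879863305)))) (.r 32 (.r 22 (.m 2518269377255598850065) (.r 46 (.m
  2511353537077818032145) (.f 10 (.m 2511355775416666177545)))) (.f 8 (.l 26
  193677701370936)))))))))))
def c246 : L := L.mk 157401424178511678562645502876641853953 9473158036354304007 (.r 71 (.l 0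
  205163980997136) (.f 11 (.l 0 205163964285456)))
def c247 : L := L.mk 11341579159256899910506530838047367300576837567844123137 7801095 (.r 15 (.m
  2366083185325916561505) (.r 21 (.m 2366083193570240503905) (.r 93 (.r 31 (.m
  2361472070499888005205) (.r 55 (.m 2366083193568395526225) (.r 67 (.m 2366083193568127090785)
  (.r 79 (.m 2361472070499619569765) (.f 7 (.m 2366083211707618959465)))))) (.r 81 (.r 18 (.m
  2361507536346684858405) (.r 54 (.m 2361507536346953351175) (.r 66 (.m 2361507536346684981255)
  (.r 79 (.m 2361472070499619831845) (.r 83 (.r 43 (.m 2361472074347910299685) (.r 80 (.m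
  2361507536346684850215) (.f 6 (.r 31 (.m 2361472070499888283665) (.f 7 (.m
  2361489541736968495125)))))) (.f 6 (.m 2361507536346953302035))))))) (.f 9 (.r 14 (.m
  2361507537995952054345) (.r 16 (.m 2366083193020216320105) (.r 17 (.m 2366083193020216385625)
  (.f 1 (.r 28 (.m 2398401023944079523915) (.r 29 (.m 2379954279870370037835) (.r 31 (.m
  2361472072148887027785) (.r 32 (.m 2361507537995952046155) (.f 2 (.r 40 (.m
  2361651637924009132065) (.r 41 (.m 2361651637924277567505) (.r 42 (.m 2398401023944079745045)
  (.r 43 (.m 2398365558097014456405) (.f 3 (.m 2398401023944079474775))))))))))))))))))))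
def c248 : L := L.mk 44303043590847265275416136086122528517299924321370625 144548903389447 (.r
  22 (.l 0 205163983024656) (.r 58 (.l 0 205163982828096) (.r 70 (.l 0 205163981779536) (.d 10))))
def c249 : L := L.mk 11341579159256902977082308632803910659420526200739791361 37004520039516423
  (.r 27 (.m 2361525532744851931185) (.r 33 (.m 2361525550744959205425) (.r 57 (.r 28 (.m
  2361525550745462587395) (.r 54 (.m 2361507536346953351175) (.r 55 (.m 2361490647848350973955)
  (.r 58 (.l 0 205163982894096) (.f 4 (.r 14 (.m 2361291366326033457225) (.r 15 (.m
  2365903017151565931585) (.r 17 (.m 2365903016052322739265) (.r 18 (.m 2361329634811800985605)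
  (.r 19 (.m 2366119222364843745345) (.f 1 (.m 2366083193569972068465)))))))))))) (.r 93 (.r 19
  (.m 2361490647848350908435) (.r 55 (.m 2361490647848350908435) (.r 67 (.m
  2361490647847847591985) (.r 79 (.m 2361472633449338110065) (.f 7 (.r 21 (.m
  2361490647436034048025) (.f 9 (.m 2361490649497115033625)))))))) (.f 9 (.r 14 (.m
  2361329634828238200945) (.r 17 (.m 2361329634811528094805) (.r 18 (.m 2361472633451451785265)
  (.r 19 (.m 2361507536346483269745) (.r 22 (.m 2361472633451451523185) (.f 1 (.r 28 (.m
  2361336390227679322185) (.r 29 (.m 2361329634811532296275) (.f 2 (.l 67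
  82953174930201)))))))))))))))
def c250 : L := L.mk 2903444264769767162133071010000587712270747450317947994625
  2425128225404271331591 (.r 15 (.m 2361472630704954155025) (.r 21 (.m 2361472633453062135825) (.r
  57 (.l 0 205163982897456) (.r 33 (.l 0 205163983020336) (.f 9 (.r 17 (.m 2509046585490298511385)
  (.r 18 (.m 2398366121049115074585) (.r 19 (.m 2398366121048041586715) (.f 1 (.l 31
  193793932879161))))))))))
def c251 : L := L.mk 44303043590847277254227768096890275363983261725557249
  620832911861224613414919 (.r 32 (.l 1 205163983024656) (.f 8 (.r 58 (.l 32 176244678611736) (.r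
  22 (.l 0 205163983024656) (.r 70 (.l 0 205163978830416) (.d 10))))))
def c252 : L := L.mk 173058764026747129982091493756233190619698973311489 2425128561764618274823
  (.r 56 (.l 3 205163983024656) (.r 80 (.l 0 205163983024656) (.f 8 (.r 33 (.m
  2361507536346449723505) (.r 57 (.l 3 205163982963216) (.r 81 (.r 18 (.m 2361507536346953293845)
  (.r 66 (.m 2361507536346450100245) (.r 79 (.m 2361472633449338372145) (.r 83 (.l 0
  205163915916816) (.f 6 (.r 19 (.m 2379954264474055114755) (.l 33 125024527987206))))))) (.f 9
  (.r 14 (.m 2398401023944079466585) (.r 15 (.m 2361336381689351382225) (.r 17 (.m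
  2361329626290312979665) (.r 18 (.m 2361525550744992751665) (.r 19 (.m 2361329626291923592305)
  (.f 1 (.m 2361507536346483269745))))))))))))))
def c253 : L := L.mk 676010796979480914928546338689495154464519291393 2425128561764618274823 (.r
  71 (.l 0 205163983024656) (.r 83 (.l 0 202973533974816) (.d 11)))
def c254 : L := L.mk 11341579159280075539002546448039885989787760785312907777
  158933225436792363718084615 (.r 71 (.r 44 (.l 0 205163980935696) (.r 56 (.l 0 205163981918736)
  (.f 8 (.r 14 (.m 2509063473987827294265) (.r 17 (.m 2508901327080175707225) (.r 18 (.m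
  2361336381709618257945) (.r 19 (.m 2361336381691364648025) (.r 22 (.m 2361507537995750711385)
  (.f 1 (.r 27 (.m 2509063473987827327025) (.r 33 (.m 2398419038342588940315) (.l 35
  55748852147481)))))))))))) (.f 11 (.r 80 (.m 2363778475910909657145) (.r 44 (.l 0
  205163983016496) (.f 8 (.l 0 205163982950976))))))
def c255 : L := L.mk 173058764027100761765234904565779061965565360013825
  158933225436792363718084615 (.r 81 (.r 21 (.l 0 205163983024656) (.r 33 (.l 0 202973533974816)
  (.d 9))) (.f 9 (.r 22 (.m 2366083193020216254585) (.r 32 (.m 2363813378805874049145) (.r 80 (.r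
  43 (.m 2363796490307271917625) (.r 55 (.m 2363796490307271917625) (.r 67 (.m
  2363778475909836177465) (.r 19 (.r 44 (.m 2366101207416712986675) (.f 8 (.m
  2366101207416847204395))) (.f 7 (.r 46 (.m 2363779601806521287025) (.f 10 (.m
  2361476028326746275945)))))))) (.f 8 (.l 1 205163983016496)))))))
def c256 : L := L.mk 2640667175701097323939586892600774320143401473 2425128561764618274823 (.r
  45 (.l 2 205163983024656) (.r 57 (.l 2 205163982963216) (.r 93 (.r 69 (.l 0 205163983024656) (.r
  81 (.l 0 202973533974816) (.d 9))) (.f 9 (.r 32 (.m 2363813378805874049145) (.r 44 (.l 2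
  205163983016496) (.f 8 (.l 2 205163982950976))))))))
def c257 : L := L.mk 10315106155082411421639010505728417866121729 2425128561764618274823 (.r 34
  (.l 0 205163983024656) (.r 46 (.l 0 205163983020816) (.r 58 (.l 0 205163982955536) (.d 10))))
def c258 : L := L.mk 40293383418290669615777384772604157690369 2425128561764618274823 (.r 20 (.l
  0 205163983024656) (.r 32 (.l 0 205163983024416) (.r 44 (.l 0 205163983020336) (.d 8))))
def c259 : L := L.mk 40293383418290050641035375599597062914561 2425128561764618274823 (.r 83 (.l
  0 205163949601296) (.f 11 (.l 0 205163950584336)))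
def c260 : L := L.mk 2903444264769744076344473363996212688818821724752979362305 1802129416 (.r
  14 (.m 2361507558882176671785) (.r 16 (.m 2361507520408933441545) (.r 17 (.m
  2361507519309421879305) (.r 19 (.m 2366083185326856085545) (.r 20 (.m 2361507519309421748265)
  (.f 1 (.f 8 (.m 2361507520399337148930))))))))
def c261 : L := L.mk 11341579159256812798220599078110205686498117153953350145 30234728603864840
  (.r 30 (.l 0 205163983024656) (.r 42 (.l 0 205163983020816) (.d 6)))
def c262 : L := L.mk 11341579159256638573648735557616912438699112088629084673 1802129416 (.r 16
  (.m 2361473778589590691845) (.r 17 (.m 2361473777490079129605) (.r 20 (.m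
  2361473777490078998565) (.f 8 (.r 14 (.m 2361473778589590642705) (.r 15 (.m
  2361472652689683816465) (.f 1 (.m 2361472652688610041945))))))))
def c263 : L := L.mk 2640667175700812653436644097160608212811186689 620832911889811915737095 (.r
  80 (.l 3 205163982963216) (.r 56 (.r 83 (.l 3 205163965145616) (.f 11 (.r 81 (.r 79 (.r 20 (.r
  33 (.m 2361472070224741924905) (.r 45 (.m 2361472070499619831845) (.r 57 (.m
  2361473759899537899525) (.f 9 (.m 2361473760998780829765))))) (.f 8 (.r 30 (.m
  2361473742314296852515) (.r 42 (.m 2361472616414390026275) (.f 6 (.l 44 184972052087046))))))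
  (.r 18 (.l 1 205163983024656) (.r 30 (.l 1 205163983024416) (.r 42 (.l 1 205163983020336) (.d
  6))))) (.r 79 (.r 18 (.l 0 205163983024656) (.r 30 (.l 0 205163983024416) (.d 6))) (.f 6 (.r 14
  (.m 2509045482674834120745) (.r 15 (.m 2509045482674901229605) (.r 16 (.m
  2509045479377440153605) (.r 17 (.m 2509045478277928591365) (.r 19 (.m 2370696023624879972385)
  (.f 1 (.m 2370695997236602478625)))))))))))) (.f 8 (.r 83 (.l 3 205163964032016) (.f 11 (.r 81
  (.r 18 (.r 30 (.m 2361507520408899829785) (.r 42 (.m 2361507520408899846165) (.f 6 (.m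
  2379920485563372675105)))) (.r 30 (.r 42 (.m 2361507520408933400595) (.f 6 (.m
  2379920485425933729825))) (.f 6 (.m 2379919359526026903585)))) (.r 18 (.r 30 (.m
  2361507555583642050585) (.f 6 (.m 2379954299658357997575))) (.f 6 (.m
  2379954299658357997575)))))))))
def c264 : L := L.mk 10315106155081299427434925733545380132618753 620832911889811915737095 (.r
  46 (.l 0 205163983024656) (.r 58 (.l 0 205163982963216) (.d 10)))
def c265 : L := L.mk 40293383418286325888416885714055749370369 620832911889811915737095 (.r 34
  (.l 0 205163983024656) (.r 46 (.l 0 205163983020816) (.d 10)))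
def c266 : L := L.mk 157396028977680960501628442224032416257 2425128561764618274823 (.r 82 (.l 7
  205163983024656) (.r 22 (.l 0 205163983024656) (.r 34 (.l 0 205163983024416) (.r 46 (.l 0
  205163983020336) (.d 10)))))
def c267 : L := L.mk 614828238194023528432123866930938369 9473158036354304007 (.r 106 (.r 69 (.l
  21 205163983024656) (.r 81 (.l 21 205163967296016) (.r 45 (.l 20 205163983024656) (.r 57 (.l 20
  205163982963216) (.d 9))))) (.r 68 (.l 0 205163983024656) (.r 80 (.l 0 205163967296016) (.f 8
  (.r 71 (.l 0 205163982041616) (.f 11 (.l 0 205163965329936)))))))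
def c268 : L := L.mk 2401672805445182178921575155433985 9473158036354304007 (.r 59 (.l 0
  205163983024656) (.r 71 (.l 0 205163982041616) (.d 11)))
def c269 : L := L.mk 9381534396269374798888217805313 9473158036354304007 (.r 47 (.l 0
  205163983024656) (.r 59 (.l 0 205163982963216) (.d 11)))
def c270 : L := L.mk 36646618735423848912427090433 9473158036354304007 (.r 35 (.l 0
  205163983024656) (.r 47 (.l 0 205163983020816) (.d 11)))
def c271 : L := L.mk 143150854435230713804685825 144083436242951 (.r 119 (.l 52 205163983024656)
  (.r 107 (.l 89 202973549703696) (.r 23 (.l 0 205163983024656) (.r 35 (.l 0 205163983024416) (.r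
  47 (.l 0 205163983020336) (.r 59 (.l 0 205163982954816) (.d 11)))))))
def c272 : L := L.mk 190292948313365170711313974541928926163160405582026322789728769 2628891 (.r
  14 (.m 2370694879039717400625) (.r 15 (.m 2361399424129855135845) (.r 16 (.m
  2370694879039717449765) (.r 18 (.m 2370694879038912340005) (.r 22 (.m 2370694879038912077925)
  (.f 1 (.r 32 (.m 2370694879036496945205) (.r 33 (.m 2370694879311374843955) (.f 2 (.l 0
  57340692296961))))))))))
def c273 : L := L.mk 743331829349082698091070213054409545027336679105166072545793 8609290 (.r 27
  (.m 2361543564730044563505) (.r 29 (.m 2361543564730044661785) (.r 40 (.m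
  2361543564730044612645) (.r 42 (.m 2361543564729239502885) (.r 53 (.m 2361543564730044710925)
  (.r 46 (.l 0 205163983024656) (.r 70 (.l 0 205163980935696) (.f 10 (.r 43 (.m
  2361543565141556076645) (.f 3 (.m 2361336381417912828930)))))))))))
def c274 : L := L.mk 2903543788646696797690390132932239701014471187067975172609 0 (.r 14 (.m
  2361476012800439509065) (.r 27 (.m 2361476012800439533635) (.r 28 (.m 2361617865187411378275)
  (.r 29 (.m 2361476011151172190275) (.r 32 (.m 2361476028739063136355) (.f 2 (.m
  2361476011151172059235)))))))
def c275 : L := L.mk 2903543788646764397518130192683363566816272437880130044417 2205641483 (.r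
  59 (.l 0 205163983024656) (.r 83 (.l 0 205163949601296) (.d 11)))
def c276 : L := L.mk 2903543788646696797689045165707372965690488985925328241153 0 (.r 14 (.m
  2370699382638271029345) (.r 15 (.m 2804194490664416714865) (.r 16 (.m 2370696004938550550625)
  (.r 18 (.m 2370694879038912340005) (.r 19 (.m 2370696004938550485105) (.f 1 (.m
  2370696004938550485105)))))))
def c277 : L := L.mk 11341967924401159365972832678221628138645609847011344897 2203996682 (.r 46
  (.l 0 205163983024656) (.r 70 (.l 0 205163980935696) (.d 10)))
def c278 : L := L.mk 2903543788646742096758294414794872430496860769794482438657 17989 (.r 29 (.m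
  2363777350012076441625) (.r 68 (.m 2363777350009392742425) (.r 41 (.r 53 (.m
  2363777350011002781765) (.f 5 (.m 2370550755049647120405))) (.f 5 (.m
  1180735762295653670925)))))
def c279 : L := L.mk 11341967924401336315462087557792470431628064410046759425 564222298632 (.r
  70 (.r 14 (.m 2363786357211331051545) (.r 20 (.m 2398364995696850649105) (.r 27 (.m
  2370703886238972133395) (.r 29 (.m 2398364995700037533715) (.r 35 (.m 2361480514751873171475)
  (.r 44 (.m 2398364995284634451985) (.r 32 (.r 56 (.m 1217631493482486972435) (.r 68 (.m
  1180738005300976568355) (.f 8 (.m 2361480514748652470355)))) (.f 2 (.r 56 (.m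
  1217631629788911255555) (.f 8 (.m 599591389524257685555))))))))))) (.r 22 (.l 0 205163983024656)
  (.r 46 (.l 0 205163983016496) (.d 10))))
def c280 : L := L.mk 173064696112078237172479025464947435141748899381761 2425124888296269875207
  (.r 69 (.r 82 (.r 107 (.r 19 (.l 6 205163983024656) (.r 43 (.l 6 205163983016496) (.r 67 (.l 6
  205163980919376) (.d 7)))) (.r 35 (.l 4 205163983024656) (.r 59 (.l 4 205163982894096) (.r 83
  (.l 4 205163949340176) (.d 11))))) (.r 22 (.l 2 205163983024656) (.r 46 (.l 2 205163983016496)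
  (.r 70 (.l 2 205163980919376) (.d 10))))) (.r 81 (.r 33 (.l 0 205163983024656) (.r 57 (.l 0
  205163982894096) (.d 9))) (.f 9 (.l 98 114027263177241))))
def c281 : L := L.mk 173064696112078237172558240314962865639084880232961 144548117941000 (.r 107
  (.r 35 (.m 2361472633036987957305) (.f 11 (.l 9 162739137172251))) (.f 11 (.l 9 9458715800091)))
def c282 : L := L.mk 11341967924401336315508879076748085242844514251767480833
  9473143941026744840 (.r 59 (.r 20 (.m 2379990309216070934565) (.r 22 (.m 2379918251626327973925)
  (.r 44 (.m 2361476015134888968225) (.r 68 (.m 2361476010737245372425) (.r 56 (.r 46 (.m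
  2361473763335209500705) (.f 10 (.m 2361480514336604029005))) (.f 8 (.m
  2361476010736708239465))))))) (.r 56 (.l 0 205163983024656) (.r 40 (.r 16 (.m
  2370699387036317524005) (.f 4 (.l 10 203989914563076))) (.f 4 (.m 2398223122959752504325)))))
def c283 : L := L.mk 44304562204692028762946149474650947067994305479246337
  620831971452227911485447 (.r 57 (.r 82 (.r 59 (.l 2 205163965329936) (.r 107 (.r 53 (.m
  2361543564730044710925) (.r 40 (.r 43 (.m 2361543564730044612645) (.l 11 10600977945111)) (.r 28
  (.r 35 (.m 2361561579127480336425) (.f 11 (.l 11 11631450280731))) (.f 4 (.m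
  1180735894238416404525))))) (.f 11 (.l 11 10489507951131)))) (.r 70 (.r 22 (.m
  2398366121598870626385) (.f 10 (.l 11 193956856283946))) (.f 10 (.m 2370696004938550485105))))
  (.r 81 (.l 0 205163983024656) (.f 9 (.r 59 (.l 101 114022968275481) (.r 83 (.l 0
  205163967296016) (.f 11 (.m 2361548068329671901225)))))))
def c284 : L := L.mk 173064696112078237355258396385355261970054792806913
  620831971452227911485447 (.r 19 (.l 0 205163983024656) (.r 43 (.l 0 205163983016496) (.d 7)))
def c285 : L := L.mk 676033969187805613952517843290292344727839900161 2425124888296269875207 (.r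
  55 (.l 4 205163983024656) (.r 67 (.l 0 205163983024656) (.f 7 (.r 69 (.l 0 205163980935696) (.r
  57 (.r 70 (.l 13 158717488542231) (.r 68 (.r 14 (.m 1185349693517093412945) (.r 15 (.m
  2693368829389519724625) (.r 16 (.m 1185349693517093478465) (.r 17 (.m 2370550748470357008465)
  (.r 20 (.m 2370550748470357008465) (.f 1 (.m 2398437053288706744405))))))) (.r 53 (.r 14 (.m
  2398370625198497996865) (.r 15 (.m 2398225374758358230085) (.r 16 (.m 2398223122975925739585)
  (.r 20 (.m 2398370625194204078145) (.r 22 (.m 2398370625198497996865) (.f 1 (.f 10 (.m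
  1180735762294663839810)))))))) (.f 5 (.m 590421983991059980305))))) (.f 9 (.r 59 (.l 13
  127567953015321) (.r 53 (.r 14 (.m 2398369499298591170625) (.r 15 (.m 2398513605134509940805)
  (.r 16 (.m 2398369499298591154245) (.r 17 (.m 2370708389837525753925) (.r 20 (.m
  2398369499294364344385) (.f 1 (.m 2398369499298591154245))))))) (.r 56 (.l 3 205163983024656)
  (.f 4 (.m 590403968218160963685)))))))))))
def c286 : L := L.mk 2640757692139865679501970823404120485124047361 2425124888296269875207 (.r
  45 (.l 0 205163983024656) (.r 69 (.l 0 205163980935696) (.f 9 (.r 43 (.l 14 123537126212121) (.l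
  14 126468441391641)))))
def c287 : L := L.mk 10315459734921350310554572951882146401944065 2425124888296269875207 (.r 31
  (.l 0 205163983024656) (.r 55 (.l 0 205163982894096) (.f 7 (.r 33 (.l 15 158648232203031) (.l 15
  160548755231511)))))
def c288 : L := L.mk 40294764589536524650603800576792648155649 2425124888296269875207 (.r 21 (.l
  0 205163983024656) (.r 45 (.l 0 205163983016496) (.r 69 (.l 0 205163980919376) (.d 9))))
def c289 : L := L.mk 44304562204692709327619144122766918805937327261811201
  620831971478616190552071 (.r 82 (.l 0 205163949601296) (.r 70 (.r 22 (.m 2370703886238166818885)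
  (.f 10 (.r 43 (.m 2363786357210525761605) (.l 17 176373830599191)))) (.f 10 (.m
  2370694879038912077925))))
def c290 : L := L.mk 173064696112080895811012281729558276008444768223745
  620831971478616190552071 (.r 21 (.l 0 205163983024656) (.r 69 (.l 0 205163978830416) (.f 9 (.l 1
  204133157450256))))
def c291 : L := L.mk 173064696112080895628470595296693242192919506649601
  620831971478616190552071 (.r 67 (.l 0 205163983024656) (.f 7 (.r 69 (.l 0 205163980935696) (.r
  21 (.r 70 (.l 109 116157583733271) (.r 68 (.r 14 (.m 1185349693517093412945) (.r 15 (.m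
  2693368830214153445445) (.r 16 (.m 1199184751572375576645) (.r 17 (.m 2370550748470558335045)
  (.r 20 (.m 2370550748470558335045) (.f 1 (.m 1180738007498934460485))))))) (.r 66 (.r 17 (.l 2
  181447663763751) (.f 5 (.m 2363651240419706045445))) (.f 5 (.m 590403970417184219205))))) (.f 9
  (.l 2 204133157450256))))))
def c292 : L := L.mk 676033969187815998548713210875758832578692579841 620831971478616190552071
  (.r 45 (.l 0 205163983024656) (.r 69 (.l 0 205163980935696) (.f 9 (.l 3 204133157450256))))
def c293 : L := L.mk 40294764589537762590643085957067547279873 620831971478616190552071 (.r 67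
  (.l 4 205163967296016) (.f 7 (.l 4 205163933749776)))
def c294 : L := L.mk 676033969187763811668640229654755576662307570177
  158932984699163465837250567 (.r 82 (.l 5 205163949601296) (.r 83 (.l 0 205163983024656) (.r 80
  (.r 66 (.r 18 (.r 19 (.m 2398223118579959603205) (.f 7 (.r 22 (.m 1180737997606819471365) (.f 10
  (.m 1180736326344850309125))))) (.f 6 (.r 14 (.m 2545943451475011190785) (.r 16 (.m
  2545940073775290712065) (.r 20 (.m 1199184749408307904515) (.r 22 (.m 2398365531980663128065)
  (.f 1 (.f 10 (.m 1199254546645279451145))))))))) (.f 6 (.r 19 (.m 2370622795325835846705) (.f 7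
  (.m 2363705266023585317925))))) (.f 6 (.r 19 (.m 2398223122959752504325) (.f 7 (.m
  2398221434109892264965)))))))
def c295 : L := L.mk 2640757692139702389330573895140304984868061697 158932984699163465837250567
  (.r 45 (.l 0 205163983024656) (.r 69 (.l 0 205163980935696) (.d 9)))
def c296 : L := L.mk 10315459734920712458322554277875319360913921 620831971478616190552071 (.r
  81 (.r 19 (.l 3 205163983024656) (.r 43 (.l 3 205163983016496) (.d 7))) (.r 21 (.l 0
  205163983024656) (.r 45 (.l 0 205163983016496) (.r 69 (.l 0 205163980919376) (.d 9)))))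
def c297 : L := L.mk 44304562204689301140347844071892628486018058548347393
  158932984699163465837250567 (.r 82 (.l 8 205163916047376) (.r 83 (.l 3 205163983024656) (.r 80
  (.r 54 (.r 59 (.m 1185348006866256461865) (.f 11 (.m 2361472633038061436985))) (.f 6 (.r 22 (.m
  1185419488315656120345) (.f 10 (.m 1180628797405117030425))))) (.f 6 (.r 22 (.m
  1185351951913431607305) (.f 10 (.m 1180699713156329512965)))))))
def c298 : L := L.mk 40294764589534033002303519668757143421441 620831971478616190552071 (.r 55
  (.l 1 205163983024656) (.f 7 (.r 81 (.l 116 116153288831511) (.r 57 (.r 21 (.l 0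
  205163983024656) (.r 45 (.l 0 205163983016496) (.d 9))) (.f 9 (.r 82 (.l 9 205163916047376) (.r
  83 (.l 1 204133158244656) (.r 54 (.r 18 (.r 30 (.m 1199191513566797899785) (.f 6 (.m
  590332987046409282585))) (.f 6 (.m 590403901423232254995))) (.f 6 (.m
  590332987046409282585))))))))))
def c299 : L := L.mk 157401424177867316415245853210259423745 9473143742703142919 (.r 93 (.l 27
  204133190873616) (.r 79 (.l 10 205163983024656) (.r 31 (.l 0 205163983024656) (.r 55 (.l 0
  205163982894096) (.d 7)))))
def c300 : L := L.mk 2640845158016285679241798814776549816657969665 2425124888296269875207 (.r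
  69 (.l 0 204133155349776) (.r 21 (.l 0 204133173178656) (.f 9 (.l 0 166819235509536))))
def c301 : L := L.mk 676056360452169132932685400720393448532008436225 620831971478616190552071
  (.r 43 (.l 1 134796312588816) (.f 7 (.r 33 (.m 2361476028189307322475) (.r 57 (.m
  2361472650489586843755) (.f 9 (.l 0 170942420898576))))))
def c302 : L := L.mk 676056360452169132932685457408031746475784602113 2425124888296269875207 (.r
  79 (.l 1 205163983024656) (.r 19 (.l 0 205163983024656) (.r 43 (.l 0 205163983016496) (.d 7))))
def c303 : L := L.mk 157401424177864903286045164415593153025 2425124593627153631239 (.r 21 (.l 3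
  204133189890336) (.f 9 (.l 3 204133189890576)))
def c304 : L := L.mk 2640845158016284563846886196441609555679576577 2425124888296269875207 (.r
  81 (.l 1 205163983024656) (.r 69 (.l 0 205163983024656) (.f 9 (.r 31 (.m 2361476011151172059235)
  (.r 55 (.m 2361472633451451580515) (.f 7 (.l 1 133765483684176)))))))
def c305 : L := L.mk 614849313194732610128728354663367169 9473143742703142919 (.r 71 (.l 5
  205163983024656) (.r 83 (.l 5 205163967296016) (.f 11 (.r 93 (.l 33 204133190873616) (.r 67 (.l
  0 205163983024656) (.r 79 (.l 0 205163967296016) (.f 7 (.r 69 (.l 3 205163964162576) (.r 81 (.l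
  1 134796296860176) (.f 9 (.m 2361543565141287698535)))))))))))
def c306 : L := L.mk 2401755129666720404266891083973121 9473143742703142919 (.r 58 (.l 0
  205163983024656) (.r 70 (.l 0 205163982041616) (.r 82 (.l 0 205163965329936) (.d 10))))
def c307 : L := L.mk 9381855975259686715524296933889 9473143742703142919 (.r 47 (.l 0
  205163983024656) (.r 59 (.l 0 205163982963216) (.r 71 (.l 0 205163981918736) (.d 11))))
def c308 : L := L.mk 36647874903355036311763485185 9473143742703142919 (.r 34 (.l 0
  205163983024656) (.r 46 (.l 0 205163983020816) (.r 58 (.l 0 205163982955536) (.d 10))))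
def c309 : L := L.mk 143155761341211914583343617 9473143742703142919 (.r 23 (.l 0
  205163983024656) (.r 35 (.l 0 205163983024416) (.r 47 (.l 0 205163983020336) (.d 11))))
def c310 : L := L.mk 743281731406921727942307513489495707776974428459876537795073
  131246333298951 (.r 31 (.m 2370838977729750122595) (.f 7 (.r 16 (.m 2361633619266771165225) (.r
  33 (.m 2361489505041306894345) (.r 40 (.m 2366227290611811188835) (.r 45 (.m
  2361480514748719562835) (.r 53 (.m 2370838976905116581955) (.r 54 (.m 2370838976905116712995)
  (.r 57 (.m 2370694861717579563075) (.f 4 (.f 9 (.m 2398364995147128176715))))))))))))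
def c311 : L := L.mk 2903444263308287999774597124632869268345569575722591388161 2002651399 (.r
  19 (.r 45 (.m 2361480514748719571025) (.r 57 (.m 2361480515298475384905) (.r 69 (.m
  2361489523597510189065) (.f 9 (.m 2361480518599392116745))))) (.r 43 (.r 33 (.m
  2379927240815847424065) (.r 57 (.m 2398364996246639771715) (.r 69 (.m 2379936267670951329795)
  (.f 9 (.m 2361480518597010292755))))) (.r 67 (.l 0 205163983024656) (.r 79 (.l 0
  205163967296016) (.d 7)))))
def c312 : L := L.mk 11341579153547999999119520018097145578753726867359072769 33613626816923655
  (.r 32 (.l 0 205163983024656) (.r 44 (.l 0 205163983020816) (.r 68 (.l 0 205163980924176) (.d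
  8))))
def c313 : L := L.mk 44288417111106912304072263330141495719507231628263937 1195655950 (.r 17 (.m
  2361489532393602686985) (.r 29 (.m 2361489532393569140745) (.f 5 (.l 41 37072187835141))))
def c314 : L := L.mk 2903444263308287999419677490243400976773461273232122511873 2001159177 (.r
  14 (.m 2370694906520058994785) (.r 67 (.r 21 (.m 2361489505178745839625) (.r 33 (.m
  2361489505041306894345) (.r 45 (.m 2361489521947940880405) (.f 9 (.m 2361472633999094054985)))))
  (.r 69 (.l 0 205163983024656) (.r 17 (.r 29 (.m 2361489548881713831945) (.f 5 (.m
  2509189557181852164165))) (.f 5 (.m 2509189557181852172355))))))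
def c315 : L := L.mk 44303043568546874991144981235403456565754685462610433
  2425128562121117337607 (.r 71 (.l 2 205163983024656) (.f 11 (.r 68 (.l 2 205163980923216) (.r 32
  (.l 0 205163983024656) (.r 44 (.l 0 205163983020816) (.d 8))))))
def c316 : L := L.mk 173058763849458682375710289072367254719166515708417 9473158394229229575 (.r
  79 (.m 2361473742442611343365) (.r 19 (.r 23 (.m 2361473781887588638725) (.f 11 (.l 44
  9457910498091))) (.f 7 (.l 134 116140403933991))))
def c317 : L := L.mk 173058763849444045128366331450547581069768297480705 2425128548922682836999
  (.r 81 (.l 0 205163983024656) (.r 33 (.l 0 205163915916816) (.r 45 (.l 0 205163932689936) (.d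
  9))))
def c318 : L := L.mk 44303043545460742133832585842668967224952881194205697 33599277116885255 (.r
  33 (.r 31 (.m 2361474305254588694625) (.f 7 (.l 46 158716951675671))) (.f 9 (.l 46
  123331773023001)))
def c319 : L := L.mk 173058763849456023757218971297886600924799808242177 33599277116885255 (.r
  69 (.r 19 (.l 0 205163983024656) (.r 57 (.l 0 188534390600256) (.f 7 (.f 9 (.m
  1180735754736846798945))))) (.f 9 (.r 14 (.m 2370694879032269873265) (.r 27 (.m
  2361580157436002582625) (.r 28 (.m 2361329634948702814305) (.r 30 (.m 2370694879038677467185)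
  (.r 31 (.m 2370694879038677205105) (.f 2 (.f 7 (.m 2361544664101282676835))))))))))
def c320 : L := L.mk 676010796286890638782933039492990038831752479233 620832911903006055270407
  (.r 93 (.r 82 (.l 4 205163983024656) (.r 71 (.l 4 188534390600256) (.f 10 (.f 11 (.r 68 (.l 4
  188534374085136) (.r 80 (.l 4 205163949601296) (.f 8 (.r 14 (.m 2509189557180979748985) (.r 15
  (.m 2509189557181046857845) (.r 16 (.m 2509189557181181075565) (.r 67 (.r 17 (.m
  2370838976630775357525) (.r 19 (.m 2361617856668075303025) (.f 1 (.m 2361473767595615199345))))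
  (.r 17 (.r 29 (.m 2509189557180979880025) (.r 41 (.m 2509189557181046988885) (.f 5 (.m
  2582833544196708696075)))) (.r 29 (.r 41 (.m 2509189557181046997075) (.f 5 (.m
  2582832981246755274765))) (.f 5 (.m 2582832981246755274765))))))))))))))) (.r 67 (.l 2
  205163983024656) (.r 81 (.l 2 188534390600256) (.r 79 (.l 0 205163983024656) (.r 69 (.l 0
  188534390600256) (.f 7 (.f 9 (.m 2361472634001240916065))))))))
def c321 : L := L.mk 2640667172995666554959206205964446975798739457 620832911903006055270407 (.r
  56 (.l 0 205163983024656) (.r 80 (.l 0 205163949601296) (.f 8 (.r 58 (.l 0 205163982963216) (.f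
  10 (.l 0 205163949416976))))))
def c322 : L := L.mk 10315106144514322479048508079108876134449665 620832911903006055270407 (.r
  47 (.l 0 205163983024656) (.r 71 (.l 0 205163980935696) (.d 11)))
def c323 : L := L.mk 40293383377009072183782369414543164244481 620832911903006055270407 (.r 34
  (.l 0 205163983024656) (.r 58 (.l 0 205163982894096) (.d 10)))
def c324 : L := L.mk 157396028816441688217899865128084636161 620832911903006055270407 (.r 20 (.l
  0 205163983024656) (.r 32 (.l 0 188534390735136) (.r 44 (.l 0 205163983016496) (.d 8))))
def c325 : L := L.mk 2903444261783920300392178625073868959605725092489992536577 0 (.r 14 (.m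
  2509194060780607119465) (.r 18 (.m 2509194060781613752365) (.r 19 (.m 2361620108468962730025)
  (.r 21 (.m 2509049967587058786345) (.r 30 (.m 2509194060781613760555) (.r 31 (.m
  2361620108331523784745) (.r 33 (.m 2509049967587025240105) (.r 15 (.r 27 (.m
  2509054484376631394385) (.f 2 (.r 16 (.m 2509054484376765612105) (.f 1 (.m
  2509049980777406677065))))) (.f 1 (.r 28 (.m 2509054484376765612105) (.f 2 (.m
  2509049980777406677065))))))))))))
def c326 : L := L.mk 2903444261783920300392178625077274513084312468614430261761 7039496 (.r 32
  (.l 0 205163983024656) (.r 44 (.l 0 188534405354256) (.r 56 (.l 0 188534404305936) (.d 8))))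
def c327 : L := L.mk 2903444261778188311622959510487356236165240909586814403073 131242713567497
  (.r 21 (.r 42 (.m 2509054467064658403345) (.r 54 (.m 2509054467064792621065) (.f 6 (.m
  2509049980778446864395)))) (.f 9 (.l 145 114010083377961)))
def c328 : L := L.mk 11341579147571048092277185587841235112980395624512029185
  2202902647392977881095 (.r 81 (.l 1 205163983024656) (.r 93 (.l 1 11649684877851) (.r 33 (.l 0
  205163983024656) (.r 45 (.l 0 11649684874011) (.r 57 (.l 0 11649684808731) (.r 69 (.l 0
  11649683760411) (.d 9)))))))
def c329 : L := L.mk 44303043545196682965157973223818713077030608563274241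
  2202902647392977881095 (.r 79 (.l 0 205163983024656) (.r 81 (.l 0 188534406525456) (.r 93 (.l 0
  176371075920411) (.r 30 (.r 31 (.r 42 (.m 2361480540584088190995) (.f 6 (.m
  2361480540584222408715))) (.f 7 (.m 2366083215006422278185))) (.f 6 (.r 31 (.m
  2361476036984460812325) (.f 7 (.m 2370694852795319844885))))))))
def c330 : L := L.mk 11341579147548050093882093146476246373319180723402506753 1783845456 (.r 81
  (.r 30 (.m 2361617857493782773795) (.r 54 (.m 2361617856669149102115) (.f 6 (.l 58
  185040771559686)))) (.r 30 (.r 18 (.m 2361480532889553616905) (.f 6 (.m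
  2361473736805199134755))) (.f 6 (.m 2361472087815585071145))))
def c331 : L := L.mk 676010796270939902833514048981323486504960590337
  40686905714495748010962126855 (.r 82 (.l 6 205163967296016) (.f 10 (.r 79 (.l 0 205163983024656)
  (.r 81 (.l 0 188534406525456) (.f 6 (.m 2370695411196101148705))))))
def c332 : L := L.mk 2640667172933358992656788237601213416420344321
  40686905714495748010962126855 (.r 56 (.l 0 205163983024656) (.f 8 (.r 82 (.l 7 205163967296016)
  (.f 10 (.l 0 188534405542416)))))
def c333 : L := L.mk 614828237548457122310886338951578113 620832911903006055270407 (.r 83 (.l 8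
  205163983024656) (.f 11 (.r 80 (.r 82 (.l 8 205163967296016) (.f 10 (.r 20 (.l 3
  205163983024656) (.r 32 (.l 3 205163983024416) (.r 44 (.l 3 205163983020336) (.d 8)))))) (.r 32
  (.l 0 205163983024656) (.r 56 (.l 0 205163982894096) (.d 8))))))
def c334 : L := L.mk 2401672802871473998732069827707393 620832911903006055270407 (.r 70 (.l 0
  205163983024656) (.r 82 (.l 0 205163967296016) (.d 10)))
def c335 : L := L.mk 9381534385976091324283311292929 620832911903006055270407 (.r 59 (.l 0
  205163983024656) (.r 71 (.l 0 205163982041616) (.d 11)))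
def c336 : L := L.mk 36646618694422796429869384193 620832911903006055270407 (.r 46 (.l 0
  205163983024656) (.r 58 (.l 0 205163982963216) (.d 10)))
def c337 : L := L.mk 143150854271412277359084033 620832911903006055270407 (.r 35 (.l 0
  205163983024656) (.r 47 (.l 0 205163983020816) (.d 11)))
def c338 : L := L.mk 559183024480107710579201 47413004295 (.r 131 (.l 156 205163983024656) (.r
  94 (.l 66 205163983024656) (.r 119 (.l 66 188534406525456) (.r 106 (.l 28 205163983024656) (.r
  107 (.l 28 188534406525456) (.r 22 (.l 0 205163983024656) (.r 34 (.l 0 205163983024416) (.r 46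
  (.l 0 205163983020336) (.r 58 (.l 0 205163982954816) (.r 70 (.l 0 205163981906256) (.d
  10)))))))))))
def c339 : L := L.mk 44305966548648291653717029784237156786596053002682881 144548909615880 (.r
  56 (.r 23 (.m 2370694879174204325925) (.r 35 (.m 2366085444816843374625) (.f 11 (.m
  2398364995150348877835)))) (.r 68 (.r 23 (.m 2370694879174472761365) (.r 35 (.m
  2366085444816843440145) (.f 11 (.m 2379918251076639391755)))) (.f 8 (.l 0 99591893955096))))
def c340 : L := L.mk 173070181830645420804884394893875954605110818177537 2425128279548004861959
  (.r 79 (.l 0 205163983024656) (.r 80 (.l 0 205159956492576) (.r 55 (.r 56 (.m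
  3551142367246409597025) (.f 8 (.l 1 117184079933976))) (.f 7 (.l 1 117184080982551)))))
def c341 : L := L.mk 676055397775953259533391209609898118688723370497
  158933206928458046667032583 (.r 70 (.l 0 205163983024656) (.f 10 (.r 45 (.m
  1180735877197093937265) (.f 9 (.l 0 151369501909776)))))
def c342 : L := L.mk 2640841397562317416956188978501367048274379265 158933206928458046667032583
  (.r 57 (.l 0 205163983024656) (.r 81 (.l 0 205163949601296) (.d 9)))
def c343 : L := L.mk 10315786709227802408714777373424174426685953 158933206928458046667032583
  (.r 47 (.l 0 205163983024656) (.r 59 (.l 0 205163982963216) (.r 83 (.l 0 205163949416976) (.d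
  11))))
def c344 : L := L.mk 40296041832921103159041305904155847754241 158933206928458046667032583 (.r
  32 (.l 0 205163983024656) (.r 35 (.l 0 152400309793296) (.r 68 (.l 0 205163979879696) (.r 71 (.l
  0 152400306648336) (.f 8 (.f 11 (.l 0 133777584165936)))))))
def c345 : L := L.mk 157406413409848059215005086890145808897 158933206928458046667032583 (.r 19
  (.l 0 205163983024656) (.r 31 (.l 0 205163983024416) (.r 43 (.l 0 204133175006256) (.d 7))))
def c346 : L := L.mk 676055397759945346598537290085631698047886098945
  40686900973685335817374468103 (.r 81 (.l 0 205163967296016) (.f 9 (.r 44 (.m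
  1180735886538715439205) (.f 8 (.m 1180735753772828491875)))))
def c347 : L := L.mk 2640841397499786510150536289396983423024955905
  40686900973685338016397723655 (.r 80 (.l 8 12611791106586) (.r 20 (.l 0 205163983024656) (.r 32
  (.l 0 205163983024416) (.d 8))))
def c348 : L := L.mk 2640841397500009854340664000564659623420953089
  10415846649263446606968919754759 (.r 19 (.l 0 205163981780256) (.r 31 (.l 0 205163981845776) (.d
  7)))
def c349 : L := L.mk 614868802366450777321240071581663745 158933206928458046667032583 (.r 82 (.l
  3 205163983024656) (.f 10 (.r 79 (.l 10 12676215616026) (.r 43 (.l 0 205163983024656) (.r 55 (.l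
  0 205163982963216) (.d 7))))))
def c350 : L := L.mk 2401831259191780016527724217827841 158933206928458046667032583 (.r 69 (.l 0
  205163983024656) (.r 81 (.l 0 205163967296016) (.d 9)))
def c351 : L := L.mk 9382153355995589617757708288513 158933206928458046667032583 (.r 58 (.l 0
  205163983024656) (.r 70 (.l 0 205163982041616) (.d 10)))
def c352 : L := L.mk 36649036545917629025166230017 620832839562837529004039 (.r 94 (.l 13
  204129164341776) (.r 46 (.l 0 205163983024656) (.r 58 (.l 0 205163982963216) (.d 10))))
def c353 : L := L.mk 143160299004096541672800769 620832839562837529004039 (.r 33 (.l 0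
  205163983024656) (.r 45 (.l 0 205163983020816) (.d 9)))
def c354 : L := L.mk 11337836247854620650222998196417503582057268714513039873
  2425128562168345200647 (.r 14 (.m 2361507540469853200425) (.r 21 (.m 2361507536072880431145) (.r
  43 (.m 2361472070225815404585) (.r 55 (.m 2361472070225681186865) (.r 67 (.m
  2361472070225815404585) (.r 19 (.r 46 (.m 2361473746702679679525) (.r 58 (.m
  2361475997952737550885) (.f 10 (.l 15 202585981473306)))) (.f 7 (.r 27 (.m
  2361472052905019195505) (.r 28 (.m 2361472053454775009385) (.r 32 (.m 2361472053454775009385)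
  (.f 8 (.r 29 (.m 2361472053454773043785) (.f 2 (.r 45 (.m 2363786357757866147925) (.f 9 (.m
  2361472071046958956905))))))))))))))))
def c355 : L := L.mk 675787701705282260019719584577042253456473260545 8612362 (.r 22 (.m
  2361507536346684596325) (.r 46 (.m 2361507535934367760485) (.f 10 (.l 16 202516725126186))))
def c356 : L := L.mk 675787701718631716803913870013027159839997100545 37004520866253321 (.r 45
  (.l 0 205163983024656) (.r 57 (.l 0 152400242624016) (.d 9)))
def c357 : L := L.mk 173001651731178743293397973639187509331723827741185 2425128562168345200647
  (.r 81 (.r 22 (.l 2 205163983024656) (.r 46 (.l 2 205163983016496) (.r 58 (.l 2 205163982950976)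
  (.d 10)))) (.r 21 (.l 0 205163983024656) (.r 45 (.l 0 205163983016496) (.r 57 (.l 0
  205163982950976) (.d 9)))))
def c358 : L := L.mk 675787702074916965989832165211704094702512046593 620832911915100683175943
  (.r 47 (.l 0 205163983024656) (.r 83 (.l 0 205163932705296) (.d 11)))
def c359 : L := L.mk 173001651731178743292683980831734110016700185510401
  620832911915100683175943 (.r 57 (.l 0 205163982894096) (.l 2 152400276166176))
def c360 : L := L.mk 44288417111015713919337495905087072550169334522249729 37004520867105289 (.r
  45 (.m 2361476010876831039555) (.r 21 (.r 22 (.m 2361476019396032864325) (.f 10 (.l 21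
  12610450047786))) (.f 9 (.l 21 202516741903401))))
def c361 : L := L.mk 2639795369556038219728305677499354489907511809 158933225450357038669957127
  (.r 58 (.r 68 (.r 82 (.r 47 (.l 0 205163983024656) (.r 71 (.l 0 205163980935696) (.d 11))) (.f
  10 (.l 22 12611791106586))) (.f 8 (.r 43 (.m 2363781836014285242465) (.r 67 (.m
  2363784087814501580865) (.r 55 (.r 19 (.m 2366227291161566969955) (.f 7 (.m
  1770961749266338431075))) (.f 7 (.m 2363925951751980597345))))))) (.f 10 (.l 22 9325605368346)))
def c362 : L := L.mk 10311700662328274293353303500232858116751873 620832911915100683175943 (.r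
  94 (.r 56 (.l 3 205163983024656) (.f 8 (.r 47 (.l 2 205163983024656) (.r 83 (.l 2
  205163932705296) (.d 11))))) (.r 46 (.l 0 205163983024656) (.r 82 (.l 0 205163932705296) (.d
  10))))
def c363 : L := L.mk 40280080712219821458410620362021818008065 620832911915100683175943 (.r 33
  (.l 0 205163983024656) (.r 45 (.l 0 152400276366096) (.r 57 (.l 0 205163982894096) (.d 9))))
def c364 : L := L.mk 157344065282108677571915625966742995457 620832911915100683175943 (.r 23 (.l
  0 205163983024656) (.r 47 (.l 0 205163983016496) (.d 11)))
def c365 : L := L.mk 173001629336162026460409318683388244683422316036609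
  10415847863113826032962700380167 (.r 82 (.l 0 205163967296016) (.r 79 (.r 18 (.m
  2361257564049120436245) (.f 6 (.m 2370479801381388034065))) (.f 6 (.m 2361291332791400669205))))
def c366 : L := L.mk 614625254996095540183920581978292737 620832911915100683175943 (.r 80 (.l 1
  205163983024656) (.r 83 (.l 1 152400309731616) (.f 8 (.f 11 (.r 81 (.r 82 (.l 1 205163967296016)
  (.r 94 (.l 1 204133175144976) (.f 10 (.l 10 151369501844496)))) (.r 21 (.l 0 205163983024656)
  (.r 33 (.l 0 152400309793056) (.r 45 (.l 0 152400309788976) (.d 9)))))))))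
def c367 : L := L.mk 2400879902276274818614899566117377 620832911915100683175943 (.r 70 (.l 0
  205163983024656) (.r 82 (.l 0 205163967296016) (.f 10 (.r 68 (.l 0 205163980935696) (.f 8 (.l 0
  205163964162576))))))
def c368 : L := L.mk 173001606164292592633947163190798336552752627515905 144492872927751 (.r 79
  (.r 19 (.m 2398366121184675495945) (.r 43 (.m 2398366121596992356355) (.f 7 (.m
  2398366139186761760835)))) (.r 19 (.r 22 (.m 2513657147807171092545) (.f 10 (.l 29
  12610450047786))) (.f 7 (.m 2398366138774444900425))))
def c369 : L := L.mk 10311699280953330979206317867337565255959041 158933225450357390874118407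
  (.r 45 (.r 58 (.r 71 (.l 0 205163983024656) (.f 11 (.l 0 151369499632416))) (.f 10 (.l 30
  12611255349786))) (.f 9 (.l 30 12611003695641)))
def c370 : L := L.mk 40280075316223934587894161658241806959105 40686905715291492063774312455 (.r
  56 (.l 0 205163983024656) (.r 47 (.l 0 151369501851936) (.f 8 (.f 11 (.r 22 (.m
  2361472624108287041625) (.f 10 (.m 2379918242548379820105)))))))
def c371 : L := L.mk 157344044203999744483024523382562685441 40686905715291492063774312455 (.r
  34 (.l 0 205163983024656) (.r 58 (.l 0 205163982894096) (.d 10)))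
def c372 : L := L.mk 614625172671874001886517672011825665 40686905715291492063774312455 (.r 21
  (.l 0 205163983024656) (.r 33 (.l 0 152400309731616) (.d 9)))
def c373 : L := L.mk 2400879564985971146133359823094273 40686905715291492063774312455 (.r 82 (.l
  0 205163983024656) (.f 10 (.r 81 (.l 0 205163967296016) (.f 9 (.r 14 (.m 1180735877742555832425)
  (.r 15 (.m 2808805050782937260145) (.r 16 (.m 1180735737039427215465) (.r 19 (.m
  2513657145607879401585) (.r 23 (.m 2366083193020350472305) (.f 1 (.f 11 (.m
  2453705227364432617485))))))))))))
def c374 : L := L.mk 9378435753225431043912874787329 620832911915100683175943 (.r 93 (.l 6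
  205163983024656) (.r 94 (.l 6 204133190873616) (.r 69 (.l 0 205163983024656) (.r 81 (.l 0
  205163967296016) (.d 9)))))
def c375 : L := L.mk 36634514383682923041174782465 620832911915100683175943 (.r 59 (.l 0
  205163983024656) (.r 71 (.l 0 205163982041616) (.d 11)))
def c376 : L := L.mk 143103571158505549662978561 620832911915100683175943 (.r 44 (.l 0
  205163983024656) (.r 56 (.l 0 205163982963216) (.d 8)))
def c377 : L := L.mk 558998320600390178112001 620832911915100683175943 (.r 35 (.l 0
  205163983024656) (.r 47 (.l 0 205163983020816) (.d 11)))
def c378 : L := L.mk 2183587174447799534081 47413004295 (.r 105 (.l 39 205163983024656) (.r 106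
  (.l 39 204133190873616) (.r 119 (.l 39 152400309793296) (.r 131 (.l 39 151369517642256) (.r 107
  (.r 93 (.l 39 205159956492816) (.r 21 (.l 24 205163983024656) (.r 33 (.l 24 205163983024416) (.r
  45 (.l 24 205163983020336) (.d 9))))) (.r 20 (.l 0 205163983024656) (.r 32 (.l 0
  205163983024416) (.r 44 (.l 0 205163983020336) (.r 56 (.l 0 205163982954816) (.r 68 (.l 0
  205163981906256) (.d 8)))))))))))
def c379 : L := L.mk 173064696025323576143135461108335787630069444444673 33546 (.r 58 (.m
  2361476011149092200545) (.r 70 (.m 2361480514748719571025) (.r 82 (.m 2361489521947974311985)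
  (.f 10 (.l 0 100485214712346)))))
def c380 : L := L.mk 676033968848920219309122847674781950968166810113 2205616649 (.r 45 (.l 0
  205163983024656) (.r 57 (.l 0 205163982963216) (.r 69 (.l 0 205163981918736) (.r 81 (.l 0
  205163965145616) (.d 9)))))
def c381 : L := L.mk 2640757690816094606676261123079958451758236161 144548920166664 (.r 32 (.l 0
  205163983024656) (.r 44 (.l 0 205163983020816) (.r 56 (.l 0 205163982955536) (.r 68 (.l 0
  205163981907216) (.d 8)))))
def c382 : L := L.mk 2903539670135172874002153093708723142581931852348346532353 7825673 (.r 45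
  (.m 2361472637298266349585) (.r 69 (.m 2361472633999597248585) (.f 9 (.l 3 153176694473241))))
def c383 : L := L.mk 2903539670135172874002153093708723137674881755959492018689 564644088329 (.r
  34 (.l 0 205163983024656) (.r 58 (.l 0 205163982894096) (.r 82 (.l 0 205163949340176) (.f 10 (.m
  2398365005042665136205)))))
def c384 : L := L.mk 2903539670135172001846473035805107606989211008211798393345 2204043783 (.r
  79 (.r 22 (.m 2361331880566716375045) (.r 34 (.m 2361472633037524828185) (.r 46 (.m
  2361331880154399539205) (.f 10 (.m 2361476011149058900005))))) (.r 19 (.r 31 (.m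
  2361331950384693911625) (.r 43 (.m 2361328572682893533265) (.f 7 (.m 2361328571035907268705))))
  (.r 43 (.r 31 (.m 2361331950384693936195) (.f 7 (.m 2361328570623590432865))) (.f 7 (.l 5
  65287975621671)))))
def c385 : L := L.mk 11341951836465515632212785295793326618258910232617091585
  9473156199299549447 (.r 45 (.l 0 205163983024656) (.r 69 (.l 0 205163980935696) (.d 9)))
def c386 : L := L.mk 44304499361193420438331192561692682102276995644850689
  2425128561025883899911 (.r 81 (.r 19 (.l 2 205163983024656) (.r 31 (.l 2 205099542724896) (.r 43
  (.l 2 205163983016496) (.r 55 (.l 2 205099542716736) (.d 7))))) (.r 21 (.l 0 205163983024656)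
  (.r 45 (.l 0 205163983016496) (.r 69 (.l 0 205163980919376) (.d 9)))))
def c387 : L := L.mk 173064450629661798404527979666803891406995382796801 2425128561025883899911
  (.r 68 (.l 0 205163983024656) (.r 69 (.l 0 205099558453536) (.r 80 (.l 0 205163967296016) (.r 81
  (.l 0 205099542724896) (.f 8 (.f 9 (.r 14 (.m 2379774197453698375785) (.r 15 (.m
  2379774197453765484645) (.r 16 (.m 2370550825417044926565) (.r 67 (.r 17 (.m
  2370550816623367823445) (.r 19 (.m 2370550816623367823445) (.f 1 (.m 2361329626292464656465))))
  (.r 70 (.l 73 10631444316696) (.r 17 (.r 29 (.m 2379774197453698506825) (.f 5 (.m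
  590692129462653321285))) (.f 5 (.m 590692129600092274755))))))))))))))
def c388 : L := L.mk 676033010272116400014588901158867136496793747969 2425128561025883899911 (.r
  57 (.l 0 205163983024656) (.r 69 (.l 0 205163982041616) (.r 81 (.l 0 205163965329936) (.d 9))))
def c389 : L := L.mk 2640753946375454687556945356238555014930563585 2425128561025883899911 (.r
  44 (.l 0 205163983024656) (.r 56 (.l 0 205163982963216) (.r 68 (.l 0 205163981918736) (.d 8))))
def c390 : L := L.mk 10315445103029119873269317076371092743062017 2425128561025883899911 (.r 33
  (.l 0 205163983024656) (.r 45 (.l 0 205163983020816) (.r 57 (.l 0 205163982955536) (.d 9))))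
def c391 : L := L.mk 40294707433707499504958269814177106428417 9473158397131556871 (.r 105 (.r
  19 (.l 9 205163983024656) (.r 31 (.l 9 205163983024416) (.r 43 (.l 9 205163983020336) (.r 55 (.l
  9 205163982954816) (.d 7))))) (.r 20 (.l 0 205163983024656) (.r 32 (.l 0 205163983024416) (.r 44
  (.l 0 205163983020336) (.r 56 (.l 0 205163982954816) (.d 8))))))
def c392 : L := L.mk 11341950369053919485512248965795761642778059511794172417 8609290 (.r 14 (.m
  2361620112591594479625) (.r 22 (.m 2361476010875221057545) (.r 28 (.m 2361329641425509302275)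
  (.r 29 (.m 2361329701883884879875) (.r 31 (.m 2361329701883884879875) (.r 34 (.m
  2361476011152782671875) (.f 2 (.f 10 (.m 2361475986414443184195)))))))))
def c393 : L := L.mk 44304493629116872990282222522639674820699177047228929 144548892117513 (.r
  33 (.l 0 205163983024656) (.r 81 (.l 0 205163915916816) (.f 9 (.l 14 153245145449241))))
def c394 : L := L.mk 44304493629113805090508421528956137765317836519178753 8609290 (.r 15 (.m
  2361620108468425891905) (.r 22 (.m 2361475993280385679425) (.r 40 (.m 2361256469064119779425)
  (.r 41 (.m 2361620108467922698305) (.r 43 (.m 2361620108467922567265) (.r 46 (.m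
  2361475993288436645985) (.f 3 (.f 10 (.m 2361475986414443184195)))))))))
def c395 : L := L.mk 173064428238725801134798521554927624909180652159489 9473158441490581768 (.r
  80 (.l 1 205163983024656) (.r 81 (.l 1 205099558511376) (.r 44 (.l 0 205163983024656) (.r 33 (.l
  0 205099558511376) (.f 8 (.f 9 (.m 2361329696659057680465)))))))
def c396 : L := L.mk 676032922807522498340894932856979561153818722817 620832911622987072473095
  (.r 67 (.l 0 205163983024656) (.r 68 (.l 0 204129164280096) (.r 69 (.l 0 203029921022256) (.r 70
  (.l 0 201866253251136) (.r 79 (.l 0 205163967296016) (.r 80 (.l 0 204129148551456) (.r 81 (.l 0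
  203029905293616) (.r 82 (.l 0 201866237522496) (.f 7 (.f 8 (.f 9 (.f 10 (.m
  1180735745251612836195)))))))))))))
def c397 : L := L.mk 2640753604716884755737320592143831934643143169 620832911622987072473095 (.r
  58 (.l 0 205163983024656) (.r 70 (.l 0 205163982041616) (.r 82 (.l 0 205163965329936) (.d 10))))
def c398 : L := L.mk 10315443768425331077051628908342381702742529 620832911622987072473095 (.r
  45 (.l 0 205163983024656) (.r 57 (.l 0 205163982963216) (.r 69 (.l 0 205163981918736) (.d 9))))
def c399 : L := L.mk 40294702220411449519732275764668217360897 620832911622987072473095 (.r 32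
  (.l 0 205163983024656) (.r 44 (.l 0 205163983020816) (.r 56 (.l 0 205163982955536) (.d 8))))
def c400 : L := L.mk 157401180548482224686454187907772252673 9473158397131556871 (.r 94 (.l 8
  205163983024656) (.r 105 (.l 8 204129164341776) (.r 19 (.l 0 205163983024656) (.r 31 (.l 0
  205163983024416) (.r 43 (.l 0 205163983020336) (.r 55 (.l 0 205163982954816) (.d 7)))))))
def c401 : L := L.mk 11341576224634937000266219491837474006111641557860024833 512903219464 (.r
  20 (.m 2361617858592489087045) (.r 32 (.r 45 (.m 2361489521948511182865) (.r 57 (.m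
  2361489522498266996745) (.r 69 (.m 2361489523597241819145) (.f 9 (.m 2361345390815037382665)))))
  (.f 8 (.l 22 188154354488376))))
def c402 : L := L.mk 173058719247954982487333463667297376393552342483457
  620832911904462049183751 (.r 82 (.r 19 (.l 0 205163983024656) (.r 31 (.l 0 205163983024416) (.r
  43 (.l 0 205163983020336) (.d 7)))) (.f 10 (.l 23 202792942973466)))
def c403 : L := L.mk 676010622062323967480070118558627847213204832769 620832911904462049183751
  (.r 68 (.l 0 205163983024656) (.r 80 (.l 0 205163967296016) (.f 8 (.r 14 (.m
  2527636301254689300585) (.r 15 (.m 2527636301254756409445) (.r 16 (.m 2370838976630506922085)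
  (.r 19 (.m 2370838976630506922085) (.r 21 (.m 2361473768695126827105) (.f 1 (.r 27 (.m
  2527636301254756417635) (.r 28 (.m 2370838976630506930275) (.r 29 (.m 2527636301254689431625)
  (.r 30 (.m 2527636301254689562665) (.f 2 (.m 2361473741351418871905)))))))))))))))
def c404 : L := L.mk 2640666492430952995491882930958276603504951809 620832911904462049183751 (.r
  55 (.l 0 205163983024656) (.r 67 (.l 0 205163982041616) (.r 79 (.l 0 205163965329936) (.d 7))))
def c405 : L := L.mk 10315103486058410138588202428067522283766273 620832911904462049183751 (.r
  46 (.l 0 205163983024656) (.r 58 (.l 0 205163982963216) (.d 10)))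
def c406 : L := L.mk 40293372992415664603859372802032867148289 620832911904462049183751 (.r 34
  (.l 0 205163983024656) (.r 46 (.l 0 205163983020816) (.d 10)))
def c407 : L := L.mk 157395988251623689858825657411443032577 2425128562125395527687 (.r 94 (.l 6
  204133190873616) (.r 22 (.l 0 205163983024656) (.r 34 (.l 0 205163983024416) (.r 46 (.l 0
  205163983020336) (.d 10)))))
def c408 : L := L.mk 44285488198043914785252876337064649827728838254330369 37004520867105289 (.r
  21 (.r 46 (.m 2361489506552665612305) (.f 10 (.m 2361475995204027686985))) (.r 45 (.r 22 (.m
  2361489506146856747025) (.f 10 (.m 2361475995201947844675))) (.f 9 (.l 29 153038718653481))))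
def c409 : L := L.mk 675742922929148053351366346878507041816534254081 2425128279552316541191 (.r
  82 (.r 31 (.l 0 205163983024656) (.r 55 (.l 0 205163982894096) (.r 79 (.l 0 205163949340176) (.d
  7)))) (.f 10 (.l 30 202792942973466)))
def c410 : L := L.mk 2639620792691801959081175007163792112455188993 158933225450358494663870471
  (.r 68 (.l 0 205163983024656) (.r 80 (.l 0 205163967296016) (.d 8)))
def c411 : L := L.mk 10311018721452347994656433839510662104154625 158933225450358494663870471
  (.r 58 (.l 0 205163983024656) (.r 70 (.l 0 205163982041616) (.d 10)))
def c412 : L := L.mk 40277416880673234311606156102331185431041 158933225450358494663870471 (.r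
  44 (.l 0 205163983024656) (.r 56 (.l 0 205163982963216) (.d 8)))
def c413 : L := L.mk 157333659690129821528918053917909254657 158933225450358494663870471 (.r 34
  (.l 0 205163983024656) (.r 46 (.l 0 205163983020816) (.d 10)))
def c414 : L := L.mk 614584608164569615347320750642233857 9473158397131556871 (.r 106 (.l 13
  205163983024656) (.r 105 (.l 6 205163983024656) (.r 94 (.l 6 202836647621136) (.r 20 (.l 0
  205163983024656) (.r 32 (.l 0 205163983024416) (.r 44 (.l 0 205163983020336) (.r 56 (.l 0
  205163982954816) (.d 8))))))))
def c415 : L := L.mk 11336697663392717473024643703842634268555195875519037953 1802135816 (.r 14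
  (.m 2361228313187839909905) (.r 15 (.m 2361616745884440076305) (.r 16 (.m
  2361309377975763935265) (.r 18 (.m 2361228313186766430225) (.r 20 (.m 2361273324448457433105)
  (.f 1 (.f 8 (.m 2361472616411303518305))))))))
def c416 : L := L.mk 44283975247627802629002511991036674822813716247151105
  40686905715291774990449969159 (.r 43 (.l 0 205163983024656) (.r 56 (.l 0 204129148551456) (.r 69
  (.l 0 202836612108816) (.r 82 (.l 0 201801777635616) (.f 7 (.f 8 (.f 9 (.f 10 (.m
  2361472074348178767885)))))))))
def c417 : L := L.mk 172984278311046104019541062455376112671777410449921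
  40686905715291774990449969159 (.r 34 (.l 0 205163983024656) (.r 82 (.l 0 205163915916816) (.d
  10)))
def c418 : L := L.mk 2639530601893062773536436316458860991977030145
  40686905715291774990449969159 (.r 80 (.r 21 (.l 0 205163983024656) (.r 33 (.l 0 205159940763936)
  (.d 9))) (.f 8 (.l 39 205129371628056)))
def c419 : L := L.mk 10310666413482434547334737404693778081710593 40686905715291774990449969159
  (.r 67 (.l 0 205163983024656) (.r 79 (.l 0 205163967296016) (.d 7)))
def c420 : L := L.mk 40276040677662353150286989242608956670465 40686905715291774990449969159 (.r
  58 (.l 0 205163983024656) (.r 70 (.l 0 205163982041616) (.d 10)))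
def c421 : L := L.mk 157328283897118519713653832267149279745 40686905715291774990449969159 (.r
  45 (.l 0 205163983024656) (.r 57 (.l 0 205163982963216) (.d 9)))
def c422 : L := L.mk 614563608973119216981801738082386433 40686905715291774990449969159 (.r 32
  (.l 0 205163983024656) (.r 44 (.l 0 205163983020816) (.d 8)))
def c423 : L := L.mk 8528698412944785921 47413004295 (.r 95 (.l 44 205163983024656) (.r 107 (.l
  44 205159956492816) (.r 119 (.l 44 202836647621136) (.r 131 (.l 44 202832621089296) (.f 11 (.r
  93 (.l 8 205163983024656) (.r 94 (.l 8 204133190873616) (.r 105 (.l 8 205159956492816) (.r 106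
  (.l 8 204129164341776) (.r 19 (.l 0 205163983024656) (.r 31 (.l 0 205163983024416) (.r 43 (.l 0
  205163983020336) (.r 55 (.l 0 205163982954816) (.r 67 (.l 0 205163981906256) (.d
  7)))))))))))))))
def c424 : L := L.mk 2338431563783529085744685022107375520637658957805456130561 2205641483 (.r
  16 (.m 2379954279870973878345) (.r 18 (.m 2435294512092102533145) (.r 23 (.m
  2361507540195310837785) (.f 11 (.r 14 (.m 2361480527393169891345) (.r 15 (.m
  2361480527393102798865) (.f 1 (.m 2361473764365800308770))))))))
def c425 : L := L.mk 9134498296029410491190175867606935627490558431476253185 37004572440988425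
  (.r 21 (.l 0 205163983024656) (.r 45 (.l 0 205163983016496) (.d 9)))
def c426 : L := L.mk 139381382690183259172202630511515984869783549182465 2425131659498489579784
  (.r 83 (.r 32 (.l 0 205163983024656) (.r 56 (.l 0 205163982894096) (.d 8))) (.f 11 (.r 14 (.m
  2379927267068832931905) (.r 15 (.m 2366119206417764196945) (.r 16 (.m 2366092209013550817345)
  (.r 17 (.m 2366119204768899408465) (.r 18 (.m 2361480524094635253765) (.f 1 (.m
  2366092183172745798225)))))))))
def c427 : L := L.mk 544458526133517788844149902388130693322190815745 620833704831613332490504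
  (.r 70 (.l 0 205163983024656) (.r 83 (.l 0 188606868308256) (.f 10 (.f 11 (.l 0
  188671308608016)))))
def c428 : L := L.mk 2126791117709053859265665057544564650396549633 620833704831613332490504 (.r
  57 (.l 0 205163983024656) (.r 83 (.l 0 170117016465936) (.f 9 (.f 11 (.m
  2361328502314153549905)))))
def c429 : L := L.mk 8307777803550991637713965145987599594357249 620833704831613332490504 (.r 44
  (.l 0 205163983024656) (.r 57 (.l 0 188606868308256) (.r 70 (.l 0 202973547614736) (.r 83 (.l 0
  186416432898336) (.f 8 (.f 9 (.f 10 (.f 11 (.m 2361507542393998557195)))))))))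
def c430 : L := L.mk 32452257045121061084819383139632215687681 620833704831613332490504 (.r 33
  (.l 0 205163983024656) (.r 57 (.l 0 205163982894096) (.d 9)))
def c431 : L := L.mk 126766629082504144862575699991713743361 620833704831613332490504 (.r 20 (.l
  0 205163983024656) (.r 32 (.l 0 188671308546336) (.d 8)))
def c432 : L := L.mk 495182144837773038312117058178056705 620833704831613332490504 (.r 81 (.l 0
  205163983024656) (.f 9 (.r 80 (.l 0 167926580797776) (.f 8 (.r 14 (.m 590370261589629083745) (.r
  15 (.m 590372450717342378085) (.r 16 (.m 590370120886500466785) (.r 19 (.m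
  590372380365778069605) (.r 23 (.m 2365939061352485101665) (.f 1 (.f 11 (.m
  2435118854384969588745))))))))))))
def c433 : L := L.mk 1934305253229809028577616615113217 620833704831209588721671 (.r 105 (.l 9
  204004341854736) (.r 68 (.l 0 205163983024656) (.r 80 (.l 0 205163967296016) (.d 8))))
def c434 : L := L.mk 7555879895188337534617478431233 620833704831209588721671 (.r 59 (.l 0
  205163983024656) (.r 71 (.l 0 205163982041616) (.d 11)))
def c435 : L := L.mk 29515155839783133188987224577 620833704831209588721671 (.r 46 (.l 0
  205163983024656) (.r 58 (.l 0 205163982963216) (.d 10)))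
def c436 : L := L.mk 115293577495476092824388097 620833704831209588721671 (.r 35 (.l 0
  205163983024656) (.r 47 (.l 0 205163983020816) (.d 11)))
def c437 : L := L.mk 35306022138195734969857394068605383739026125082526209
  2203695575689809496328 (.r 33 (.r 21 (.m 2361331888827075141705) (.f 9 (.l 0 141536744784681)))
  (.f 9 (.m 2361508666094747918385)))
def c438 : L := L.mk 538727144429375904690542731297091734080200049153 2203695575689809496328 (.r
  81 (.r 20 (.l 0 205163983024656) (.r 32 (.l 0 205163983024416) (.d 8))) (.f 9 (.r 14 (.m
  2361331957529372008545) (.r 15 (.m 2361331888809966575685) (.r 17 (.m 2361331887161101787205)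
  (.r 19 (.m 2361331887177807700065) (.r 20 (.m 2361331887177807700065) (.f 1 (.f 8 (.m
  2398220871158869270605))))))))))
def c439 : L := L.mk 2104402907927066924456155254356456792721129985 2203695575689809496328 (.r
  68 (.l 0 205163983024656) (.r 80 (.l 0 205163967296016) (.d 8)))
def c440 : L := L.mk 8220323859090102075137460252012828166390273 2203695575689809496328 (.r 57
  (.l 0 205163983024656) (.r 69 (.l 0 205163982041616) (.d 9)))
def c441 : L := L.mk 32110640074570711188485166086918701777409 2203695575286065727495 (.r 105
  (.l 17 204004341854736) (.r 44 (.l 0 205163983024656) (.r 56 (.l 0 205163982963216) (.d 8))))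
def c442 : L := L.mk 445624632086321227301377 2425131657989362092039 (.r 107 (.l 18
  188606884098576) (.r 95 (.l 5 205163983024656) (.f 11 (.r 34 (.l 0 205163983024656) (.r 46 (.l 0
  205163983020816) (.d 10))))))
def c443 : L := L.mk 1740721201490694439425 2425131657989362092039 (.r 22 (.l 0 205163983024656)
  (.r 34 (.l 0 205163983024416) (.d 10)))
def c444 : L := L.mk 601526038823673756663322424008948403059172770305 131350491957512 (.r 32 (.r
  45 (.m 2361480514748719571025) (.r 57 (.m 2361480515298475384905) (.f 9 (.m
  2361476012794065723465)))) (.r 44 (.r 33 (.m 2361480497160828493905) (.r 57 (.m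
  2361480515298542493765) (.f 9 (.m 2361476012794132832325)))) (.f 8 (.l 20 204724069880856))))
def c445 : L := L.mk 532994019115675294423633158323405806581085045249 2203695575689809496328 (.r
  44 (.r 21 (.m 2361480505956920991825) (.f 9 (.m 2361480515294248575045))) (.f 8 (.l 1
  159065043190296)))
def c446 : L := L.mk 2082007887170606618842316840160727253395898881 2203695575689809496328 (.r
  33 (.l 0 205163983024656) (.r 45 (.l 0 205163983020816) (.d 9)))
def c447 : L := L.mk 6727258561996587521 9473170130982209543 (.r 106 (.l 23 205099558515216) (.r
  94 (.l 3 205163983024656) (.f 10 (.r 107 (.l 23 188606884098576) (.r 95 (.l 3 188606884098576)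
  (.f 11 (.r 105 (.r 19 (.l 2 205163983024656) (.r 31 (.l 2 205163983024416) (.r 43 (.l 2
  205163983020336) (.d 7)))) (.r 20 (.l 0 205163983024656) (.r 32 (.l 0 205163983024416) (.r 44
  (.l 0 205163983020336) (.r 56 (.l 0 205163982954816) (.r 68 (.l 0 205163981906256) (.d
  8)))))))))))))
def c448 : L := L.mk 25902316469289473 47413004295 (.r 118 (.l 24 205163983024656) (.r 119 (.l
  24 188671308608016) (.r 131 (.l 24 171147842040336) (.r 93 (.l 0 205163983024656) (.r 94 (.l 0
  204133190873616) (.r 95 (.l 0 186609724305936) (.r 105 (.l 0 205159956492816) (.r 106 (.l 0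
  204129164341776) (.r 107 (.l 0 186605697774096) (.f 9 (.f 10 (.f 11 (.r 14 (.m
  2361480515294179893321) (.r 15 (.m 2361480515294247002181) (.r 16 (.m 2361480514744625406021)
  (.r 17 (.m 2361476011145266470981) (.r 18 (.m 2361476011145803341861) (.f 1 (.r 27 (.m
  2361480515294247010755) (.r 28 (.m 2361480514744625414595) (.r 29 (.m 2361476011145266479555)
  (.r 30 (.m 2361476011145803350435) (.f 2 (.m 2361480515294181466185))))))))))))))))))))))))
def c449 : L := L.mk 6618611909121 47413004295 (.r 92 (.l 0 205163983024656) (.r 93 (.l 0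
  205099558515216) (.r 94 (.l 0 204004341854736) (.r 95 (.l 0 186416450777616) (.r 105 (.l 0
  205031107473936) (.r 106 (.l 0 203935890813456) (.r 107 (.l 0 186347999736336) (.r 118 (.l 0
  202836647621136) (.r 119 (.l 0 185248756544016) (.r 131 (.l 0 167656838935056) (.f 7 (.f 8 (.f 9
  (.f 10 (.f 11 (.m 2361480515298542501955))))))))))))))))
def lems : List L :=
  [c0, c1, c2, c3, c4, c5, c6, c7, c8, c9, c10, c11, c12, c13, c14, c15, c16, c17, c18, c19, c20,
  c21, c22, c23, c24, c25, c26, c27, c28, c29, c30, c31, c32, c33, c34, c35, c36, c37, c38, c39,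
  c40, c41, c42, c43, c44, c45, c46, c47, c48, c49, c50, c51, c52, c53, c54, c55, c56, c57, c58,
  c59, c60, c61, c62, c63, c64, c65, c66, c67, c68, c69, c70, c71, c72, c73, c74, c75, c76, c77,
  c78, c79, c80, c81, c82, c83, c84, c85, c86, c87, c88, c89, c90, c91, c92, c93, c94, c95, c96,
  c97, c98, c99, c100, c101, c102, c103, c104, c105, c106, c107, c108, c109, c110, c111, c112,
  c113, c114, c115, c116, c117, c118, c119, c120, c121, c122, c123, c124, c125, c126, c127, c128,
  c129, c130, c131, c132, c133, c134, c135, c136, c137, c138, c139, c140, c141, c142, c143, c144,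
  c145, c146, c147, c148, c149, c150, c151, c152, c153, c154, c155, c156, c157, c158, c159, c160,
  c161, c162, c163, c164, c165, c166, c167, c168, c169, c170, c171, c172, c173, c174, c175, c176,
  c177, c178, c179, c180, c181, c182, c183, c184, c185, c186, c187, c188, c189, c190, c191, c192,
  c193, c194, c195, c196, c197, c198, c199, c200, c201, c202, c203, c204, c205, c206, c207, c208,
  c209, c210, c211, c212, c213, c214, c215, c216, c217, c218, c219, c220, c221, c222, c223, c224,
  c225, c226, c227, c228, c229, c230, c231, c232, c233, c234, c235, c236, c237, c238, c239, c240,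
  c241, c242, c243, c244, c245, c246, c247, c248, c249, c250, c251, c252, c253, c254, c255, c256,
  c257, c258, c259, c260, c261, c262, c263, c264, c265, c266, c267, c268, c269, c270, c271, c272,
  c273, c274, c275, c276, c277, c278, c279, c280, c281, c282, c283, c284, c285, c286, c287, c288,
  c289, c290, c291, c292, c293, c294, c295, c296, c297, c298, c299, c300, c301, c302, c303, c304,
  c305, c306, c307, c308, c309, c310, c311, c312, c313, c314, c315, c316, c317, c318, c319, c320,
  c321, c322, c323, c324, c325, c326, c327, c328, c329, c330, c331, c332, c333, c334, c335, c336,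
  c337, c338, c339, c340, c341, c342, c343, c344, c345, c346, c347, c348, c349, c350, c351, c352,
  c353, c354, c355, c356, c357, c358, c359, c360, c361, c362, c363, c364, c365, c366, c367, c368,
  c369, c370, c371, c372, c373, c374, c375, c376, c377, c378, c379, c380, c381, c382, c383, c384,
  c385, c386, c387, c388, c389, c390, c391, c392, c393, c394, c395, c396, c397, c398, c399, c400,
  c401, c402, c403, c404, c405, c406, c407, c408, c409, c410, c411, c412, c413, c414, c415, c416,
  c417, c418, c419, c420, c421, c422, c423, c424, c425, c426, c427, c428, c429, c430, c431, c432,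
  c433, c434, c435, c436, c437, c438, c439, c440, c441, c442, c443, c444, c445, c446, c447, c448,
  c449]

theorem run_ok : run lems [] = true := by decide +kernel

theorem ref_start : Ref 6618611909121 47413004295 :=
  run_spec lems [] run_ok (fun _ h => absurd h (by simp)) c449 (by
    unfold lems
    repeat (first | exact List.mem_cons_self | apply List.mem_cons_of_mem))

end K6

theorem order12_minDegree6_hasK6Minor {V : Type*} [Fintype V] (G : SimpleGraph V)
    (hcard : Fintype.card V = 12) (hdeg : ∀ v : V, 6 ≤ G.degree v) :
    G.HasCompleteMinor 6 := by
  exact K6.main_of_ref K6.ref_start G hcard fun v => by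
    have h := hdeg v
    rw [← SimpleGraph.card_neighborSet_eq_degree, ← Nat.card_eq_fintype_card] at h
    exact h
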